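/- Let Ψ ∈ P_dLV_{n+d}(ℝⁿ). Then there exists a unique continuous map ψ assigning to each x ∈ ℝⁿ a homogeneous complex-valued polynomial ψ(x) of degree d on ℝ × ℝⁿ such that Ψ(f;B) = ∫_B ψ(x)[f(x), ∇f(x)] · det(D²f(x)) dx for every f ∈ Conv(ℝⁿ,ℝ) ∩ C²(ℝⁿ) and every bounded Borel set B ⊂ ℝⁿ (here ∇f and D²f denote gradient and Hessian). Conversely, for every such continuous map ψ there exists an element of P_dLV_{n+d}(ℝⁿ) satisfying this formula on all C² convex functions. -/

import Mathlib

open scoped CompactlySupported NNReal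

noncomputable section

abbrev Eucl (n : ℕ) := EuclideanSpace ℝ (Fin n)

def RadonMeasure (n : ℕ) : Submodule ℂ (C_c(Eucl n, ℂ) →ₗ[ℂ] ℂ) where
  carrier := {μ | ∀ A : Set (Eucl n), IsCompact A → ∃ C : ℝ, ∀ φ : C_c(Eucl n, ℂ),
      tsupport ⇑φ ⊆ A → (∀ x, ‖φ x‖ ≤ 1) → ‖μ φ‖ ≤ C}
  add_mem' := by
    intro μ ν hμ hν A hA
    obtain ⟨C₁, h₁⟩ := hμ A hA
    obtain ⟨C₂, h₂⟩ := hν A hA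
    refine ⟨C₁ + C₂, fun φ h h' => ?_⟩
    calc ‖(μ + ν) φ‖ = ‖μ φ + ν φ‖ := by simp
    _ ≤ ‖μ φ‖ + ‖ν φ‖ := norm_add_le _ _
    _ ≤ C₁ + C₂ := add_le_add (h₁ φ h h') (h₂ φ h h')
  zero_mem' := fun _ _ => ⟨0, fun φ _ _ => by simp⟩
  smul_mem' := by
    intro c μ hμ A hA
    obtain ⟨C, h⟩ := hμ A hA
    refine ⟨‖c‖ * C, fun φ hs hb => ?_⟩
    simp only [LinearMap.smul_apply, norm_smul]
    exact mul_le_mul_of_nonneg_left (h φ hs hb) (norm_nonneg c)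

abbrev ConvFn (n : ℕ) := {f : C(Eucl n, ℝ) // ConvexOn ℝ Set.univ ⇑f}

def IsLocalFunctional {n : ℕ} (Ψ : ConvFn n → RadonMeasure n) : Prop :=
  ∀ (f h : ConvFn n) (U : Set (Eucl n)), IsOpen U → (∀ x ∈ U, f.1 x = h.1 x) →
    ∀ φ : C_c(Eucl n, ℂ), tsupport ⇑φ ⊆ U → (Ψ f).1 φ = (Ψ h).1 φ

def IsContinuousFunctional {n : ℕ} (Ψ : ConvFn n → RadonMeasure n) : Prop :=
  ∀ φ : C_c(Eucl n, ℂ), Continuous fun f : ConvFn n => (Ψ f).1 φ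

lemma convexOn_affine {n : ℕ} (s : ℝ) (v : Eucl n) :
    ConvexOn ℝ Set.univ (fun x : Eucl n => s + inner ℝ v x) := by
  refine ⟨convex_univ, fun x _ y _ a b _ _ hab => le_of_eq ?_⟩
  simp only [smul_eq_mul, inner_add_right, real_inner_smul_right]
  linear_combination s * hab.symm

/-- Add the affine function `ℓ(x) = s + ⟨v, x⟩` to a convex function. -/
def addAffine {n : ℕ} (f : ConvFn n) (s : ℝ) (v : Eucl n) : ConvFn n :=
  ⟨⟨fun x => f.1 x + (s + inner ℝ v x),
    (map_continuous f.1).add (continuous_const.add (Continuous.inner continuous_const continuous_id))⟩,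
    f.2.add (convexOn_affine s v)⟩

/-- `Ψ` is polynomial of degree at most `d`: for every `f` and `φ`, the map
`(s, v) ↦ Ψ(f + s + ⟨v, ·⟩)(φ)` is (the restriction of) a polynomial of degree at most `d`
on `ℝ × ℝⁿ`. -/
def IsPolynomialDeg {n : ℕ} (d : ℕ) (Ψ : ConvFn n → RadonMeasure n) : Prop :=
  ∀ (f : ConvFn n) (φ : C_c(Eucl n, ℂ)), ∃ P : MvPolynomial (Fin (n + 1)) ℂ,
    P.totalDegree ≤ d ∧ ∀ (s : ℝ) (v : Eucl n),
      (Ψ (addAffine f s v)).1 φ = MvPolynomial.eval (Fin.cons (s : ℂ) fun i => (v i : ℂ)) P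

/-- `P_dLV(ℝⁿ)`: continuous local functionals, polynomial of degree at most `d`. -/
def MemPdLV {n : ℕ} (d : ℕ) (Ψ : ConvFn n → RadonMeasure n) : Prop :=
  IsLocalFunctional Ψ ∧ IsContinuousFunctional Ψ ∧ IsPolynomialDeg d Ψ

/-- Multiply a convex function by a nonnegative scalar `t ≥ 0`. -/
def smulConv {n : ℕ} (t : ℝ≥0) (f : ConvFn n) : ConvFn n :=
  ⟨(t : ℝ) • f.1, by exact f.2.smul t.2⟩

/-- `Ψ` is homogeneous of degree `k`: `Ψ(t f) = t^k Ψ(f)` for `t ≥ 0`. -/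
def IsHomogeneousDeg {n : ℕ} (k : ℕ) (Ψ : ConvFn n → RadonMeasure n) : Prop :=
  ∀ (f : ConvFn n) (t : ℝ≥0), Ψ (smulConv t f) = ((t : ℝ) : ℂ) ^ k • Ψ f

open MeasureTheory

/-- The gradient `∇f(x)` of `f : ℝⁿ → ℝ`, in coordinates. -/
def gradVec {n : ℕ} (f : Eucl n → ℝ) (x : Eucl n) : Fin n → ℝ :=
  fun i => fderiv ℝ f x (EuclideanSpace.single i 1)

/-- The Hessian matrix `D²f(x)` of `f : ℝⁿ → ℝ`. -/
def hessMat {n : ℕ} (f : Eucl n → ℝ) (x : Eucl n) : Matrix (Fin n) (Fin n) ℝ :=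
  Matrix.of fun i j =>
    fderiv ℝ (fun y => fderiv ℝ f y (EuclideanSpace.single j 1)) x (EuclideanSpace.single i 1)

/-- The integral representation `Ψ(f; B) = ∫_B ψ(x)[f(x), ∇f(x)] det(D²f(x)) dx` for all
bounded Borel sets `B`, expressed by testing against all functions in `C_c(ℝⁿ, ℂ)`. -/
def TopDegreeRepresentation {n : ℕ} (Ψ : ConvFn n → RadonMeasure n)
    (ψ : Eucl n → MvPolynomial (Fin (n + 1)) ℂ) : Prop :=
  ∀ f : ConvFn n, ContDiff ℝ 2 ⇑f.1 → ∀ φ : C_c(Eucl n, ℂ),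
    (Ψ f).1 φ = ∫ x, φ x *
      MvPolynomial.eval (Fin.cons ((f.1 x : ℝ) : ℂ) fun i => ((gradVec (⇑f.1) x i : ℝ) : ℂ)) (ψ x)
      * (((hessMat (⇑f.1) x).det : ℝ) : ℂ) ∂(volume)

section Aux1
open MeasureTheory Filter Topology Metric

instance instFCConv (n : ℕ) : FirstCountableTopology (ConvFn n) := by
  have : FirstCountableTopology (C(Eucl n, ℝ)) := inferInstance
  exact Topology.IsInducing.subtypeVal.firstCountableTopology

variable {n : ℕ}

lemma addAffine_apply (f : ConvFn n) (s : ℝ) (v x : Eucl n) :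
    (addAffine f s v).1 x = f.1 x + (s + inner ℝ v x) := rfl

lemma smulConv_apply (t : ℝ≥0) (f : ConvFn n) (x : Eucl n) :
    (smulConv t f).1 x = t * f.1 x := rfl

lemma convFn_ext {f g : ConvFn n} (h : ∀ x, f.1 x = g.1 x) : f = g :=
  Subtype.ext (ContinuousMap.ext h)

lemma tendsto_convFn {ι : Type*} {l : Filter ι} {F : ι → ConvFn n} {f : ConvFn n}
    (h : ∀ R : ℝ, ∀ ε > 0, ∀ᶠ i in l, ∀ x : Eucl n, ‖x‖ ≤ R → |(F i).1 x - f.1 x| < ε) :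
    Tendsto F l (𝓝 f) := by
  rw [tendsto_subtype_rng, ContinuousMap.tendsto_iff_forall_isCompact_tendstoUniformlyOn]
  intro K hK
  rw [Metric.tendstoUniformlyOn_iff]
  intro ε hε
  obtain ⟨R, hR⟩ := hK.isBounded.exists_norm_le
  filter_upwards [h R ε hε] with i hi x hx
  rw [dist_comm, Real.dist_eq]
  exact hi x (hR x hx)

lemma convFn_tendsto_unif {ι : Type*} {l : Filter ι} {F : ι → ConvFn n} {f : ConvFn n}
    (h : Tendsto F l (𝓝 f)) (R : ℝ) (ε : ℝ) (hε : 0 < ε) :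
    ∀ᶠ i in l, ∀ x : Eucl n, ‖x‖ ≤ R → |(F i).1 x - f.1 x| < ε := by
  rw [tendsto_subtype_rng, ContinuousMap.tendsto_iff_forall_isCompact_tendstoUniformlyOn] at h
  have := h (closedBall 0 R) (isCompact_closedBall 0 R)
  rw [Metric.tendstoUniformlyOn_iff] at this
  filter_upwards [this ε hε] with i hi x hx
  have := hi x (by simpa using hx)
  rwa [dist_comm, Real.dist_eq] at this

/-- product of a test function and a continuous function -/
def mulC (φ : C_c(Eucl n, ℂ)) (u : C(Eucl n, ℂ)) : C_c(Eucl n, ℂ) :=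
  ⟨φ.1 * u, φ.2.mul_right⟩

lemma mulC_apply (φ : C_c(Eucl n, ℂ)) (u : C(Eucl n, ℂ)) (x : Eucl n) :
    mulC φ u x = φ x * u x := rfl

lemma cc_tsupport_compact (φ : C_c(Eucl n, ℂ)) : IsCompact (tsupport ⇑φ) := φ.2

lemma cc_tsupport_ball (φ : C_c(Eucl n, ℂ)) : ∃ R : ℝ, 0 < R ∧ tsupport ⇑φ ⊆ closedBall 0 R := by
  obtain ⟨R, hR⟩ := (cc_tsupport_compact φ).isBounded.subset_closedBall 0
  exact ⟨max R 1, by positivity, hR.trans (closedBall_subset_closedBall (le_max_left _ _))⟩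

lemma cc_bound (φ : C_c(Eucl n, ℂ)) : ∃ M : ℝ, 0 < M ∧ ∀ x, ‖φ x‖ ≤ M := by
  obtain ⟨M, hM⟩ := φ.2.exists_bound_of_continuous φ.1.continuous
  exact ⟨max M 1, by positivity, fun x => (hM x).trans (le_max_left _ _)⟩

lemma tsupport_mulC_left (φ : C_c(Eucl n, ℂ)) (u : C(Eucl n, ℂ)) :
    tsupport ⇑(mulC φ u) ⊆ tsupport ⇑φ :=
  closure_mono (fun x hx => by
    simp only [Function.mem_support, mulC_apply] at hx ⊢
    exact left_ne_zero_of_mul hx)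

lemma tsupport_mulC_right (φ : C_c(Eucl n, ℂ)) (u : C(Eucl n, ℂ)) :
    tsupport ⇑(mulC φ u) ⊆ tsupport ⇑u :=
  closure_mono (fun x hx => by
    simp only [Function.mem_support, mulC_apply] at hx ⊢
    exact right_ne_zero_of_mul hx)

/-- a radon measure has a bound scaling with the sup of the test function -/
lemma radon_bound (μ : RadonMeasure n) (A : Set (Eucl n)) (hA : IsCompact A) :
    ∃ C : ℝ, 0 ≤ C ∧ ∀ (φ : C_c(Eucl n, ℂ)) (M : ℝ), 0 < M → tsupport ⇑φ ⊆ A →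
      (∀ x, ‖φ x‖ ≤ M) → ‖μ.1 φ‖ ≤ C * M := by
  obtain ⟨C, hC⟩ := μ.2 A hA
  refine ⟨max C 0, le_max_right _ _, fun φ M hM hs hb => ?_⟩
  have key := hC (((M : ℂ)⁻¹) • φ) ?_ ?_
  · rw [map_smul, norm_smul, norm_inv, Complex.norm_real, Real.norm_of_nonneg hM.le,
      inv_mul_le_iff₀ hM] at key
    calc _ ≤ M * C := key
      _ ≤ _ := by rw [mul_comm]; gcongr; exact le_max_left _ _
  · refine (closure_mono (fun x hx => ?_)).trans hs
    simp only [Function.mem_support, CompactlySupportedContinuousMap.coe_smul, Pi.smul_apply, smul_eq_mul] at hx ⊢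
    exact right_ne_zero_of_mul hx
  · intro x
    simp only [CompactlySupportedContinuousMap.coe_smul, Pi.smul_apply, smul_eq_mul, norm_mul, norm_inv,
      Complex.norm_real, Real.norm_of_nonneg hM.le]
    rw [inv_mul_le_iff₀ hM, mul_one]; exact hb x

/-- cutoff functions -/
lemma exists_cutoff (A U : Set (Eucl n)) (hA : IsCompact A) (hU : IsOpen U) (hAU : A ⊆ U) :
    ∃ χ : C_c(Eucl n, ℂ), (∀ x ∈ A, χ x = 1) ∧ (∀ x, ‖χ x‖ ≤ 1) ∧ tsupport ⇑χ ⊆ U := by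
  obtain ⟨f, h1, h2, h3⟩ := exists_continuous_sum_one_of_isOpen_isCompact (n := 1) (t := A)
    (s := fun _ => U) (fun _ => hU) hA (fun x hx => Set.mem_iUnion.2 ⟨0, hAU hx⟩)
  have hsub : Function.support (fun x => ((f 0 x : ℝ) : ℂ)) = Function.support (f 0) := by
    ext x; simp
  refine ⟨⟨⟨fun x => ((f 0 x : ℝ) : ℂ), by fun_prop⟩, ?_⟩, ?_, ?_, ?_⟩
  · have := h3.2 0
    rw [HasCompactSupport, tsupport] at this ⊢
    rwa [show Function.support _ = _ from hsub]
  · intro x hx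
    have := h2 hx
    simp only [Finset.univ_unique, Fin.default_eq_zero, Finset.sum_singleton, Pi.one_apply] at this
    change ((f 0 x : ℝ) : ℂ) = 1
    rw [this]; simp
  · intro x
    change ‖((f 0 x : ℝ) : ℂ)‖ ≤ 1
    rw [Complex.norm_real, Real.norm_of_nonneg (h3.1 0 x).1]
    exact (h3.1 0 x).2
  · have := h1 0
    change closure (Function.support (fun x => ((f 0 x : ℝ) : ℂ))) ⊆ U
    rw [hsub]; exact this

/-- the functional `u ↦ Ψ(f)(χ u)` on bounded continuous functions -/
lemma exists_clm (μ : RadonMeasure n) (χ : C_c(Eucl n, ℂ)) :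
    ∃ T : (BoundedContinuousFunction (Eucl n) ℂ) →L[ℂ] ℂ, ∀ u, T u = μ.1 (mulC χ u.1) := by
  obtain ⟨C, hC0, hC⟩ := radon_bound μ _ (cc_tsupport_compact χ)
  obtain ⟨M, hM0, hM⟩ := cc_bound χ
  refine ⟨LinearMap.mkContinuous
    { toFun := fun u => μ.1 (mulC χ u.1)
      map_add' := ?_
      map_smul' := ?_ } (C * M) ?_, fun u => rfl⟩
  · intro u v
    rw [← map_add]; congr 1; ext x
    simp [mulC_apply, mul_add]
  · intro c u
    rw [RingHom.id_apply, ← map_smul]; congr 1; ext x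
    simp [mulC_apply]; ring
  · intro u
    rcases eq_or_ne u 0 with rfl | hu
    · have : mulC χ (0 : BoundedContinuousFunction (Eucl n) ℂ).1 = 0 := by
        ext x; simp [mulC_apply]
      simp [this]
    · have h := hC (mulC χ u.1) (M * ‖u‖) (by positivity) (tsupport_mulC_left _ _) (fun x => by
        rw [mulC_apply, norm_mul]
        exact mul_le_mul (hM x) (u.norm_coe_le_norm x) (norm_nonneg _) hM0.le)
      calc _ ≤ C * (M * ‖u‖) := h
        _ = _ := by ring

lemma lemmaA {k : ℕ} (Ψ : ConvFn n → RadonMeasure n) (hc : IsContinuousFunctional Ψ)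
    (hh : IsHomogeneousDeg k Ψ) (R L : ℝ) :
    ∃ C : ℝ, 0 ≤ C ∧ ∀ f : ConvFn n, (∀ x y, |f.1 x - f.1 y| ≤ L * ‖x - y‖) → |f.1 0| ≤ L →
      ∀ (φ : C_c(Eucl n, ℂ)) (M : ℝ), 0 ≤ M → tsupport ⇑φ ⊆ closedBall 0 R → (∀ x, ‖φ x‖ ≤ M) →
        ‖(Ψ f).1 φ‖ ≤ C * M := by
  obtain ⟨χ, hχ1, -, -⟩ := exists_cutoff (n := n) (closedBall 0 R) Set.univ (isCompact_closedBall 0 R)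
    isOpen_univ (Set.subset_univ _)
  choose T hT using fun f : ConvFn n => exists_clm (Ψ f) χ
  suffices H : ∃ C : ℝ, ∀ f : ConvFn n, (∀ x y, |f.1 x - f.1 y| ≤ L * ‖x - y‖) → |f.1 0| ≤ L →
      ‖T f‖ ≤ C by
    obtain ⟨C, hC⟩ := H
    refine ⟨max C 0, le_max_right _ _, fun f hf hf0 φ M hM hs hb => ?_⟩
    let u : BoundedContinuousFunction (Eucl n) ℂ := BoundedContinuousFunction.ofNormedAddCommGroup φ φ.1.continuous M hb
    have h1 : mulC χ u.1 = φ := by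
      ext x
      rw [mulC_apply]
      change χ x * φ x = φ x
      by_cases hx : x ∈ tsupport ⇑φ
      · rw [hχ1 x (hs hx), one_mul]
      · rw [image_eq_zero_of_notMem_tsupport hx, mul_zero]
    rw [← h1, ← hT f u]
    refine ((T f).le_opNorm u).trans ?_
    have hu : ‖u‖ ≤ M := BoundedContinuousFunction.norm_ofNormedAddCommGroup_le _ hM hb
    have := (hC f hf hf0).trans (le_max_left _ 0)
    gcongr
  by_contra hcon
  push Not at hcon
  choose F hF1 hF2 hF3 using fun j : ℕ => hcon ((j : ℝ) * ((2 : ℝ) ^ j) ^ k)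
  let G : ℕ → ConvFn n := fun j => smulConv ((2⁻¹ : ℝ≥0) ^ j) (F j)
  have hG : Tendsto G atTop (𝓝 (smulConv 0 (F 0))) := by
    apply tendsto_convFn
    intro R' ε hε
    have hlim : Tendsto (fun j : ℕ => ((2⁻¹ : ℝ)) ^ j * (L + |L| * |R'|)) atTop (𝓝 0) := by
      have := (tendsto_pow_atTop_nhds_zero_of_lt_one (r := (2⁻¹ : ℝ)) (by norm_num) (by norm_num)).mul_const (L + |L| * |R'|)
      simpa using this
    filter_upwards [hlim.eventually (gt_mem_nhds hε)] with j hj x hx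
    simp only [G, smulConv_apply, NNReal.coe_pow, NNReal.coe_inv, NNReal.coe_ofNat, NNReal.coe_zero, zero_mul, sub_zero]
    rw [abs_mul, abs_of_nonneg (by positivity)]
    refine lt_of_le_of_lt (mul_le_mul_of_nonneg_left ?_ (by positivity)) hj
    have h1 := hF1 j x 0
    have h2 := hF2 j
    have h3 : |(F j).1 x| ≤ |(F j).1 x - (F j).1 0| + |(F j).1 0| := by
      simpa using abs_add_le ((F j).1 x - (F j).1 0) ((F j).1 0)
    rw [sub_zero] at h1
    have : L * ‖x‖ ≤ |L| * |R'| :=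
      mul_le_mul (le_abs_self _) (hx.trans (le_abs_self _)) (norm_nonneg _) (abs_nonneg _)
    linarith
  obtain ⟨C', hC'⟩ := banach_steinhaus (g := fun j => T (G j)) (fun u => by
    have h := ((hc (mulC χ u.1)).tendsto _).comp hG
    obtain ⟨C, hC⟩ := h.norm.bddAbove_range
    refine ⟨C, fun j => ?_⟩
    have := hC ⟨j, rfl⟩
    simpa [hT] using this)
  have hrel : ∀ j, T (F j) = (((2 : ℝ) ^ j) ^ k : ℂ) • T (G j) := by
    intro j
    ext u
    rw [smul_apply, hT, hT]
    have := hh (F j) ((2⁻¹ : ℝ≥0) ^ j)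
    simp only [G, this]
    simp only [Submodule.coe_smul, LinearMap.smul_apply, smul_eq_mul]
    push_cast
    rw [← mul_assoc, ← mul_pow, ← mul_pow]
    norm_num
  obtain ⟨j, hj⟩ := exists_nat_gt C'
  have h1 := hF3 j
  rw [hrel, norm_smul] at h1
  have h2 := hC' j
  have h3 : ‖(((2 : ℝ) ^ j) ^ k : ℂ)‖ = ((2 : ℝ) ^ j) ^ k := by
    simp
  rw [h3, mul_comm] at h1
  have := lt_of_mul_lt_mul_left h1 (by positivity)
  linarith
end Aux1

section Aux2
open MeasureTheory Filter Topology Metric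
variable {n : ℕ}

/-- complex coordinate vector of an affine function -/
def wvec (s : ℝ) (v : Eucl n) : Fin (n + 1) → ℂ := Fin.cons (s : ℂ) fun i => (v i : ℂ)

lemma wvec_smul (c s : ℝ) (v : Eucl n) : wvec (c * s) (c • v) = fun i => (c : ℂ) * wvec s v i := by
  funext i
  refine Fin.cases ?_ (fun j => ?_) i <;> simp [wvec]

lemma hom_eval_smul {σ : Type*} [Fintype σ] {d : ℕ} {p : MvPolynomial σ ℂ} (hp : p.IsHomogeneous d) (c : ℂ)
    (w : σ → ℂ) : MvPolynomial.eval (fun i => c * w i) p = c ^ d * MvPolynomial.eval w p := by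
  rw [MvPolynomial.eval_eq', MvPolynomial.eval_eq', Finset.mul_sum]
  refine Finset.sum_congr rfl fun m hm => ?_
  have h := hp (MvPolynomial.mem_support_iff.1 hm)
  rw [Finsupp.weight_apply, Finsupp.sum_fintype _ _ (by simp)] at h
  simp only [Pi.one_apply, smul_eq_mul, mul_one] at h
  simp_rw [mul_pow]
  rw [Finset.prod_mul_distrib, Finset.prod_pow_eq_pow_sum, h]
  ring

lemma sum_homComp {σ : Type*} {d : ℕ} (p : MvPolynomial σ ℂ) (hp : p.totalDegree ≤ d) :
    p = ∑ j ∈ Finset.range (d + 1), MvPolynomial.homogeneousComponent j p := by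
  conv_lhs => rw [← MvPolynomial.sum_homogeneousComponent p]
  refine Finset.sum_subset (Finset.range_mono (by omega)) fun j _ hj => ?_
  apply MvPolynomial.homogeneousComponent_eq_zero
  simp at hj; omega

/-- Lagrange interpolation version of `t^{-n} Ψ(tG + ℓ)` -/
def Qf (d : ℕ) (Ψ : ConvFn n → RadonMeasure n) (φ : C_c(Eucl n, ℂ)) (t : ℝ) (G : ConvFn n) (s : ℝ)
    (v : Eucl n) : ℂ :=
  ∑ k ∈ Finset.range (d + 1),
    (Lagrange.basis (Finset.range (d + 1)) (fun k : ℕ => ((k : ℂ) + 1)) k).eval (t : ℂ) *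
      ((((k : ℂ) + 1) ^ n)⁻¹ * (Ψ (addAffine (smulConv ((k : ℝ≥0) + 1) G) s v)).1 φ)

lemma smul_addAffine_eq (t : ℝ≥0) (ht : 0 < t) (G : ConvFn n) (s : ℝ) (v : Eucl n) :
    addAffine (smulConv t G) s v = smulConv t (addAffine G ((t : ℝ)⁻¹ * s) ((t : ℝ)⁻¹ • v)) := by
  apply convFn_ext
  intro x
  have : (t : ℝ) ≠ 0 := by exact_mod_cast ht.ne'
  simp only [addAffine_apply, smulConv_apply, real_inner_smul_left]
  field_simp

lemma psi_scale {d : ℕ} {Ψ : ConvFn n → RadonMeasure n} (hh : IsHomogeneousDeg (n + d) Ψ)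
    (G : ConvFn n) (φ : C_c(Eucl n, ℂ)) (P : MvPolynomial (Fin (n + 1)) ℂ) (hPd : P.totalDegree ≤ d)
    (hP : ∀ (s : ℝ) (v : Eucl n), (Ψ (addAffine G s v)).1 φ = MvPolynomial.eval (wvec s v) P)
    (t : ℝ≥0) (ht : 0 < t) (s : ℝ) (v : Eucl n) :
    (Ψ (addAffine (smulConv t G) s v)).1 φ = ((t : ℝ) : ℂ) ^ n *
      ∑ j ∈ Finset.range (d + 1), ((t : ℝ) : ℂ) ^ (d - j) *
        MvPolynomial.eval (wvec s v) (MvPolynomial.homogeneousComponent j P) := by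
  rw [smul_addAffine_eq t ht, hh]
  simp only [Submodule.coe_smul, LinearMap.smul_apply, smul_eq_mul]
  rw [hP, wvec_smul]
  conv_lhs => rw [sum_homComp P hPd]
  have h0 : ((t : ℝ) : ℂ) ≠ 0 := by exact_mod_cast ht.ne'
  rw [map_sum, pow_add, mul_assoc, Finset.mul_sum]
  congr 1
  refine Finset.sum_congr rfl fun j hj => ?_
  rw [hom_eval_smul (MvPolynomial.homogeneousComponent_isHomogeneous j P), ← mul_assoc]
  congr 1
  rw [Finset.mem_range] at hj
  rw [pow_sub₀ _ h0 (by omega)]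
  simp

lemma Qf_eq_sum {d : ℕ} {Ψ : ConvFn n → RadonMeasure n} (hh : IsHomogeneousDeg (n + d) Ψ)
    (G : ConvFn n) (φ : C_c(Eucl n, ℂ)) (P : MvPolynomial (Fin (n + 1)) ℂ) (hPd : P.totalDegree ≤ d)
    (hP : ∀ (s : ℝ) (v : Eucl n), (Ψ (addAffine G s v)).1 φ = MvPolynomial.eval (wvec s v) P)
    (t : ℝ) (s : ℝ) (v : Eucl n) :
    Qf d Ψ φ t G s v = ∑ j ∈ Finset.range (d + 1), (t : ℂ) ^ (d - j) *
        MvPolynomial.eval (wvec s v) (MvPolynomial.homogeneousComponent j P) := by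
  let q : Polynomial ℂ := ∑ j ∈ Finset.range (d + 1), Polynomial.monomial (d - j)
    (MvPolynomial.eval (wvec s v) (MvPolynomial.homogeneousComponent j P))
  have hq : ∀ z : ℂ, q.eval z = ∑ j ∈ Finset.range (d + 1), z ^ (d - j) *
        MvPolynomial.eval (wvec s v) (MvPolynomial.homogeneousComponent j P) := by
    intro z
    simp only [q, Polynomial.eval_finsetSum, Polynomial.eval_monomial]
    exact Finset.sum_congr rfl fun j _ => mul_comm _ _
  have hdeg : q.degree < (Finset.range (d + 1)).card := by
    rw [Finset.card_range]
    refine lt_of_le_of_lt (Polynomial.degree_sum_le _ _) ?_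
    rw [Finset.sup_lt_iff (by exact_mod_cast WithBot.bot_lt_coe _)]
    intro j _
    refine lt_of_le_of_lt (Polynomial.degree_monomial_le _ _) ?_
    exact_mod_cast (by omega : d - j < d + 1)
  have hinj : Set.InjOn (fun k : ℕ => ((k : ℂ) + 1)) (Finset.range (d + 1)) := by
    intro a _ b _ h
    simpa using h
  have hint := Lagrange.eq_interpolate hinj hdeg
  rw [← hq, hint, Lagrange.interpolate_apply, Polynomial.eval_finsetSum, Qf]
  refine Finset.sum_congr rfl fun k _ => ?_
  rw [psi_scale hh G φ P hPd hP ((k : ℝ≥0) + 1) (by positivity), Polynomial.eval_mul, Polynomial.eval_C, hq, mul_comm]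
  congr 1
  push_cast
  have : ((k : ℂ) + 1) ^ n ≠ 0 := by
    apply pow_ne_zero; exact_mod_cast Nat.succ_ne_zero k
  rw [← mul_assoc, inv_mul_cancel₀ this, one_mul]

lemma Qf_spec {d : ℕ} {Ψ : ConvFn n → RadonMeasure n} (hp : IsPolynomialDeg d Ψ)
    (hh : IsHomogeneousDeg (n + d) Ψ) (φ : C_c(Eucl n, ℂ)) (t : ℝ≥0) (ht : 0 < t) (G : ConvFn n) (s : ℝ)
    (v : Eucl n) :
    (Ψ (addAffine (smulConv t G) s v)).1 φ = ((t : ℝ) : ℂ) ^ n * Qf d Ψ φ t G s v := by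
  obtain ⟨P, hPd, hP⟩ := hp G φ
  rw [psi_scale hh G φ P hPd hP t ht, Qf_eq_sum hh G φ P hPd hP]

lemma Qf_zero {d : ℕ} {Ψ : ConvFn n → RadonMeasure n} (hh : IsHomogeneousDeg (n + d) Ψ)
    (G : ConvFn n) (φ : C_c(Eucl n, ℂ)) (P : MvPolynomial (Fin (n + 1)) ℂ) (hPd : P.totalDegree ≤ d)
    (hP : ∀ (s : ℝ) (v : Eucl n), (Ψ (addAffine G s v)).1 φ = MvPolynomial.eval (wvec s v) P)
    (s : ℝ) (v : Eucl n) :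
    Qf d Ψ φ 0 G s v = MvPolynomial.eval (wvec s v) (MvPolynomial.homogeneousComponent d P) := by
  rw [Qf_eq_sum hh G φ P hPd hP, Finset.sum_eq_single_of_mem d (by simp)]
  · simp
  · intro j hj hjd
    rw [Finset.mem_range] at hj
    have : d - j ≠ 0 := by omega
    simp [this]

/-- `Qf` is sequentially continuous -/
lemma Qf_tendsto {d : ℕ} {Ψ : ConvFn n → RadonMeasure n} (hc : IsContinuousFunctional Ψ)
    (φ : C_c(Eucl n, ℂ)) {ι : Type*} {l : Filter ι} {t : ι → ℝ} {G : ι → ConvFn n} {s : ι → ℝ}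
    {v : ι → Eucl n} {t₀ : ℝ} {G₀ : ConvFn n} {s₀ : ℝ} {v₀ : Eucl n} (ht : Tendsto t l (𝓝 t₀))
    (hG : Tendsto G l (𝓝 G₀)) (hs : Tendsto s l (𝓝 s₀)) (hv : Tendsto v l (𝓝 v₀)) :
    Tendsto (fun i => Qf d Ψ φ (t i) (G i) (s i) (v i)) l (𝓝 (Qf d Ψ φ t₀ G₀ s₀ v₀)) := by
  unfold Qf
  refine tendsto_finsetSum _ fun k _ => ?_
  refine Tendsto.mul ?_ (Tendsto.const_mul _ ?_)
  · exact (((Polynomial.continuous _).comp Complex.continuous_ofReal).tendsto t₀).comp ht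
  · refine ((hc φ).tendsto _).comp (tendsto_convFn fun R ε hε => ?_)
    have hk : (0 : ℝ) < k + 1 := by positivity
    have hlim : Tendsto (fun i => |s i - s₀| + ‖v i - v₀‖ * |R|) l (𝓝 0) := by
      have h1 := (hs.sub_const s₀).abs
      have h2 := ((hv.sub_const v₀).norm).mul_const |R|
      simpa using h1.add h2
    filter_upwards [convFn_tendsto_unif hG R (ε / 2 / (k + 1)) (by positivity),
      hlim.eventually (gt_mem_nhds (show 0 < ε / 2 by positivity))] with i h1 h2 x hx
    have h3 := h1 x hx
    rw [lt_div_iff₀ hk] at h3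
    have h4 : |inner ℝ (v i - v₀) x| ≤ ‖v i - v₀‖ * |R| :=
      (abs_real_inner_le_norm _ _).trans (by gcongr; exact hx.trans (le_abs_self _))
    rw [inner_sub_left] at h4
    simp only [addAffine_apply, smulConv_apply]
    push_cast
    rw [show ((k : ℝ) + 1) * (G i).1 x + (s i + inner ℝ (v i) x) - (((k : ℝ) + 1) * G₀.1 x + (s₀ + inner ℝ v₀ x))
      = ((G i).1 x - G₀.1 x) * (k + 1) + (s i - s₀) + (inner ℝ (v i) x - inner ℝ v₀ x) by ring]
    refine lt_of_le_of_lt (abs_add_three _ _ _) ?_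
    rw [abs_mul, abs_of_pos hk]
    linarith

lemma lemmaB {d : ℕ} {Ψ : ConvFn n → RadonMeasure n} (hc : IsContinuousFunctional Ψ)
    (hp : IsPolynomialDeg d Ψ) (hh : IsHomogeneousDeg (n + d) Ψ) (R L : ℝ) :
    ∃ C : ℝ, 0 ≤ C ∧ ∀ (h : ConvFn n) (p : Eucl n) (ρ : ℝ), 0 < ρ → ρ ≤ 1 → ‖p‖ ≤ L → |h.1 0| ≤ L →
      (∀ x y, |h.1 x - h.1 y - inner ℝ p (x - y)| ≤ ρ * ‖x - y‖) →
      ∀ (φ : C_c(Eucl n, ℂ)) (M : ℝ), 0 ≤ M → tsupport ⇑φ ⊆ closedBall 0 R → (∀ x, ‖φ x‖ ≤ M) →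
        ‖(Ψ h).1 φ‖ ≤ C * ρ ^ n * M := by
  obtain ⟨C, hC0, hC⟩ := lemmaA Ψ hc hh R (L + (d + 1))
  obtain ⟨B, hB⟩ : ∃ B : ℝ, ∀ t ∈ Set.Icc (0 : ℝ) 1, ∑ k ∈ Finset.range (d + 1),
    ‖(Lagrange.basis (Finset.range (d + 1)) (fun k : ℕ => ((k : ℂ) + 1)) k).eval (t : ℂ)‖ ≤ B := by
    obtain ⟨B, hB⟩ := (isCompact_Icc (a := (0 : ℝ)) (b := 1)).exists_bound_of_continuousOn
      (f := fun t : ℝ => ∑ k ∈ Finset.range (d + 1),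
        ‖(Lagrange.basis (Finset.range (d + 1)) (fun k : ℕ => ((k : ℂ) + 1)) k).eval (t : ℂ)‖)
      (Continuous.continuousOn (by
        refine continuous_finsetSum _ fun k _ => ?_
        exact ((Polynomial.continuous _).comp Complex.continuous_ofReal).norm))
    exact ⟨B, fun t ht => (le_abs_self _).trans (hB t ht)⟩
  have hB0 : 0 ≤ B := le_trans (Finset.sum_nonneg fun _ _ => norm_nonneg _) (hB 0 (by simp))
  refine ⟨B * C, by positivity, fun h p ρ hρ hρ1 hpL h0 hlip φ M hM hs hb => ?_⟩
  let G : ConvFn n := smulConv (Real.toNNReal ρ⁻¹) (addAffine h (-h.1 0) (-p))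
  have hGv : ∀ x, G.1 x = ρ⁻¹ * (h.1 x - h.1 0 - inner ℝ p x) := by
    intro x
    simp only [G, smulConv_apply, addAffine_apply, inner_neg_left, Real.coe_toNNReal _ (inv_nonneg.2 hρ.le)]
    ring
  have hhG : h = addAffine (smulConv (Real.toNNReal ρ) G) (h.1 0) p := by
    apply convFn_ext
    intro x
    rw [addAffine_apply, smulConv_apply, hGv, Real.coe_toNNReal _ hρ.le, ← mul_assoc, mul_inv_cancel₀ hρ.ne']
    ring
  have hGlip : ∀ x y, |G.1 x - G.1 y| ≤ ‖x - y‖ := by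
    intro x y
    have := hlip x y
    rw [hGv, hGv, ← mul_sub, abs_mul, abs_of_pos (inv_pos.2 hρ), inv_mul_le_iff₀ hρ]
    rw [inner_sub_right] at this
    rw [show h.1 x - h.1 0 - inner ℝ p x - (h.1 y - h.1 0 - inner ℝ p y) = h.1 x - h.1 y - (inner ℝ p x - inner ℝ p y) by ring]
    exact this
  have hG0 : G.1 0 = 0 := by rw [hGv]; simp
  conv_lhs => rw [hhG]
  rw [Qf_spec hp hh φ _ (Real.toNNReal_pos.2 hρ), Real.coe_toNNReal _ hρ.le, norm_mul, norm_pow, Complex.norm_real,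
    Real.norm_of_nonneg hρ.le]
  have hQ : ‖Qf d Ψ φ ρ G (h.1 0) p‖ ≤ B * (C * M) := by
    unfold Qf
    refine (norm_sum_le _ _).trans ?_
    calc _ ≤ ∑ k ∈ Finset.range (d + 1),
        ‖(Lagrange.basis (Finset.range (d + 1)) (fun k : ℕ => ((k : ℂ) + 1)) k).eval (ρ : ℂ)‖ * (C * M) := ?_
      _ ≤ _ := by
        rw [← Finset.sum_mul]
        gcongr
        exact hB ρ ⟨hρ.le, hρ1⟩
    refine Finset.sum_le_sum fun k hk => ?_
    rw [norm_mul]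
    gcongr
    rw [norm_mul]
    have hk1 : ‖(((k : ℂ) + 1) ^ n)⁻¹‖ ≤ 1 := by
      rw [norm_inv, norm_pow]
      apply inv_le_one_of_one_le₀
      apply one_le_pow₀
      have : ‖((k : ℂ) + 1)‖ = (k : ℝ) + 1 := by
        rw [← Nat.cast_succ, Complex.norm_natCast]; simp
      rw [this]; linarith [(Nat.cast_nonneg k : (0 : ℝ) ≤ k)]
    have hkd : (k : ℝ) ≤ d := by
      rw [Finset.mem_range] at hk; exact_mod_cast (by omega : k ≤ d)
    have := hC (addAffine (smulConv ((k : ℝ≥0) + 1) G) (h.1 0) p) ?_ ?_ φ M hM hs hb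
    · calc _ ≤ 1 * (C * M) := mul_le_mul hk1 this (norm_nonneg _) zero_le_one
        _ = _ := one_mul _
    · intro x y
      simp only [addAffine_apply, smulConv_apply]
      push_cast
      rw [show ((k : ℝ) + 1) * G.1 x + (h.1 0 + inner ℝ p x) - (((k : ℝ) + 1) * G.1 y + (h.1 0 + inner ℝ p y)) =
        ((k : ℝ) + 1) * (G.1 x - G.1 y) + inner ℝ p (x - y) by rw [inner_sub_right]; ring]
      refine (abs_add_le _ _).trans ?_
      have h1 : |inner ℝ p (x - y)| ≤ L * ‖x - y‖ := (abs_real_inner_le_norm _ _).trans (by gcongr)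
      rw [abs_mul, abs_of_pos (by positivity : (0 : ℝ) < (k : ℝ) + 1)]
      have h2 : ((k : ℝ) + 1) * |G.1 x - G.1 y| ≤ (d + 1) * ‖x - y‖ := by
        gcongr
        exact hGlip x y
      linarith
    · simp only [addAffine_apply, smulConv_apply, hG0, inner_zero_right]
      simp only [mul_zero, add_zero, zero_add]
      have : (0 : ℝ) ≤ d := Nat.cast_nonneg d
      linarith
  calc _ ≤ ρ ^ n * (B * (C * M)) := by gcongr
    _ = _ := by ring

lemma coeff_continuous {T : Type*} [TopologicalSpace T] {d : ℕ} (p : T → MvPolynomial (Fin (n + 1)) ℂ)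
    (hd : ∀ x, (p x).totalDegree ≤ d)
    (hc : ∀ (s : ℝ) (v : Eucl n), Continuous fun x => MvPolynomial.eval (wvec s v) (p x))
    (m : Fin (n + 1) →₀ ℕ) : Continuous fun x => (p x).coeff m := by
  let V := MvPolynomial.restrictTotalDegree (Fin (n + 1)) ℂ d
  let ev : ℝ × Eucl n → Module.Dual ℂ V := fun w =>
    (MvPolynomial.aeval (R := ℂ) (wvec w.1 w.2)).toLinearMap ∘ₗ V.subtype
  have hev : ∀ w (q : V), ev w q = MvPolynomial.eval (wvec w.1 w.2) q.1 := by
    intro w q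
    simp [ev, MvPolynomial.aeval_eq_eval]
  let W : Submodule ℂ (Module.Dual ℂ V) := Submodule.span ℂ (Set.range ev)
  have hbot : W.dualCoannihilator = ⊥ := by
    rw [eq_bot_iff]
    intro q hq
    rw [Submodule.mem_dualCoannihilator] at hq
    rw [Submodule.mem_bot]
    apply Subtype.ext
    apply MvPolynomial.funext_set (fun _ => Set.range ((↑) : ℝ → ℂ)) (fun _ => Set.infinite_range_of_injective Complex.ofReal_injective)
    intro w hw
    choose r hr using fun i => hw i (Set.mem_univ i)
    have h1 := hq (ev (r 0, WithLp.toLp 2 (fun i => r i.succ))) (Submodule.subset_span ⟨_, rfl⟩)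
    rw [hev] at h1
    have h2 : wvec (r 0) (WithLp.toLp 2 (fun i => r i.succ)) = w := by
      funext i
      rw [← hr i]
      refine Fin.cases ?_ (fun j => ?_) i <;> simp [wvec]
    rw [h2] at h1
    simpa using h1
  have hfin : FiniteDimensional ℂ V := by
    infer_instance
  have htop : W = ⊤ := by
    rw [← Subspace.dualCoannihilator_dualAnnihilator_eq (W := W), hbot, Submodule.dualAnnihilator_bot]
  have key : ∀ lam ∈ W, Continuous fun x => lam ⟨p x, (MvPolynomial.mem_restrictTotalDegree _ _ _).2 (hd x)⟩ := by
    intro lam hlam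
    induction hlam using Submodule.span_induction with
    | mem y hy =>
      obtain ⟨w, rfl⟩ := hy
      simp only [hev]
      exact hc w.1 w.2
    | zero => simpa using continuous_const
    | add a b _ _ ha hb => exact ha.add hb
    | smul c a _ ha => exact ha.const_smul c
  exact key ((MvPolynomial.lcoeff ℂ m) ∘ₗ V.subtype) (by rw [htop]; trivial)
end Aux2

section Aux3
open MeasureTheory Filter Topology Metric
variable {n : ℕ}

lemma supAffine {ι : Type*} [Nonempty ι] (c : ι → ℝ) (v : ι → Eucl n) (p : Eucl n) (ρ : ℝ)
    (hv : ∀ i, ‖v i - p‖ ≤ ρ) (z₀ : Eucl n) (b₀ : ℝ) (hb : ∀ i, c i + inner ℝ (v i) z₀ ≤ b₀) :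
    ∃ h : ConvFn n, (∀ i z, c i + inner ℝ (v i) z ≤ h.1 z) ∧
      (∀ z b, (∀ i, c i + inner ℝ (v i) z ≤ b) → h.1 z ≤ b) ∧
      (∀ x y, |h.1 x - h.1 y - inner ℝ p (x - y)| ≤ ρ * ‖x - y‖) := by
  have hstep : ∀ i x y, c i + inner ℝ (v i) x ≤ c i + inner ℝ (v i) y + inner ℝ p (x - y) + ρ * ‖x - y‖ := by
    intro i x y
    have h1 : inner ℝ (v i) x = inner ℝ (v i) y + inner ℝ p (x - y) + inner ℝ (v i - p) (x - y) := by
      simp only [inner_sub_right, inner_sub_left]; ring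
    have h2 : inner ℝ (v i - p) (x - y) ≤ ρ * ‖x - y‖ :=
      (real_inner_le_norm _ _).trans (mul_le_mul_of_nonneg_right (hv i) (norm_nonneg _))
    linarith
  have hbdd : ∀ z, BddAbove (Set.range fun i => c i + inner ℝ (v i) z) := by
    intro z
    refine ⟨b₀ + inner ℝ p (z - z₀) + ρ * ‖z - z₀‖, ?_⟩
    rintro _ ⟨i, rfl⟩
    have := hstep i z z₀
    have := hb i
    simp only
    linarith
  let H : Eucl n → ℝ := fun z => ⨆ i, (c i + inner ℝ (v i) z)
  have hle : ∀ i z, c i + inner ℝ (v i) z ≤ H z := fun i z => le_ciSup (hbdd z) i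
  have hls : ∀ z b, (∀ i, c i + inner ℝ (v i) z ≤ b) → H z ≤ b := fun z b h => ciSup_le h
  have h1 : ∀ x y, H x ≤ H y + inner ℝ p (x - y) + ρ * ‖x - y‖ := by
    intro x y
    refine hls _ _ fun i => ?_
    have := hstep i x y
    have := hle i y
    linarith
  have hlip : ∀ x y, |H x - H y - inner ℝ p (x - y)| ≤ ρ * ‖x - y‖ := by
    intro x y
    have a := h1 x y
    have b := h1 y x
    rw [norm_sub_rev y x, ← neg_sub x y, inner_neg_right] at b
    rw [abs_le]; constructor <;> linarith
  have hcont : Continuous H := by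
    have : Continuous fun x => H x - inner ℝ p x := by
      have hρ : 0 ≤ ρ := (norm_nonneg _).trans (hv (Classical.arbitrary ι))
      refine (LipschitzWith.of_dist_le_mul (K := ⟨ρ, hρ⟩) fun x y => ?_).continuous
      rw [Real.dist_eq, dist_eq_norm]
      have := hlip x y
      rw [inner_sub_right] at this
      rw [show H x - inner ℝ p x - (H y - inner ℝ p y) = H x - H y - (inner ℝ p x - inner ℝ p y) by ring]
      exact this
    have h2 : Continuous fun x : Eucl n => inner ℝ p x := by fun_prop
    have h3 : H = fun x => (H x - inner ℝ p x) + inner ℝ p x := by funext x; ring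
    rw [h3]; exact this.add h2
  refine ⟨⟨⟨H, hcont⟩, convex_univ, ?_⟩, hle, hls, hlip⟩
  intro x _ y _ a b ha hb' hab
  refine hls _ _ fun i => ?_
  have e1 := mul_le_mul_of_nonneg_left (hle i x) ha
  have e2 := mul_le_mul_of_nonneg_left (hle i y) hb'
  have e3 : c i + inner ℝ (v i) (a • x + b • y) = a * (c i + inner ℝ (v i) x) + b * (c i + inner ℝ (v i) y) := by
    simp only [inner_add_right, real_inner_smul_right]
    linear_combination (-c i) * hab
  rw [e3]
  simp only [smul_eq_mul]
  exact add_le_add e1 e2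

lemma radon_zero_of_tsupport_empty (μ : RadonMeasure n) (φ : C_c(Eucl n, ℂ)) (h : tsupport ⇑φ = ∅) :
    μ.1 φ = 0 := by
  have : φ = 0 := by
    ext x
    have : x ∉ tsupport ⇑φ := by rw [h]; simp
    simpa using image_eq_zero_of_notMem_tsupport this
  rw [this, map_zero]

lemma lemmaC0 {d : ℕ} {Ψ : ConvFn n → RadonMeasure n} (hΨ : MemPdLV d Ψ)
    (hh : IsHomogeneousDeg (n + d) Ψ) (R L : ℝ) (hR : 0 ≤ R) (hL : 0 ≤ L) :
    ∃ C : ℝ, 0 ≤ C ∧ ∀ (f : ConvFn n) (U : Set (Eucl n)) (y : Eucl n → Eucl n) (p : Eucl n) (ρ : ℝ),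
      0 < ρ → ρ ≤ 1 → ‖p‖ ≤ L → IsOpen U → U ⊆ closedBall 0 (R + 1) →
      (∀ x ∈ U, ∀ z, f.1 x + inner ℝ (y x) (z - x) ≤ f.1 z) → (∀ x ∈ U, ‖y x - p‖ ≤ ρ) →
      (∀ x ∈ closedBall (0 : Eucl n) (R + 1), |f.1 x| ≤ L) →
      ∀ (φ : C_c(Eucl n, ℂ)) (M : ℝ), 0 ≤ M → tsupport ⇑φ ⊆ closedBall 0 R → tsupport ⇑φ ⊆ U →
        (∀ x, ‖φ x‖ ≤ M) → ‖(Ψ f).1 φ‖ ≤ C * ρ ^ n * M := by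
  obtain ⟨C, hC0, hC⟩ := lemmaB hΨ.2.1 hΨ.2.2 hh R (L + (L + 1) * (R + 1))
  refine ⟨C, hC0, fun f U y p ρ hρ hρ1 hpL hU hUR hsub hyp hfL φ M hM hs hsU hb => ?_⟩
  rcases (tsupport ⇑φ).eq_empty_or_nonempty with he | ⟨x₀, hx₀⟩
  · rw [radon_zero_of_tsupport_empty _ _ he, norm_zero]; positivity
  have hx₀U := hsU hx₀
  have : Nonempty U := ⟨⟨x₀, hx₀U⟩⟩
  have hsub' : ∀ (i : U) z, f.1 i - inner ℝ (y i) (i : Eucl n) + inner ℝ (y i) z ≤ f.1 z := by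
    intro i z
    have := hsub i i.2 z
    rw [inner_sub_right] at this; linarith
  obtain ⟨h, h1, h2, h3⟩ := supAffine (ι := U) (fun i => f.1 i - inner ℝ (y i) (i : Eucl n)) (fun i => y i) p ρ
    (fun i => hyp i i.2) 0 (f.1 0) (fun i => hsub' i 0)
  have heq : ∀ x ∈ U, f.1 x = h.1 x := by
    intro x hx
    refine le_antisymm ?_ (h2 _ _ fun i => hsub' i x)
    have := h1 ⟨x, hx⟩ x
    simpa using this
  rw [hΨ.1 f h U hU heq φ hsU]
  refine hC h p ρ hρ hρ1 (by nlinarith) ?_ h3 φ M hM hs hb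
  have f0 := hfL 0 (by simp; linarith)
  rw [abs_le] at f0 ⊢
  have hx0R := hUR hx₀U
  have fx := (abs_le.1 (hfL x₀ hx0R)).1
  have hyb : ‖y x₀‖ ≤ L + 1 := by
    calc ‖y x₀‖ = ‖(y x₀ - p) + p‖ := by simp
      _ ≤ ‖y x₀ - p‖ + ‖p‖ := norm_add_le _ _
      _ ≤ L + 1 := by linarith [hyp x₀ hx₀U]
  have hi : inner ℝ (y x₀) x₀ ≤ (L + 1) * (R + 1) := by
    refine (real_inner_le_norm _ _).trans ?_
    have : ‖x₀‖ ≤ R + 1 := by simpa using hx0R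
    gcongr
  have hlow := h1 ⟨x₀, hx₀U⟩ 0
  have hup := h2 0 (f.1 0) (fun i => hsub' i 0)
  simp only [inner_zero_right] at hlow
  constructor
  · linarith
  · nlinarith

lemma sum_mulC (φ : C_c(Eucl n, ℂ)) {N : ℕ} (u : Fin N → C(Eucl n, ℝ))
    (h : ∀ x ∈ tsupport ⇑φ, ∑ i, u i x = 1) :
    φ = ∑ i, mulC φ ⟨fun x => ((u i x : ℝ) : ℂ), by fun_prop⟩ := by
  apply DFunLike.ext
  intro x
  have : (⇑(∑ i, mulC φ ⟨fun x => ((u i x : ℝ) : ℂ), by fun_prop⟩) : Eucl n → ℂ) x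
      = ∑ i, φ x * ((u i x : ℝ) : ℂ) := by
    rw [CompactlySupportedContinuousMap.sum_apply]
    rfl
  rw [this, ← Finset.mul_sum]
  by_cases hx : x ∈ tsupport ⇑φ
  · have h1 := h x hx
    have : (∑ i, ((u i x : ℝ) : ℂ)) = 1 := by exact_mod_cast h1
    rw [this, mul_one]
  · rw [image_eq_zero_of_notMem_tsupport hx, zero_mul]

lemma lemmaC {d : ℕ} {Ψ : ConvFn n → RadonMeasure n} (hΨ : MemPdLV d Ψ)
    (hh : IsHomogeneousDeg (n + d) Ψ) (R L : ℝ) (hR : 0 ≤ R) (hL : 0 ≤ L) :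
    ∃ C : ℝ, 0 ≤ C ∧ ∀ (f : ConvFn n) (W : Set (Eucl n)) (y : Eucl n → Eucl n), IsOpen W →
      ContinuousOn y W → (∀ x ∈ W, ∀ z, f.1 x + inner ℝ (y x) (z - x) ≤ f.1 z) → (∀ x ∈ W, ‖y x‖ ≤ L) →
      (∀ x ∈ closedBall (0 : Eucl n) (R + 1), |f.1 x| ≤ L) →
      ∀ (φ : C_c(Eucl n, ℂ)) (M : ℝ), 0 ≤ M → tsupport ⇑φ ⊆ closedBall 0 R → tsupport ⇑φ ⊆ W →
        (∀ x, ‖φ x‖ ≤ M) → ‖(Ψ f).1 φ‖ ≤ C * M * volume.real (y '' tsupport ⇑φ) := by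
  obtain ⟨C, hC0, hC⟩ := lemmaC0 hΨ hh R L hR hL
  set ω : ℝ := (volume : Measure (Eucl n)).real (ball 0 1) with hω
  have hωpos : 0 < ω := by
    rw [hω, Measure.real]
    exact ENNReal.toReal_pos (measure_ball_pos _ _ one_pos).ne' measure_ball_lt_top.ne
  refine ⟨C * 2 ^ n * ω⁻¹, by positivity, fun f W y hW hyc hsub hyL hfL φ M hM hsR hsW hb => ?_⟩
  set K := tsupport ⇑φ with hK
  have hKc : IsCompact K := cc_tsupport_compact φ
  have hYc : IsCompact (y '' K) := hKc.image_of_continuousOn (hyc.mono hsW)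
  refine le_of_forall_pos_le_add fun ε hε => ?_
  set A := C * 2 ^ n * ω⁻¹ * M with hA
  have hA0 : 0 ≤ A := by positivity
  set ε' := ε / (A + 1) with hε'
  have hε'pos : 0 < ε' := by positivity
  obtain ⟨t, r, htc, hts, htr, hcov, hsum⟩ := Besicovitch.exists_closedBall_covering_tsum_measure_le
    (volume : Measure (Eucl n)) (ε := ENNReal.ofReal ε') (by simpa using hε'pos) (fun _ => Set.Ioo 0 (1/2)) (y '' K)
    (fun x _ δ hδ => ⟨min δ (1/2) / 2, ⟨by positivity, by have := min_le_right δ (1/2); linarith⟩,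
      by positivity, by have := min_le_left δ (1/2); have : 0 < min δ (1/2) := by positivity
                        linarith⟩)
  let U : Eucl n → Set (Eucl n) := fun p => (W ∩ y ⁻¹' ball p (2 * r p)) ∩ ball 0 (R + 1)
  have hUo : ∀ p, IsOpen (U p) := fun p => (hyc.isOpen_inter_preimage hW isOpen_ball).inter isOpen_ball
  have hKU : K ⊆ ⋃ p ∈ t, U p := by
    intro x hx
    obtain ⟨p, hp⟩ := Set.mem_iUnion.1 (hcov ⟨x, hx, rfl⟩)
    obtain ⟨hpt, hp⟩ := Set.mem_iUnion.1 hp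
    refine Set.mem_biUnion hpt ⟨⟨hsW hx, ?_⟩, ?_⟩
    · have := (htr p hpt).1
      rw [Set.mem_preimage, mem_ball]; rw [mem_closedBall] at hp; linarith
    · have := hsR hx
      rw [mem_closedBall] at this; rw [mem_ball]; linarith
  obtain ⟨b', hb't, hb'fin, hb'cov⟩ := hKc.elim_finite_subcover_image (b := t) (c := U) (fun p _ => hUo p) hKU
  lift b' to Finset (Eucl n) using hb'fin
  let e := b'.equivFin.symm
  obtain ⟨u, hu1, hu2, hu3, -⟩ := exists_continuous_sum_one_of_isOpen_isCompact (t := K)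
    (s := fun i => U (e i)) (fun i => hUo _) hKc (by
      intro x hx
      obtain ⟨p, hp⟩ := Set.mem_iUnion.1 (hb'cov hx)
      obtain ⟨hpt, hp⟩ := Set.mem_iUnion.1 hp
      exact Set.mem_iUnion.2 ⟨b'.equivFin ⟨p, hpt⟩, by simpa [e] using hp⟩)
  rw [sum_mulC φ u (fun x hx => by have := hu2 hx; simpa using this), map_sum]
  have hterm : ∀ i, ‖(Ψ f).1 (mulC φ ⟨fun x => ((u i x : ℝ) : ℂ), by fun_prop⟩)‖ ≤
      C * (2 * r (e i)) ^ n * M := by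
    intro i
    have hpt : (e i : Eucl n) ∈ t := hb't (e i).2
    have hr := htr _ hpt
    refine hC f (U (e i)) y (e i) (2 * r (e i)) (by linarith [hr.1]) (by linarith [hr.2]) ?_ (hUo _) ?_ ?_ ?_ hfL
      _ M hM ((tsupport_mulC_left _ _).trans hsR) ?_ ?_
    · obtain ⟨x, hx, hxe⟩ := hts hpt
      rw [← hxe]; exact hyL x (hsW hx)
    · exact fun x hx => ball_subset_closedBall hx.2
    · exact fun x hx => hsub x hx.1.1
    · intro x hx
      have := hx.1.2
      rw [Set.mem_preimage, mem_ball, dist_eq_norm] at this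
      exact this.le
    · refine (tsupport_mulC_right _ _).trans (subset_trans ?_ (hu1 i))
      refine closure_mono fun x hx => ?_
      simpa using hx
    · intro x
      rw [mulC_apply, norm_mul]
      have h01 := hu3 i x
      have : ‖((u i x : ℝ) : ℂ)‖ ≤ 1 := by
        rw [Complex.norm_real, Real.norm_of_nonneg h01.1]; exact h01.2
      calc _ ≤ M * 1 := mul_le_mul (hb x) this (norm_nonneg _) hM
        _ = M := mul_one M
  refine (norm_sum_le _ _).trans ((Finset.sum_le_sum fun i _ => hterm i).trans ?_)
  have hvol : ∀ p ∈ t, r p ^ n = ω⁻¹ * volume.real (closedBall p (r p)) := by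
    intro p hp
    rw [Measure.addHaar_real_closedBall _ _ (htr p hp).1.le, ← hω, finrank_euclideanSpace, Fintype.card_fin]
    field_simp
  have e1 : ∑ i, C * (2 * r (e i)) ^ n * M = ∑ p ∈ b', A * volume.real (closedBall p (r p)) := by
    rw [← Finset.sum_coe_sort b', ← Equiv.sum_comp e]
    refine Finset.sum_congr rfl fun i _ => ?_
    rw [mul_pow, hvol _ (hb't (e i).2), hA]; ring
  rw [e1, ← Finset.mul_sum]
  have hYfin : volume (y '' K) ≠ ⊤ := hYc.measure_ne_top
  have e2 : ∑ p ∈ b', volume.real (closedBall p (r p)) ≤ volume.real (y '' K) + ε' := by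
    have : ∑ p ∈ b', volume (closedBall p (r p)) ≤ volume (y '' K) + ENNReal.ofReal ε' := by
      refine le_trans ?_ hsum
      have h3 := ENNReal.sum_le_tsum (f := fun x : t => volume (closedBall (x : Eucl n) (r x)))
        (b'.attach.map ⟨fun p => ⟨p.1, hb't p.2⟩, fun p q h => Subtype.ext (by simpa using h)⟩)
      rw [Finset.sum_map] at h3
      rw [← Finset.sum_attach b' (fun p => volume (closedBall p (r p)))]
      exact h3
    have h4 := ENNReal.toReal_mono (by finiteness) this
    rw [ENNReal.toReal_sum (fun p _ => measure_closedBall_lt_top.ne), ENNReal.toReal_add hYfin (by finiteness),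
      ENNReal.toReal_ofReal hε'pos.le] at h4
    exact h4
  calc A * ∑ p ∈ b', volume.real (closedBall p (r p)) ≤ A * (volume.real (y '' K) + ε') := by gcongr
    _ = A * volume.real (y '' K) + A * ε' := by ring
    _ ≤ A * volume.real (y '' K) + ε := by
      have : A * ε' ≤ ε := by
        rw [hε', mul_div_assoc', div_le_iff₀ (by positivity)]
        nlinarith
      linarith
end Aux3

section Aux4
open MeasureTheory Filter Topology Metric
variable {n : ℕ}

def omegaN (n : ℕ) : ℝ := (volume : Measure (Eucl n)).real (ball 0 1)

lemma omegaN_pos : 0 < omegaN n :=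
  ENNReal.toReal_pos (measure_ball_pos _ _ one_pos).ne' measure_ball_lt_top.ne

def cone (a : Eucl n) : ConvFn n :=
  ⟨⟨fun x => ‖x - a‖, by fun_prop⟩, by
    have := (convexOn_norm (convex_univ (𝕜 := ℝ) (E := Eucl n))).translate_left (c := -a)
    simpa [sub_eq_add_neg, Function.comp_def] using this⟩

lemma cone_apply (a x : Eucl n) : (cone a).1 x = ‖x - a‖ := rfl

lemma cone_continuous : Continuous (cone (n := n)) := by
  rw [continuous_iff_continuousAt]
  intro a
  apply tendsto_convFn
  intro R ε hε
  filter_upwards [ball_mem_nhds a hε] with b hb x _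
  rw [cone_apply, cone_apply]
  refine lt_of_le_of_lt (abs_norm_sub_norm_le _ _) ?_
  rw [mem_ball, dist_eq_norm] at hb
  rw [← norm_neg]; simpa using hb

lemma cone_vanish {d : ℕ} {Ψ : ConvFn n → RadonMeasure n} (hΨ : MemPdLV d Ψ)
    (hh : IsHomogeneousDeg (n + d) Ψ) (t : ℝ≥0) (ht : 0 < t) (a : Eucl n) (s : ℝ) (v : Eucl n)
    (φ : C_c(Eucl n, ℂ)) (ha : a ∉ tsupport ⇑φ) :
    (Ψ (addAffine (smulConv t (cone a)) s v)).1 φ = 0 := by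
  set f := addAffine (smulConv t (cone a)) s v with hf
  obtain ⟨R, hR, hsR⟩ := cc_tsupport_ball φ
  obtain ⟨M, hM, hb⟩ := cc_bound φ
  obtain ⟨B, hB⟩ := (isCompact_closedBall (0 : Eucl n) (R + 1)).exists_bound_of_continuousOn
    (f := f.1) f.1.continuous.continuousOn
  have hB0 : 0 ≤ B := (norm_nonneg _).trans (hB 0 (by simp; linarith))
  have ht' : (0 : ℝ) < t := by exact_mod_cast ht
  obtain ⟨C, hC0, hC⟩ := lemmaC hΨ hh R (B + (‖v‖ + t)) hR.le (by positivity)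
  let y : Eucl n → Eucl n := fun x => v + (t : ℝ) • (‖x - a‖⁻¹ • (x - a))
  have hne : ∀ x ∈ ({a}ᶜ : Set (Eucl n)), ‖x - a‖ ≠ 0 := fun x hx => by
    rw [norm_ne_zero_iff, sub_ne_zero]; exact hx
  have hnorm : ∀ x ∈ ({a}ᶜ : Set (Eucl n)), ‖y x - v‖ = t := by
    intro x hx
    have := hne x hx
    simp only [y, add_sub_cancel_left, norm_smul, norm_inv, norm_norm, inv_mul_cancel₀ this, mul_one,
      Real.norm_of_nonneg ht'.le]
  have key := hC f {a}ᶜ y isOpen_compl_singleton ?_ ?_ ?_ ?_ φ M hM.le hsR ?_ hb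
  · have hv0 : volume (y '' tsupport ⇑φ) = 0 := by
      refine measure_mono_null ?_ (Measure.addHaar_sphere_of_ne_zero volume v ht'.ne')
      rintro _ ⟨x, hx, rfl⟩
      rw [mem_sphere, dist_eq_norm]
      exact hnorm x (fun h => ha (by rw [← h]; exact hx))
    rw [Measure.real, hv0] at key
    simpa using key
  · have hc1 : ContinuousOn (fun x : Eucl n => ‖x - a‖⁻¹) {a}ᶜ :=
      ContinuousOn.inv₀ (Continuous.continuousOn (by fun_prop)) hne
    have hc2 : ContinuousOn (fun x : Eucl n => x - a) {a}ᶜ := Continuous.continuousOn (by fun_prop)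
    have hc3 : ContinuousOn (fun x : Eucl n => (t : ℝ) • (‖x - a‖⁻¹ • (x - a))) {a}ᶜ :=
      (hc1.smul hc2).const_smul (t : ℝ)
    exact continuousOn_const.add hc3
  · intro x hx z
    have h0 := hne x hx
    have hi : inner ℝ (‖x - a‖⁻¹ • (x - a)) (z - x) ≤ ‖z - a‖ - ‖x - a‖ := by
      rw [real_inner_smul_left, show z - x = (z - a) - (x - a) by abel, inner_sub_right, real_inner_self_eq_norm_sq,
        mul_sub]
      have h1 := real_inner_le_norm (x - a) (z - a)
      have h2 : ‖x - a‖⁻¹ * ‖x - a‖ ^ 2 = ‖x - a‖ := by field_simp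
      have h3 : ‖x - a‖⁻¹ * inner ℝ (x - a) (z - a) ≤ ‖z - a‖ := by
        rw [inv_mul_le_iff₀ (lt_of_le_of_ne (norm_nonneg _) h0.symm)]; exact h1
      linarith
    simp only [hf, addAffine_apply, smulConv_apply, cone_apply, y, inner_add_left]
    rw [real_inner_smul_left]
    have := mul_le_mul_of_nonneg_left hi ht'.le
    rw [inner_sub_right v]
    linarith
  · intro x hx
    have := hnorm x hx
    calc ‖y x‖ = ‖v + (y x - v)‖ := by simp
      _ ≤ ‖v‖ + ‖y x - v‖ := norm_add_le _ _
      _ ≤ _ := by linarith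
  · intro x hx
    have := hB x hx
    rw [Real.norm_eq_abs] at this
    have := norm_nonneg v
    linarith
  · intro x hx h
    exact ha (by rw [← h]; exact hx)

lemma point_zero (μ : RadonMeasure n) (a : Eucl n) (hμ : ∀ φ : C_c(Eucl n, ℂ), a ∉ tsupport ⇑φ → μ.1 φ = 0)
    (φ : C_c(Eucl n, ℂ)) (hφ : φ a = 0) : μ.1 φ = 0 := by
  obtain ⟨C, hC0, hC⟩ := radon_bound μ _ (cc_tsupport_compact φ)
  have hcont : Continuous fun x => ‖φ x‖ := (map_continuous φ).norm
  have key : ∀ ε > 0, ‖μ.1 φ‖ ≤ C * (2 * ε) := by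
    intro ε hε
    obtain ⟨χ, h1, h2, h3⟩ := exists_cutoff (tsupport ⇑φ ∩ {x | ε ≤ ‖φ x‖}) {a}ᶜ
      ((cc_tsupport_compact φ).inter_right (isClosed_le continuous_const hcont)) isOpen_compl_singleton
      (by rintro x ⟨-, hx⟩ h
          rw [Set.mem_singleton_iff] at h
          rw [Set.mem_ofPred_eq, h, hφ, norm_zero] at hx
          linarith)
    have hz : μ.1 (mulC φ χ.1) = 0 := hμ _ (fun h => h3 (tsupport_mulC_right φ χ.1 h) rfl)
    have hdec : φ = mulC φ χ.1 + mulC φ (1 - χ.1) := by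
      ext x
      change φ x = φ x * χ x + φ x * (1 - χ x)
      ring
    rw [hdec, map_add, hz, zero_add]
    refine hC _ _ (by positivity) (tsupport_mulC_left _ _) fun x => ?_
    rw [mulC_apply]
    change ‖φ x * (1 - χ x)‖ ≤ _
    by_cases hx : ε ≤ ‖φ x‖
    · have hxs : x ∈ tsupport ⇑φ := subset_tsupport _ (by
        intro h; rw [h, norm_zero] at hx; linarith)
      rw [h1 x ⟨hxs, hx⟩]; simp; positivity
    · rw [norm_mul]
      have : ‖1 - χ x‖ ≤ 2 := (norm_sub_le _ _).trans (by have := h2 x; rw [norm_one]; linarith)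
      push Not at hx
      nlinarith [norm_nonneg (φ x), norm_nonneg (1 - χ x)]
  rw [← norm_le_zero_iff]
  refine le_of_forall_pos_le_add fun ε hε => ?_
  refine (key (ε / (2 * (C + 1))) (by positivity)).trans ?_
  rw [zero_add]
  have : C * (2 * (ε / (2 * (C + 1)))) = ε * (C / (C + 1)) := by field_simp
  rw [this]
  have : C / (C + 1) ≤ 1 := by rw [div_le_one (by positivity)]; linarith
  nlinarith

lemma point_mass (μ : RadonMeasure n) (a : Eucl n) (hμ : ∀ φ : C_c(Eucl n, ℂ), a ∉ tsupport ⇑φ → μ.1 φ = 0)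
    (φ χ : C_c(Eucl n, ℂ)) (hχ : χ a = 1) : μ.1 φ = φ a * μ.1 χ := by
  have := point_zero μ a hμ (φ - φ a • χ) (by
    change φ a - φ a * χ a = 0
    rw [hχ]; ring)
  rw [map_sub, map_smul, sub_eq_zero] at this
  exact this

lemma Qf_cone {d : ℕ} {Ψ : ConvFn n → RadonMeasure n} (hΨ : MemPdLV d Ψ)
    (hh : IsHomogeneousDeg (n + d) Ψ) (a : Eucl n) (s : ℝ) (v : Eucl n)
    (φ χ : C_c(Eucl n, ℂ)) (hχ : χ a = 1) (t : ℝ) :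
    Qf d Ψ φ t (cone a) s v = φ a * Qf d Ψ χ t (cone a) s v := by
  unfold Qf
  rw [Finset.mul_sum]
  refine Finset.sum_congr rfl fun k _ => ?_
  rw [point_mass _ a (fun φ h => cone_vanish hΨ hh _ (by positivity) a s v φ h) φ χ hχ]
  ring

def shiftPoly (a : Eucl n) : Fin (n + 1) → MvPolynomial (Fin (n + 1)) ℂ :=
  Fin.cons (MvPolynomial.X 0 - ∑ i, MvPolynomial.C (a i : ℂ) * MvPolynomial.X i.succ)
    fun i => MvPolynomial.X i.succ

lemma eval_shiftPoly (a : Eucl n) (s : ℝ) (v : Eucl n) (P : MvPolynomial (Fin (n + 1)) ℂ) :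
    MvPolynomial.eval (wvec s v) (MvPolynomial.aeval (shiftPoly a) P) =
      MvPolynomial.eval (wvec (s - inner ℝ v a) v) P := by
  rw [MvPolynomial.aeval_def, MvPolynomial.algebraMap_eq, MvPolynomial.eval_eval₂]
  rw [MvPolynomial.eval]
  congr 1
  · ext <;> simp
  · funext i
    refine Fin.cases ?_ (fun j => ?_) i
    · simp [shiftPoly, wvec, PiLp.inner_apply]
    · simp [shiftPoly, wvec]

lemma shiftPoly_hom (a : Eucl n) (i) : (shiftPoly a i).IsHomogeneous 1 := by
  refine Fin.cases ?_ (fun j => ?_) i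
  · simp only [shiftPoly, Fin.cons_zero]
    refine (MvPolynomial.isHomogeneous_X _ _).sub (MvPolynomial.IsHomogeneous.sum _ _ _ fun i _ => ?_)
    exact MvPolynomial.isHomogeneous_C_mul_X _ _
  · simp only [shiftPoly, Fin.cons_succ]
    exact MvPolynomial.isHomogeneous_X _ _

lemma exists_psi {d : ℕ} {Ψ : ConvFn n → RadonMeasure n} (hΨ : MemPdLV d Ψ)
    (hh : IsHomogeneousDeg (n + d) Ψ) :
    ∃ ψ : Eucl n → MvPolynomial (Fin (n + 1)) ℂ, (∀ x, (ψ x).IsHomogeneous d) ∧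
      (∀ m : Fin (n + 1) →₀ ℕ, Continuous fun x => (ψ x).coeff m) ∧
      ∀ a s v φ, Qf d Ψ φ 0 (cone a) s v =
        omegaN n * φ a * MvPolynomial.eval (wvec (s + inner ℝ v a) v) (ψ a) := by
  have hχ : ∀ a : Eucl n, ∃ χ : C_c(Eucl n, ℂ), ∀ x ∈ closedBall (0 : Eucl n) (‖a‖ + 1), χ x = 1 := by
    intro a
    obtain ⟨χ, h, -, -⟩ := exists_cutoff (n := n) (closedBall 0 (‖a‖ + 1)) Set.univ (isCompact_closedBall _ _)
      isOpen_univ (Set.subset_univ _)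
    exact ⟨χ, h⟩
  choose χ hχ using hχ
  have hχa : ∀ a, χ a a = 1 := fun a => hχ a a (by simp)
  choose P hPd hP using fun a => hΨ.2.2 (cone a) (χ a)
  let D := fun a => MvPolynomial.homogeneousComponent d (P a)
  have hD : ∀ a s v, MvPolynomial.eval (wvec s v) (D a) = Qf d Ψ (χ a) 0 (cone a) s v :=
    fun a s v => (Qf_zero hh (cone a) (χ a) (P a) (hPd a) (hP a) s v).symm
  let ψ := fun a => MvPolynomial.C ((omegaN n : ℂ)⁻¹) * MvPolynomial.aeval (shiftPoly a) (D a)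
  have hom : ∀ x, (ψ x).IsHomogeneous d := by
    intro x
    have h1 := (MvPolynomial.homogeneousComponent_isHomogeneous d (P x)).aeval (shiftPoly x) (n := 1) (shiftPoly_hom x)
    rw [one_mul] at h1
    have := (MvPolynomial.isHomogeneous_C (Fin (n + 1)) ((omegaN n : ℂ)⁻¹)).mul h1
    rwa [zero_add] at this
  have hev : ∀ a s v, MvPolynomial.eval (wvec s v) (ψ a) =
      (omegaN n : ℂ)⁻¹ * Qf d Ψ (χ a) 0 (cone a) (s - inner ℝ v a) v := by
    intro a s v
    simp only [ψ, map_mul, MvPolynomial.eval_C, eval_shiftPoly, hD]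
  refine ⟨ψ, hom, ?_, ?_⟩
  · refine coeff_continuous ψ (d := d) (fun x => (hom x).totalDegree_le) fun s v => ?_
    simp only [hev]
    refine continuous_const.mul ?_
    rw [continuous_iff_continuousAt]
    intro a₀
    have h1 : Tendsto (fun a => Qf d Ψ (χ a₀) 0 (cone a) (s - inner ℝ v a) v) (𝓝 a₀)
        (𝓝 (Qf d Ψ (χ a₀) 0 (cone a₀) (s - inner ℝ v a₀) v)) := by
      refine Qf_tendsto hΨ.2.1 _ tendsto_const_nhds (cone_continuous.tendsto a₀) ?_ tendsto_const_nhds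
      exact Continuous.tendsto (f := fun a => s - inner ℝ v a) (by fun_prop) a₀
    refine h1.congr' ?_
    filter_upwards [ball_mem_nhds a₀ one_pos] with a ha
    have : χ a₀ a = 1 := hχ a₀ a (by
      rw [mem_ball, dist_eq_norm] at ha
      rw [mem_closedBall, dist_zero_right]
      have := norm_add_le a₀ (a - a₀)
      rw [add_sub_cancel] at this
      linarith)
    rw [Qf_cone hΨ hh a _ v (χ a₀) (χ a) (hχa a), this, one_mul]
  · intro a s v φ
    rw [Qf_cone hΨ hh a s v φ (χ a) (hχa a), hev, add_sub_cancel_right]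
    have : (omegaN n : ℂ) ≠ 0 := by exact_mod_cast omegaN_pos.ne'
    field_simp
end Aux4

section Aux5
open MeasureTheory Filter Topology Metric
variable {n : ℕ}

lemma argmax_tendsto {X : Type*} [TopologicalSpace X] {ι : Type*} {l : Filter ι} {K : Set X} (hK : IsCompact K)
    {g : X → ℝ} (hg : ContinuousOn g K) {G : ι → X → ℝ} (hG : ∀ ε > 0, ∀ᶠ i in l, ∀ x ∈ K, |G i x - g x| < ε)
    {x₀ : X} (hx₀ : x₀ ∈ K) (huniq : ∀ x ∈ K, (∀ z ∈ K, g z ≤ g x) → x = x₀)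
    {xs : ι → X} (hxs : ∀ᶠ i in l, xs i ∈ K ∧ ∀ z ∈ K, G i z ≤ G i (xs i)) : Tendsto xs l (𝓝 x₀) := by
  obtain ⟨x₁, hx₁, hmax⟩ := hK.exists_isMaxOn ⟨x₀, hx₀⟩ hg
  have h10 : x₁ = x₀ := huniq x₁ hx₁ fun z hz => hmax hz
  rw [h10] at hmax
  rw [_root_.tendsto_nhds]
  intro V hV hxV
  rcases (K \ V).eq_empty_or_nonempty with he | hne
  · filter_upwards [hxs] with i hi
    by_contra h
    have : xs i ∈ K \ V := ⟨hi.1, h⟩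
    rw [he] at this; exact this
  · obtain ⟨m, hm, hmm⟩ := (hK.diff hV).exists_isMaxOn hne (hg.mono Set.sdiff_subset)
    have hlt : g m < g x₀ := by
      refine lt_of_le_of_ne (hmax hm.1) fun h => ?_
      have : m = x₀ := huniq m hm.1 fun z hz => by rw [h]; exact hmax hz
      rw [this] at hm; exact hm.2 hxV
    filter_upwards [hxs, hG ((g x₀ - g m) / 2) (by linarith)] with i hi hGi
    by_contra h
    have h1 := hmm (show xs i ∈ K \ V from ⟨hi.1, h⟩)
    have h2 := abs_lt.1 (hGi _ hi.1)
    have h3 := abs_lt.1 (hGi _ hx₀)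
    have h4 := hi.2 _ hx₀
    simp only [Set.mem_ofPred_eq] at h1
    linarith

def SubG (f : ConvFn n) (x y : Eucl n) : Prop := ∀ z, f.1 x + inner ℝ y (z - x) ≤ f.1 z

lemma sub_iff (f : ConvFn n) (x y : Eucl n) : SubG f x y ↔ ∀ z, inner ℝ y z - f.1 z ≤ inner ℝ y x - f.1 x := by
  unfold SubG
  refine forall_congr' fun z => ?_
  rw [inner_sub_right]
  constructor <;> intro h <;> linarith

lemma sub_of_local (f : ConvFn n) (x y : Eucl n) (h : ∀ᶠ z in 𝓝 x, f.1 x + inner ℝ y (z - x) ≤ f.1 z) :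
    SubG f x y := by
  have h1 : IsLocalMin (⇑(addAffine f 0 (-y)).1) x := by
    filter_upwards [h] with z hz
    rw [addAffine_apply, addAffine_apply]
    rw [inner_sub_right] at hz
    simp only [inner_neg_left]
    linarith
  have h2 := IsMinOn.of_isLocalMin_of_convex_univ h1 (addAffine f 0 (-y)).2
  intro z
  have := h2 z
  rw [addAffine_apply, addAffine_apply] at this
  simp only [inner_neg_left] at this
  rw [inner_sub_right]
  linarith

lemma sub_segment (f : ConvFn n) (x x' y : Eucl n) (h : SubG f x y) (h' : SubG f x' y) (t : ℝ) (ht0 : 0 ≤ t)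
    (ht1 : t ≤ 1) : SubG f (x + t • (x' - x)) y := by
  rw [sub_iff] at *
  intro z
  have hc := f.2.2 (Set.mem_univ x) (Set.mem_univ x') (sub_nonneg.2 ht1) ht0 (by ring)
  have e : (1 - t) • x + t • x' = x + t • (x' - x) := by module
  rw [e] at hc
  simp only [smul_eq_mul] at hc
  have a1 := h z
  have a2 := h' z
  rw [inner_add_right, real_inner_smul_right, inner_sub_right]
  have b1 := mul_le_mul_of_nonneg_left a1 (sub_nonneg.2 ht1)
  have b2 := mul_le_mul_of_nonneg_left a2 ht0
  nlinarith

def IsU (f : ConvFn n) (y x : Eucl n) : Prop := SubG f x y ∧ ∀ x', SubG f x' y → x' = x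

/-- maximizer over a ball -/
def IsMx (f : ConvFn n) (R : ℝ) (y x : Eucl n) : Prop :=
  x ∈ closedBall (0 : Eucl n) R ∧ ∀ z ∈ closedBall (0 : Eucl n) R, inner ℝ y z - f.1 z ≤ inner ℝ y x - f.1 x

lemma exists_isMx (f : ConvFn n) {R : ℝ} (hR : 0 ≤ R) (y : Eucl n) : ∃ x, IsMx f R y x := by
  obtain ⟨x, hx, h⟩ := (isCompact_closedBall (0 : Eucl n) R).exists_isMaxOn ⟨0, by simpa using hR⟩
    (f := fun z => inner ℝ y z - f.1 z) (Continuous.continuousOn (by fun_prop))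
  exact ⟨x, hx, fun z hz => h hz⟩

def fst (f : ConvFn n) (R : ℝ) (y : Eucl n) : ℝ := ⨆ x : closedBall (0 : Eucl n) R, (inner ℝ y (x : Eucl n) - f.1 x)

lemma fst_eq {f : ConvFn n} {R : ℝ} {y x : Eucl n} (h : IsMx f R y x) : fst f R y = inner ℝ y x - f.1 x := by
  have : Nonempty (closedBall (0 : Eucl n) R) := ⟨⟨x, h.1⟩⟩
  refine le_antisymm (ciSup_le fun z => h.2 z z.2) ?_
  refine le_ciSup (f := fun x : closedBall (0 : Eucl n) R => (inner ℝ y (x : Eucl n) - f.1 x)) ?_ ⟨x, h.1⟩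
  exact ⟨inner ℝ y x - f.1 x, by rintro _ ⟨z, rfl⟩; exact h.2 z z.2⟩

lemma fst_grad {f : ConvFn n} {R : ℝ} (hR : 0 ≤ R) {y x : Eucl n} (h : IsMx f R y x) (y' : Eucl n) :
    fst f R y + inner ℝ (y' - y) x ≤ fst f R y' := by
  obtain ⟨x', hx'⟩ := exists_isMx f hR y'
  rw [fst_eq h, fst_eq hx', inner_sub_left]
  have := hx'.2 x h.1
  linarith

lemma fst_lip (f : ConvFn n) {R : ℝ} (hR : 0 ≤ R) : LipschitzWith ⟨R, hR⟩ (fst f R) := by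
  have key : ∀ y y', fst f R y - fst f R y' ≤ R * ‖y - y'‖ := by
    intro y y'
    obtain ⟨x, hx⟩ := exists_isMx f hR y
    have h1 := fst_grad hR hx y'
    have h2 : inner ℝ (y - y') x ≤ ‖y - y'‖ * ‖x‖ := real_inner_le_norm _ _
    have h3 : ‖x‖ ≤ R := by simpa using hx.1
    rw [← neg_sub y y', inner_neg_left] at h1
    nlinarith [norm_nonneg (y - y')]
  refine LipschitzWith.of_dist_le_mul fun y y' => ?_
  rw [Real.dist_eq, dist_eq_norm, abs_le]
  have a := key y y'
  have b := key y' y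
  rw [norm_sub_rev] at b
  change -(R * _) ≤ _ ∧ _ ≤ R * _
  constructor <;> linarith

def XR (f : ConvFn n) (R : ℝ) (y : Eucl n) : Eucl n :=
  (InnerProductSpace.toDual ℝ (Eucl n)).symm (fderiv ℝ (fst f R) y)

lemma XR_measurable (f : ConvFn n) (R : ℝ) : Measurable (XR f R) :=
  (InnerProductSpace.toDual ℝ (Eucl n)).symm.continuous.measurable.comp (measurable_fderiv ℝ _)

lemma XR_eq {f : ConvFn n} {R : ℝ} (hR : 0 ≤ R) {y x : Eucl n} (hd : DifferentiableAt ℝ (fst f R) y)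
    (h : IsMx f R y x) : x = XR f R y := by
  have hmin : IsLocalMin (fun y' => fst f R y' - inner ℝ x y') y := by
    refine Eventually.of_forall fun y' => ?_
    have := fst_grad hR h y'
    rw [inner_sub_left, real_inner_comm, real_inner_comm x y] at this
    simp only
    linarith
  have h0 := hmin.fderiv_eq_zero
  have hin : HasFDerivAt (fun y' => inner ℝ x y') (InnerProductSpace.toDual ℝ (Eucl n) x) y :=
    (InnerProductSpace.toDual ℝ (Eucl n) x).hasFDerivAt
  have hsb : HasFDerivAt (fun y' => fst f R y' - inner ℝ x y')
      (fderiv ℝ (fst f R) y - InnerProductSpace.toDual ℝ (Eucl n) x) y := hd.hasFDerivAt.sub hin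
  rw [hsb.fderiv, sub_eq_zero] at h0
  rw [XR, h0]; simp

lemma ae_XR (f : ConvFn n) {R : ℝ} (hR : 0 ≤ R) :
    ∀ᵐ y, IsMx f R y (XR f R y) ∧ ∀ x, IsMx f R y x → x = XR f R y := by
  filter_upwards [(fst_lip f hR).ae_differentiableAt] with y hy
  obtain ⟨x, hx⟩ := exists_isMx f hR y
  refine ⟨?_, fun x hx => XR_eq hR hy hx⟩
  rw [← XR_eq hR hy hx]; exact hx

open Classical in
def ig (f : ConvFn n) (κ : Eucl n → ℝ → Eucl n → ℂ) (y : Eucl n) : ℂ :=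
  if h : ∃ x, IsU f y x then κ h.choose (f.1 h.choose) y else 0

lemma ig_eq {f : ConvFn n} {κ : Eucl n → ℝ → Eucl n → ℂ} {y x : Eucl n} (h : IsU f y x) :
    ig f κ y = κ x (f.1 x) y := by
  have hex : ∃ x, IsU f y x := ⟨x, h⟩
  have : hex.choose = x := h.2 _ hex.choose_spec.1
  rw [ig, dif_pos hex, this]

lemma ig_none {f : ConvFn n} {κ : Eucl n → ℝ → Eucl n → ℂ} {y : Eucl n} (h : ¬ ∃ x, IsU f y x) :
    ig f κ y = 0 := by
  rw [ig, dif_neg h]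

lemma ig_of_max {f : ConvFn n} {κ : Eucl n → ℝ → Eucl n → ℂ} {R : ℝ}
    (hκ : ∀ x r y, R ≤ ‖x‖ → κ x r y = 0) {y X : Eucl n} (h : IsMx f R y X)
    (hu : ∀ x, IsMx f R y x → x = X) : ig f κ y = κ X (f.1 X) y := by
  by_cases hX : R ≤ ‖X‖
  · rw [hκ _ _ _ hX]
    by_cases hex : ∃ x, IsU f y x
    · obtain ⟨x, hx⟩ := hex
      rw [ig_eq hx]
      apply hκ
      by_contra hlt
      push Not at hlt
      have : x = X := hu x ⟨by simpa using hlt.le, fun z _ => (sub_iff f x y).1 hx.1 z⟩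
      rw [this] at hlt; linarith
    · exact ig_none hex
  · push Not at hX
    apply ig_eq
    have hsub : SubG f X y := by
      apply sub_of_local
      have : ball (0 : Eucl n) R ∈ 𝓝 X := isOpen_ball.mem_nhds (by simpa using hX)
      filter_upwards [this] with z hz
      have := h.2 z (ball_subset_closedBall hz)
      rw [inner_sub_right]; linarith
    refine ⟨hsub, fun x' hx' => ?_⟩
    have hc : Tendsto (fun t : ℝ => X + t • (x' - X)) (𝓝[>] 0) (𝓝 X) := by
      have : Continuous fun t : ℝ => X + t • (x' - X) := by fun_prop
      have := this.tendsto 0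
      simp only [zero_smul, add_zero] at this
      exact this.mono_left nhdsWithin_le_nhds
    have hev := hc.eventually (isOpen_ball.mem_nhds (show X ∈ ball (0 : Eucl n) R by simpa using hX))
    have hev2 : ∀ᶠ t : ℝ in 𝓝[>] 0, t ∈ Set.Ioo (0 : ℝ) 1 := Ioo_mem_nhdsGT one_pos
    obtain ⟨t, ht, ht2⟩ := (hev.and hev2).exists
    have h1 := sub_segment f X x' y hsub hx' t ht2.1.le ht2.2.le
    have h2 := hu _ ⟨ball_subset_closedBall ht, fun z _ => (sub_iff _ _ _).1 h1 z⟩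
    have h3 : t • (x' - X) = 0 := by simpa using h2
    rcases smul_eq_zero.1 h3 with h | h
    · linarith [ht2.1]
    · exact sub_eq_zero.1 h

lemma ig_ae {f : ConvFn n} {κ : Eucl n → ℝ → Eucl n → ℂ} {R : ℝ} (hR : 0 ≤ R)
    (hκ : ∀ x r y, R ≤ ‖x‖ → κ x r y = 0) :
    ∀ᵐ y, ig f κ y = κ (XR f R y) (f.1 (XR f R y)) y := by
  filter_upwards [ae_XR f hR] with y hy
  exact ig_of_max hκ hy.1 hy.2

/-- admissible kernels -/
structure Good (κ : Eucl n → ℝ → Eucl n → ℂ) (R : ℝ) : Prop where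
  pos : 0 ≤ R
  cont : Continuous fun p : Eucl n × ℝ × Eucl n => κ p.1 p.2.1 p.2.2
  van : ∀ x r y, R ≤ ‖x‖ → κ x r y = 0

lemma ig_meas {f : ConvFn n} {κ : Eucl n → ℝ → Eucl n → ℂ} {R : ℝ} (hκ : Good κ R) :
    AEStronglyMeasurable (ig f κ) volume := by
  refine AEStronglyMeasurable.congr ?_ (EventuallyEq.symm (ig_ae hκ.pos hκ.van))
  have hm : Measurable fun y => (XR f R y, f.1 (XR f R y), y) :=
    (XR_measurable f R).prodMk ((f.1.continuous.measurable.comp (XR_measurable f R)).prodMk measurable_id)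
  exact (hκ.cont.measurable.comp hm).aestronglyMeasurable

lemma ig_bound {f : ConvFn n} {κ : Eucl n → ℝ → Eucl n → ℂ} {R L D : ℝ} (hR : 0 ≤ R)
    (hκ : ∀ x r y, R ≤ ‖x‖ → κ x r y = 0) (hf : ∀ x ∈ closedBall (0 : Eucl n) (R + 1), |f.1 x| ≤ L)
    (hD0 : 0 ≤ D)
    (hD : ∀ x r y, ‖x‖ ≤ R → |r| ≤ L → ‖y‖ ≤ 2 * L → ‖κ x r y‖ ≤ D) (y : Eucl n) :
    ‖ig f κ y‖ ≤ (closedBall (0 : Eucl n) (2 * L)).indicator (fun _ => D) y := by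
  by_cases h0 : ig f κ y = 0
  · rw [h0, norm_zero]; exact Set.indicator_nonneg (fun _ _ => hD0) _
  have hex : ∃ x, IsU f y x := by
    by_contra h; exact h0 (ig_none h)
  obtain ⟨x, hx⟩ := hex
  rw [ig_eq hx] at h0 ⊢
  have hxR : ‖x‖ < R := by
    by_contra h; push Not at h; exact h0 (hκ _ _ _ h)
  have hy : ‖y‖ ≤ 2 * L := by
    have h1 := hx.1 (x + ‖y‖⁻¹ • y)
    rw [add_sub_cancel_left, real_inner_smul_right, real_inner_self_eq_norm_sq] at h1
    have h2 : ‖y‖⁻¹ * ‖y‖ ^ 2 = ‖y‖ := by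
      by_cases h : ‖y‖ = 0
      · rw [h]; simp
      · field_simp
    have h3 := abs_le.1 (hf x (by simp; linarith))
    have hn : ‖‖y‖⁻¹ • y‖ ≤ 1 := by
      rw [norm_smul, norm_inv, norm_norm]
      exact inv_mul_le_one
    have h4 := abs_le.1 (hf (x + ‖y‖⁻¹ • y) (by
      rw [mem_closedBall, dist_zero_right]
      exact (norm_add_le _ _).trans (by linarith)))
    linarith
  rw [Set.indicator_of_mem (by simpa using hy)]
  exact hD _ _ _ hxR.le (hf x (by simp; linarith)) hy

lemma good_bound {κ : Eucl n → ℝ → Eucl n → ℂ} {R : ℝ} (hκ : Good κ R) (L : ℝ) :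
    ∃ D, 0 ≤ D ∧ ∀ x r y, ‖x‖ ≤ R → |r| ≤ L → ‖y‖ ≤ 2 * L → ‖κ x r y‖ ≤ D := by
  obtain ⟨D, hD⟩ := ((isCompact_closedBall (0 : Eucl n) R).prod
    ((isCompact_closedBall (0 : ℝ) L).prod (isCompact_closedBall (0 : Eucl n) (2 * L)))).exists_bound_of_continuousOn
    hκ.cont.continuousOn
  refine ⟨max D 0, le_max_right _ _, fun x r y hx hr hy => le_trans ?_ (le_max_left _ _)⟩
  exact hD (x, r, y) ⟨by simpa using hx, by simpa using hr, by simpa using hy⟩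

lemma conv_bound (f : ConvFn n) (R : ℝ) : ∃ L, 0 ≤ L ∧ ∀ x ∈ closedBall (0 : Eucl n) R, |f.1 x| ≤ L := by
  obtain ⟨L, hL⟩ := (isCompact_closedBall (0 : Eucl n) R).exists_bound_of_continuousOn
    (f := f.1) f.1.continuous.continuousOn
  exact ⟨max L 0, le_max_right _ _, fun x hx => (hL x hx).trans (le_max_left _ _)⟩

lemma ind_integrable (r D : ℝ) : Integrable ((closedBall (0 : Eucl n) r).indicator (fun _ => D)) volume := by
  rw [integrable_indicator_iff measurableSet_closedBall]
  exact integrableOn_const (measure_closedBall_lt_top.ne)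

lemma ig_integrable {f : ConvFn n} {κ : Eucl n → ℝ → Eucl n → ℂ} {R : ℝ} (hκ : Good κ R) :
    Integrable (ig f κ) volume := by
  obtain ⟨L, hL0, hL⟩ := conv_bound f (R + 1)
  obtain ⟨D, hD0, hD⟩ := good_bound hκ L
  exact (ind_integrable (2 * L) D).mono' (ig_meas hκ) (Eventually.of_forall (ig_bound hκ.pos hκ.van hL hD0 hD))

def J (f : ConvFn n) (κ : Eucl n → ℝ → Eucl n → ℂ) : ℂ := ∫ y, ig f κ y

lemma J_continuous {κ : Eucl n → ℝ → Eucl n → ℂ} {R : ℝ} (hκ : Good κ R) :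
    Continuous fun f : ConvFn n => J f κ := by
  rw [continuous_iff_seqContinuous]
  intro F f hF
  obtain ⟨L, hL0, hL⟩ := conv_bound f (R + 1)
  obtain ⟨D, hD0, hD⟩ := good_bound hκ (L + 1)
  refine tendsto_integral_filter_of_dominated_convergence _
    (Eventually.of_forall fun k => ig_meas hκ) ?_ (ind_integrable (2 * (L + 1)) D) ?_
  · filter_upwards [convFn_tendsto_unif hF (R + 1) 1 one_pos] with k hk
    refine Eventually.of_forall (ig_bound hκ.pos hκ.van (fun x hx => ?_) hD0 hD)
    have h1 := hk x (by simpa using hx)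
    have h2 := hL x hx
    have h3 : |(F k).1 x| ≤ |(F k).1 x - f.1 x| + |f.1 x| := by
      have := abs_add_le ((F k).1 x - f.1 x) (f.1 x); simpa using this
    linarith
  · filter_upwards [ae_XR f hκ.pos, ae_all_iff.2 fun k => ae_XR (F k) hκ.pos] with y hy hyk
    rw [ig_of_max hκ.van hy.1 hy.2]
    simp only [fun k => ig_of_max hκ.van (hyk k).1 (hyk k).2]
    have hX : Tendsto (fun k => XR (F k) R y) atTop (𝓝 (XR f R y)) := by
      refine argmax_tendsto (isCompact_closedBall (0 : Eucl n) R) (g := fun z => inner ℝ y z - f.1 z)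
        (G := fun k z => inner ℝ y z - (F k).1 z) (Continuous.continuousOn (by fun_prop)) ?_ hy.1.1
        (fun x hx h => hy.2 x ⟨hx, h⟩) (Eventually.of_forall fun k => (hyk k).1)
      intro ε hε
      filter_upwards [convFn_tendsto_unif hF R ε hε] with k hk x hx
      rw [sub_sub_sub_cancel_left, abs_sub_comm]
      exact hk x (by simpa using hx)
    have hv : Tendsto (fun k => (F k).1 (XR (F k) R y)) atTop (𝓝 (f.1 (XR f R y))) := by
      have h1 : Tendsto (fun k => f.1 (XR (F k) R y)) atTop (𝓝 (f.1 (XR f R y))) :=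
        (f.1.continuous.tendsto _).comp hX
      have h2 : Tendsto (fun k => (F k).1 (XR (F k) R y) - f.1 (XR (F k) R y)) atTop (𝓝 0) := by
        rw [Metric.tendsto_nhds]
        intro ε hε
        filter_upwards [convFn_tendsto_unif hF R ε hε] with k hk
        rw [dist_zero_right]
        exact hk _ (by simpa using (hyk k).1.1)
      simpa using h2.add h1
    exact (hκ.cont.tendsto (XR f R y, f.1 (XR f R y), y)).comp (hX.prodMk_nhds (hv.prodMk_nhds tendsto_const_nhds))
end Aux5

section Aux6
open MeasureTheory Filter Topology Metric
variable {n : ℕ}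

def Sdeg (n d : ℕ) : Finset (Fin (n + 1) →₀ ℕ) :=
  (Finset.range (d + 1)).biUnion fun k => Finset.finsuppAntidiag Finset.univ k

lemma mem_Sdeg {d : ℕ} {m : Fin (n + 1) →₀ ℕ} : m ∈ Sdeg n d ↔ ∑ i, m i ≤ d := by
  simp only [Sdeg, Finset.mem_biUnion, Finset.mem_range, Finset.mem_finsuppAntidiag, Finset.subset_univ, and_true]
  constructor
  · rintro ⟨k, hk, h⟩
    change Finset.univ.sum ⇑m ≤ d
    omega
  · intro h
    change Finset.univ.sum ⇑m ≤ d at h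
    exact ⟨_, by omega, rfl⟩

lemma supp_Sdeg {d : ℕ} {P : MvPolynomial (Fin (n + 1)) ℂ} (h : P.totalDegree ≤ d) : P.support ⊆ Sdeg n d := by
  intro m hm
  rw [mem_Sdeg]
  have := MvPolynomial.le_totalDegree hm
  rw [Finsupp.sum_fintype _ _ (by simp)] at this
  omega

lemma eval_Sdeg {d : ℕ} {P : MvPolynomial (Fin (n + 1)) ℂ} (h : P.totalDegree ≤ d) (w : Fin (n + 1) → ℂ) :
    MvPolynomial.eval w P = ∑ m ∈ Sdeg n d, P.coeff m * ∏ i, w i ^ m i := by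
  rw [MvPolynomial.eval_eq']
  refine Finset.sum_subset (supp_Sdeg h) fun m _ hm => ?_
  rw [MvPolynomial.notMem_support_iff.1 hm, zero_mul]

lemma totalDegree_aeval_le' {d : ℕ} {P : MvPolynomial (Fin (n + 1)) ℂ} (h : P.totalDegree ≤ d)
    (T : Fin (n + 1) → MvPolynomial (Fin (n + 1)) ℂ) (hT : ∀ i, (T i).totalDegree ≤ 1) :
    (MvPolynomial.aeval T P).totalDegree ≤ d := by
  rw [MvPolynomial.aeval_def, MvPolynomial.eval₂_eq']
  refine MvPolynomial.totalDegree_finsetSum_le fun m hm => ?_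
  have hm' := mem_Sdeg.1 (supp_Sdeg h hm)
  refine (MvPolynomial.totalDegree_mul _ _).trans ?_
  rw [MvPolynomial.algebraMap_eq, MvPolynomial.totalDegree_C, zero_add]
  refine (MvPolynomial.totalDegree_finsetProd _ _).trans (le_trans ?_ hm')
  refine Finset.sum_le_sum fun i _ => ?_
  refine (MvPolynomial.totalDegree_pow _ _).trans ?_
  have := hT i
  nlinarith

lemma wvec_continuous : Continuous fun p : ℝ × Eucl n => wvec p.1 p.2 := by
  refine continuous_pi fun i => ?_
  refine Fin.cases ?_ (fun j => ?_) i
  · simp only [wvec, Fin.cons_zero]; fun_prop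
  · simp only [wvec, Fin.cons_succ]; fun_prop

lemma eval_cont {T : Type*} [TopologicalSpace T] {d : ℕ} {P : T → MvPolynomial (Fin (n + 1)) ℂ}
    (h : ∀ x, (P x).totalDegree ≤ d)
    (hc : ∀ m, Continuous fun x => (P x).coeff m) {w : T → Fin (n + 1) → ℂ} (hw : Continuous w) :
    Continuous fun p => MvPolynomial.eval (w p) (P p) := by
  simp only [fun p => eval_Sdeg (h p)]
  refine continuous_finsetSum _ fun m _ => (hc m).mul ?_
  refine continuous_finsetProd _ fun i _ => ?_
  exact ((continuous_apply i).comp hw).pow _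

def kap (ψ : Eucl n → MvPolynomial (Fin (n + 1)) ℂ) (φ : C_c(Eucl n, ℂ)) : Eucl n → ℝ → Eucl n → ℂ :=
  fun x r y => φ x * MvPolynomial.eval (wvec r y) (ψ x)

lemma cc_vanish (φ : C_c(Eucl n, ℂ)) : ∃ R : ℝ, 0 ≤ R ∧ ∀ x, R ≤ ‖x‖ → φ x = 0 := by
  obtain ⟨R, hR, h⟩ := cc_tsupport_ball φ
  refine ⟨R + 1, by linarith, fun x hx => image_eq_zero_of_notMem_tsupport fun hxs => ?_⟩
  have := h hxs
  rw [mem_closedBall, dist_zero_right] at this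
  linarith

lemma good_mul (φ : C_c(Eucl n, ℂ)) {R : ℝ} (hR : 0 ≤ R) (hv : ∀ x, R ≤ ‖x‖ → φ x = 0)
    {c : Eucl n → ℝ → Eucl n → ℂ} (hc : Continuous fun p : Eucl n × ℝ × Eucl n => c p.1 p.2.1 p.2.2) :
    Good (fun x r y => φ x * c x r y) R where
  pos := hR
  cont := ((map_continuous φ).comp continuous_fst).mul hc
  van := fun x r y h => by rw [hv x h, zero_mul]

/-- hypotheses on the family psi -/
structure Fam (d : ℕ) (ψ : Eucl n → MvPolynomial (Fin (n + 1)) ℂ) : Prop where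
  hom : ∀ x, (ψ x).IsHomogeneous d
  cont : ∀ m : Fin (n + 1) →₀ ℕ, Continuous fun x => (ψ x).coeff m

lemma Fam.deg {d : ℕ} {ψ : Eucl n → MvPolynomial (Fin (n + 1)) ℂ} (h : Fam d ψ) (x) : (ψ x).totalDegree ≤ d :=
  (h.hom x).totalDegree_le

lemma Fam.evc {d : ℕ} {ψ : Eucl n → MvPolynomial (Fin (n + 1)) ℂ} (h : Fam d ψ) :
    Continuous fun p : Eucl n × ℝ × Eucl n => MvPolynomial.eval (wvec p.2.1 p.2.2) (ψ p.1) :=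
  eval_cont (P := fun p : Eucl n × ℝ × Eucl n => ψ p.1) (fun p => h.deg p.1) (fun m => (h.cont m).comp continuous_fst)
    (wvec_continuous.comp continuous_snd)

lemma ig_add (f : ConvFn n) (κ κ' : Eucl n → ℝ → Eucl n → ℂ) (y : Eucl n) :
    ig f (fun x r y => κ x r y + κ' x r y) y = ig f κ y + ig f κ' y := by
  by_cases h : ∃ x, IsU f y x
  · obtain ⟨x, hx⟩ := h
    rw [ig_eq hx, ig_eq hx, ig_eq hx]
  · rw [ig_none h, ig_none h, ig_none h, add_zero]

lemma ig_smul (f : ConvFn n) (c : ℂ) (κ : Eucl n → ℝ → Eucl n → ℂ) (y : Eucl n) :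
    ig f (fun x r y => c * κ x r y) y = c * ig f κ y := by
  by_cases h : ∃ x, IsU f y x
  · obtain ⟨x, hx⟩ := h
    rw [ig_eq hx, ig_eq hx]
  · rw [ig_none h, ig_none h, mul_zero]

lemma ig_sum (f : ConvFn n) {ι : Type*} (S : Finset ι) (κ : ι → Eucl n → ℝ → Eucl n → ℂ) (y : Eucl n) :
    ig f (fun x r y => ∑ i ∈ S, κ i x r y) y = ∑ i ∈ S, ig f (κ i) y := by
  by_cases h : ∃ x, IsU f y x
  · obtain ⟨x, hx⟩ := h
    rw [ig_eq hx]
    exact Finset.sum_congr rfl fun i _ => (ig_eq hx).symm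
  · rw [ig_none h, Finset.sum_eq_zero fun i _ => ig_none h]

lemma J_add (f : ConvFn n) {κ κ' : Eucl n → ℝ → Eucl n → ℂ} {R R' : ℝ} (h : Good κ R) (h' : Good κ' R') :
    J f (fun x r y => κ x r y + κ' x r y) = J f κ + J f κ' := by
  unfold J
  rw [← integral_add (ig_integrable h) (ig_integrable h')]
  exact integral_congr_ae (Eventually.of_forall fun y => ig_add f κ κ' y)

lemma J_smul (f : ConvFn n) (c : ℂ) (κ : Eucl n → ℝ → Eucl n → ℂ) :
    J f (fun x r y => c * κ x r y) = c * J f κ := by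
  unfold J
  rw [← integral_const_mul]
  exact integral_congr_ae (Eventually.of_forall fun y => ig_smul f c κ y)

lemma J_sum (f : ConvFn n) {ι : Type*} (S : Finset ι) (κ : ι → Eucl n → ℝ → Eucl n → ℂ) {R : ℝ}
    (h : ∀ i ∈ S, Good (κ i) R) :
    J f (fun x r y => ∑ i ∈ S, κ i x r y) = ∑ i ∈ S, J f (κ i) := by
  unfold J
  rw [← integral_finsetSum _ fun i hi => ig_integrable (h i hi)]
  exact integral_congr_ae (Eventually.of_forall fun y => ig_sum f S κ y)

def PsiP {d : ℕ} (ψ : Eucl n → MvPolynomial (Fin (n + 1)) ℂ) (hψ : Fam d ψ) (f : ConvFn n) : RadonMeasure n :=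
  ⟨{ toFun := fun φ => J f (kap ψ φ)
     map_add' := by
      intro φ φ'
      obtain ⟨R, hR, hv⟩ := cc_vanish φ
      obtain ⟨R', hR', hv'⟩ := cc_vanish φ'
      refine Eq.trans ?_ (J_add f (κ := kap ψ φ) (κ' := kap ψ φ') (good_mul φ hR hv hψ.evc) (good_mul φ' hR' hv' hψ.evc))
      congr 1
      funext x r y
      change (φ x + φ' x) * _ = φ x * _ + φ' x * _
      ring
     map_smul' := by
      intro c φ
      rw [RingHom.id_apply, smul_eq_mul, ← J_smul]
      congr 1
      funext x r y
      change (c * φ x) * _ = c * (φ x * _)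
      ring }, by
    intro A hA
    obtain ⟨R, hR⟩ := hA.isBounded.subset_closedBall 0
    obtain ⟨L, hL0, hL⟩ := conv_bound f (max R 0 + 1 + 1)
    obtain ⟨D, hD⟩ := ((isCompact_closedBall (0 : Eucl n) (max R 0 + 1)).prod
      ((isCompact_closedBall (0 : ℝ) L).prod
        (isCompact_closedBall (0 : Eucl n) (2 * L)))).exists_bound_of_continuousOn hψ.evc.continuousOn
    refine ⟨∫ y, (closedBall (0 : Eucl n) (2 * L)).indicator (fun _ => max D 0) y, fun φ hs hb => ?_⟩
    refine norm_integral_le_of_norm_le (ind_integrable _ _) (Eventually.of_forall fun y => ?_)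
    refine ig_bound (R := max R 0 + 1) (by positivity) ?_ hL (le_max_right _ _) ?_ y
    · intro x r y hx
      have : φ x = 0 := image_eq_zero_of_notMem_tsupport fun hxs => by
        have := hR (hs hxs)
        rw [mem_closedBall, dist_zero_right] at this
        have := le_max_left R 0
        linarith
      simp [kap, this]
    · intro x r y hx hr hy
      rw [kap, norm_mul]
      have h1 := hD (x, r, y) ⟨by simpa using hx, by simpa using hr, by simpa using hy⟩
      calc _ ≤ 1 * max D 0 := mul_le_mul (hb x) (h1.trans (le_max_left _ _)) (norm_nonneg _) zero_le_one
        _ = _ := one_mul _⟩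

lemma PsiP_apply {d : ℕ} {ψ : Eucl n → MvPolynomial (Fin (n + 1)) ℂ} (hψ : Fam d ψ) (f : ConvFn n)
    (φ : C_c(Eucl n, ℂ)) : (PsiP ψ hψ f).1 φ = ∫ y, ig f (kap ψ φ) y := rfl

lemma isU_local {f h : ConvFn n} {U : Set (Eucl n)} (hU : IsOpen U) (he : ∀ x ∈ U, f.1 x = h.1 x)
    {x y : Eucl n} (hx : x ∈ U) (hu : IsU f y x) : IsU h y x := by
  have tr : ∀ (f h : ConvFn n) (_ : ∀ x ∈ U, f.1 x = h.1 x) (x : Eucl n), x ∈ U → SubG f x y → SubG h x y := by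
    intro f h he x hx hs
    apply sub_of_local
    filter_upwards [hU.mem_nhds hx] with z hz
    rw [← he x hx, ← he z hz]; exact hs z
  have hs := tr f h he x hx hu.1
  refine ⟨hs, fun x' hx' => ?_⟩
  have hc : Tendsto (fun t : ℝ => x + t • (x' - x)) (𝓝[>] 0) (𝓝 x) := by
    have : Continuous fun t : ℝ => x + t • (x' - x) := by fun_prop
    have := this.tendsto 0
    simp only [zero_smul, add_zero] at this
    exact this.mono_left nhdsWithin_le_nhds
  have hev := hc.eventually (hU.mem_nhds hx)
  have hev2 : ∀ᶠ t : ℝ in 𝓝[>] 0, t ∈ Set.Ioo (0 : ℝ) 1 := Ioo_mem_nhdsGT one_pos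
  obtain ⟨t, ht, ht2⟩ := (hev.and hev2).exists
  have h1 := sub_segment h x x' y hs hx' t ht2.1.le ht2.2.le
  have h2 := hu.2 _ (tr h f (fun x hx => (he x hx).symm) _ ht h1)
  have h3 : t • (x' - x) = 0 := by simpa using h2
  rcases smul_eq_zero.1 h3 with h | h
  · linarith [ht2.1]
  · exact sub_eq_zero.1 h

lemma ig_local {f h : ConvFn n} {U : Set (Eucl n)} (hU : IsOpen U) (he : ∀ x ∈ U, f.1 x = h.1 x)
    {κ : Eucl n → ℝ → Eucl n → ℂ} (hκ : ∀ x r y, x ∉ U → κ x r y = 0) (y : Eucl n) : ig f κ y = ig h κ y := by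
  by_cases h1 : ∃ x ∈ U, IsU f y x
  · obtain ⟨x, hx, hu⟩ := h1
    rw [ig_eq hu, ig_eq (isU_local hU he hx hu), he x hx]
  · have z1 : ∀ f : ConvFn n, (¬ ∃ x ∈ U, IsU f y x) → ig f κ y = 0 := by
      intro f h1
      by_cases h2 : ∃ x, IsU f y x
      · obtain ⟨x, hx⟩ := h2
        rw [ig_eq hx, hκ _ _ _ fun hxU => h1 ⟨x, hxU, hx⟩]
      · exact ig_none h2
    rw [z1 f h1, z1 h]
    rintro ⟨x, hx, hu⟩
    exact h1 ⟨x, hx, isU_local hU (fun x hx => (he x hx).symm) hx hu⟩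

lemma PsiP_local {d : ℕ} {ψ : Eucl n → MvPolynomial (Fin (n + 1)) ℂ} (hψ : Fam d ψ) :
    IsLocalFunctional (PsiP ψ hψ) := by
  intro f h U hU he φ hs
  rw [PsiP_apply, PsiP_apply]
  refine integral_congr_ae (Eventually.of_forall fun y => ig_local hU he (fun x r y hx => ?_) y)
  rw [kap, image_eq_zero_of_notMem_tsupport fun hxs => hx (hs hxs), zero_mul]

lemma PsiP_cont {d : ℕ} {ψ : Eucl n → MvPolynomial (Fin (n + 1)) ℂ} (hψ : Fam d ψ) :
    IsContinuousFunctional (PsiP ψ hψ) := by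
  intro φ
  obtain ⟨R, hR, hv⟩ := cc_vanish φ
  exact J_continuous (good_mul φ hR hv hψ.evc)

lemma sub_addAffine (f : ConvFn n) (s : ℝ) (v x y : Eucl n) :
    SubG (addAffine f s v) x y ↔ SubG f x (y - v) := by
  unfold SubG
  refine forall_congr' fun z => ?_
  rw [addAffine_apply, addAffine_apply, inner_sub_left, inner_sub_right, inner_sub_right]
  constructor <;> intro h <;> linarith

lemma isU_addAffine (f : ConvFn n) (s : ℝ) (v x y : Eucl n) :
    IsU (addAffine f s v) y x ↔ IsU f (y - v) x := by
  simp only [IsU, sub_addAffine]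

lemma ig_addAffine (f : ConvFn n) (s : ℝ) (v y : Eucl n) (κ : Eucl n → ℝ → Eucl n → ℂ) :
    ig (addAffine f s v) κ y = ig f (fun x r y' => κ x (r + (s + inner ℝ v x)) (y' + v)) (y - v) := by
  by_cases h : ∃ x, IsU f (y - v) x
  · obtain ⟨x, hx⟩ := h
    rw [ig_eq hx, ig_eq ((isU_addAffine f s v x y).2 hx), addAffine_apply, sub_add_cancel]
  · rw [ig_none h, ig_none]
    simpa only [isU_addAffine] using h

lemma J_addAffine (f : ConvFn n) (s : ℝ) (v : Eucl n) (κ : Eucl n → ℝ → Eucl n → ℂ) :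
    J (addAffine f s v) κ = J f (fun x r y' => κ x (r + (s + inner ℝ v x)) (y' + v)) := by
  unfold J
  simp only [ig_addAffine]
  exact integral_sub_right_eq_self (fun y => ig f (fun x r y' => κ x (r + (s + inner ℝ v x)) (y' + v)) y) v

def addPoly (x : Eucl n) (r : ℝ) (y : Eucl n) : Fin (n + 1) → MvPolynomial (Fin (n + 1)) ℂ :=
  Fin.cons (MvPolynomial.X 0 + MvPolynomial.C (r : ℂ) + ∑ i, MvPolynomial.C (x i : ℂ) * MvPolynomial.X i.succ)
    fun i => MvPolynomial.X i.succ + MvPolynomial.C (y i : ℂ)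

lemma eval_addPoly (x : Eucl n) (r : ℝ) (y : Eucl n) (s : ℝ) (v : Eucl n) (P : MvPolynomial (Fin (n + 1)) ℂ) :
    MvPolynomial.eval (wvec s v) (MvPolynomial.aeval (addPoly x r y) P) =
      MvPolynomial.eval (wvec (r + (s + inner ℝ v x)) (y + v)) P := by
  rw [MvPolynomial.aeval_def, MvPolynomial.algebraMap_eq, MvPolynomial.eval_eval₂]
  rw [MvPolynomial.eval]
  congr 1
  · ext <;> simp
  · funext i
    refine Fin.cases ?_ (fun j => ?_) i
    · simp [addPoly, wvec, PiLp.inner_apply]; ring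
    · simp [addPoly, wvec]; ring

lemma addPoly_deg (x : Eucl n) (r : ℝ) (y : Eucl n) (i) : (addPoly x r y i).totalDegree ≤ 1 := by
  refine Fin.cases ?_ (fun j => ?_) i
  · simp only [addPoly, Fin.cons_zero]
    refine (MvPolynomial.totalDegree_add _ _).trans (max_le ((MvPolynomial.totalDegree_add _ _).trans
      (max_le (by simp) (by simp))) ?_)
    refine MvPolynomial.totalDegree_finsetSum_le fun i _ => ?_
    refine (MvPolynomial.totalDegree_mul _ _).trans (by simp)
  · simp only [addPoly, Fin.cons_succ]
    exact (MvPolynomial.totalDegree_add _ _).trans (max_le (by simp) (by simp))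

lemma PsiP_poly {d : ℕ} {ψ : Eucl n → MvPolynomial (Fin (n + 1)) ℂ} (hψ : Fam d ψ) :
    IsPolynomialDeg d (PsiP ψ hψ) := by
  intro f φ
  obtain ⟨R, hR, hv⟩ := cc_vanish φ
  let B : Eucl n → ℝ → Eucl n → MvPolynomial (Fin (n + 1)) ℂ := fun x r y => MvPolynomial.aeval (addPoly x r y) (ψ x)
  have hBd : ∀ x r y, (B x r y).totalDegree ≤ d := fun x r y =>
    totalDegree_aeval_le' (hψ.deg x) _ (addPoly_deg x r y)
  have hBc : ∀ m, Continuous fun p : Eucl n × ℝ × Eucl n => (B p.1 p.2.1 p.2.2).coeff m := by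
    refine coeff_continuous (fun p : Eucl n × ℝ × Eucl n => B p.1 p.2.1 p.2.2) (fun p => hBd _ _ _) fun s v => ?_
    simp only [B, eval_addPoly]
    refine hψ.evc.comp (f := fun p : Eucl n × ℝ × Eucl n => (p.1, (p.2.1 + (s + inner ℝ v p.1)), p.2.2 + v)) ?_
    fun_prop
  let κ : (Fin (n + 1) →₀ ℕ) → Eucl n → ℝ → Eucl n → ℂ := fun m x r y => φ x * (B x r y).coeff m
  have hκ : ∀ m, Good (κ m) R := fun m => good_mul φ hR hv (hBc m)
  refine ⟨∑ m ∈ Sdeg n d, MvPolynomial.monomial m (J f (κ m)), ?_, fun s v => ?_⟩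
  · refine MvPolynomial.totalDegree_finsetSum_le fun m hm => ?_
    refine (MvPolynomial.totalDegree_monomial_le _ _).trans ?_
    rw [Finsupp.sum_fintype _ _ (by simp)]
    exact mem_Sdeg.1 hm
  · change J (addAffine f s v) (kap ψ φ) = MvPolynomial.eval (wvec s v) _
    rw [J_addAffine]
    have e1 : (fun x r y' => kap ψ φ x (r + (s + inner ℝ v x)) (y' + v)) =
        fun x r y => ∑ m ∈ Sdeg n d, (∏ i, wvec s v i ^ m i) * κ m x r y := by
      funext x r y
      rw [kap, ← eval_addPoly, eval_Sdeg (hBd x r y), Finset.mul_sum]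
      refine Finset.sum_congr rfl fun m _ => ?_
      simp only [κ]; ring
    have hg : ∀ m ∈ Sdeg n d, Good (fun x r y => (∏ i, wvec s v i ^ m i) * κ m x r y) R := fun m _ =>
      ⟨hR, continuous_const.mul (hκ m).cont, fun x r y h => by rw [(hκ m).van x r y h, mul_zero]⟩
    rw [e1, J_sum f _ (fun m x r y => (∏ i, wvec s v i ^ m i) * κ m x r y) hg, map_sum]
    refine Finset.sum_congr rfl fun m _ => ?_
    rw [J_smul, MvPolynomial.eval_monomial, Finsupp.prod_fintype _ _ (by simp)]
    ring

lemma subG_smul (f : ConvFn n) (t : ℝ≥0) (ht : 0 < t) (x y : Eucl n) :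
    SubG (smulConv t f) x y ↔ SubG f x ((t : ℝ)⁻¹ • y) := by
  unfold SubG
  refine forall_congr' fun z => ?_
  have ht' : (0 : ℝ) < t := by exact_mod_cast ht
  rw [smulConv_apply, smulConv_apply, real_inner_smul_left]
  have e : (t : ℝ) * f.1 x + inner ℝ y (z - x) = t * (f.1 x + (t : ℝ)⁻¹ * inner ℝ y (z - x)) := by
    field_simp
  rw [e]
  exact mul_le_mul_iff_of_pos_left ht'

lemma ig_smulConv (f : ConvFn n) (t : ℝ≥0) (ht : 0 < t) (y : Eucl n) (κ : Eucl n → ℝ → Eucl n → ℂ) :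
    ig (smulConv t f) κ y = ig f (fun x r y' => κ x (t * r) ((t : ℝ) • y')) ((t : ℝ)⁻¹ • y) := by
  have ht' : (t : ℝ) ≠ 0 := by exact_mod_cast ht.ne'
  have hiff : ∀ x, IsU (smulConv t f) y x ↔ IsU f ((t : ℝ)⁻¹ • y) x := by
    intro x; simp only [IsU, subG_smul f t ht]
  by_cases h : ∃ x, IsU f ((t : ℝ)⁻¹ • y) x
  · obtain ⟨x, hx⟩ := h
    rw [ig_eq hx, ig_eq ((hiff x).2 hx), smulConv_apply, smul_inv_smul₀ ht']
  · rw [ig_none h, ig_none]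
    simpa only [hiff] using h

lemma PsiP_hom_pos {d : ℕ} {ψ : Eucl n → MvPolynomial (Fin (n + 1)) ℂ} (hψ : Fam d ψ) (f : ConvFn n)
    (t : ℝ≥0) (ht : 0 < t) (φ : C_c(Eucl n, ℂ)) :
    (PsiP ψ hψ (smulConv t f)).1 φ = ((t : ℝ) : ℂ) ^ (n + d) * (PsiP ψ hψ f).1 φ := by
  rw [PsiP_apply, PsiP_apply]
  simp only [ig_smulConv f t ht]
  rw [Measure.integral_comp_inv_smul volume
    (fun y => ig f (fun x r y' => kap ψ φ x (t * r) ((t : ℝ) • y')) y) (t : ℝ)]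
  have e : (fun (x : Eucl n) (r : ℝ) (y' : Eucl n) => kap ψ φ x (t * r) ((t : ℝ) • y')) =
      fun x r y => ((t : ℝ) : ℂ) ^ d * kap ψ φ x r y := by
    funext x r y
    rw [kap, wvec_smul, hom_eval_smul (hψ.hom x), kap]; ring
  rw [e]
  simp only [ig_smul]
  rw [integral_const_mul, finrank_euclideanSpace, Fintype.card_fin, abs_of_nonneg (by positivity), pow_add,
    Complex.real_smul]
  push_cast
  ring

lemma smulConv_tendsto (f : ConvFn n) {ι : Type*} {l : Filter ι} {t : ι → ℝ≥0} {t₀ : ℝ≥0}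
    (ht : Tendsto t l (𝓝 t₀)) : Tendsto (fun i => smulConv (t i) f) l (𝓝 (smulConv t₀ f)) := by
  apply tendsto_convFn
  intro R ε hε
  obtain ⟨L, hL0, hL⟩ := conv_bound f R
  have ht' : Tendsto (fun i => (t i : ℝ)) l (𝓝 t₀) := (NNReal.continuous_coe.tendsto _).comp ht
  rw [Metric.tendsto_nhds] at ht'
  filter_upwards [ht' (ε / (L + 1)) (by positivity)] with i hi x hx
  rw [smulConv_apply, smulConv_apply, ← sub_mul, abs_mul]
  rw [Real.dist_eq, lt_div_iff₀ (by positivity)] at hi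
  have := hL x (by simpa using hx)
  nlinarith [abs_nonneg ((t i : ℝ) - t₀)]

lemma PsiP_hom {d : ℕ} {ψ : Eucl n → MvPolynomial (Fin (n + 1)) ℂ} (hψ : Fam d ψ) :
    IsHomogeneousDeg (n + d) (PsiP ψ hψ) := by
  intro f t
  apply Subtype.ext
  apply LinearMap.ext
  intro φ
  change (PsiP ψ hψ (smulConv t f)).1 φ = ((t : ℝ) : ℂ) ^ (n + d) * (PsiP ψ hψ f).1 φ
  rcases eq_or_lt_of_le (zero_le : 0 ≤ t) with h | h
  · subst h
    have hseq : Tendsto (fun k : ℕ => (1 / ((k : ℝ≥0) + 1))) atTop (𝓝 0) := tendsto_one_div_add_atTop_nhds_zero_nat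
    have h1 := ((PsiP_cont hψ φ).tendsto _).comp (smulConv_tendsto f hseq)
    have h2 : Tendsto (fun k : ℕ => (((1 / ((k : ℝ≥0) + 1) : ℝ≥0) : ℝ) : ℂ) ^ (n + d) * (PsiP ψ hψ f).1 φ) atTop
        (𝓝 (((((0 : ℝ≥0) : ℝ)) : ℂ) ^ (n + d) * (PsiP ψ hψ f).1 φ)) := by
      have hc : Continuous fun t : ℝ≥0 => ((t : ℝ) : ℂ) ^ (n + d) * (PsiP ψ hψ f).1 φ := by fun_prop
      exact (hc.tendsto 0).comp hseq
    refine tendsto_nhds_unique h1 (h2.congr fun k => ?_)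
    exact (PsiP_hom_pos hψ f _ (by positivity) φ).symm
  · exact PsiP_hom_pos hψ f t h φ

lemma PsiP_mem {d : ℕ} {ψ : Eucl n → MvPolynomial (Fin (n + 1)) ℂ} (hψ : Fam d ψ) : MemPdLV d (PsiP ψ hψ) :=
  ⟨PsiP_local hψ, PsiP_cont hψ, PsiP_poly hψ⟩
end Aux6

section Aux7
open MeasureTheory Filter Topology Metric
variable {n : ℕ}

def gr (f : ConvFn n) (x : Eucl n) : Eucl n := (InnerProductSpace.toDual ℝ (Eucl n)).symm (fderiv ℝ (⇑f.1) x)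

lemma gr_inner (f : ConvFn n) (x z : Eucl n) : inner ℝ (gr f x) z = fderiv ℝ (⇑f.1) x z := by
  rw [gr, InnerProductSpace.toDual_symm_apply]

lemma gr_coord (f : ConvFn n) (x : Eucl n) (i : Fin n) : gr f x i = gradVec (⇑f.1) x i := by
  rw [gradVec, ← gr_inner, real_inner_comm, EuclideanSpace.inner_single_left]; simp

lemma sub_gr {f : ConvFn n} {x : Eucl n} (hd : DifferentiableAt ℝ (⇑f.1) x) : SubG f x (gr f x) := by
  intro z
  rw [gr_inner]
  have h1 : HasDerivAt (fun t : ℝ => f.1 (x + t • (z - x))) (fderiv ℝ (⇑f.1) x (z - x)) 0 := by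
    have h2 : HasDerivAt (fun t : ℝ => x + t • (z - x)) (z - x) 0 := by
      have := ((hasDerivAt_id (0 : ℝ)).smul_const (z - x)).const_add x
      simpa using this
    have h3 : HasFDerivAt (⇑f.1) (fderiv ℝ (⇑f.1) x) (x + (0 : ℝ) • (z - x)) := by simpa using hd.hasFDerivAt
    exact h3.comp_hasDerivAt (0 : ℝ) h2
  have h4 := h1.tendsto_slope_zero_right
  have h5 : fderiv ℝ (⇑f.1) x (z - x) ≤ f.1 z - f.1 x := by
    refine le_of_tendsto h4 ?_
    filter_upwards [Ioo_mem_nhdsGT (zero_lt_one' ℝ)] with t ht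
    have hc := f.2.2 (Set.mem_univ x) (Set.mem_univ z) (sub_nonneg.2 ht.2.le) ht.1.le (by ring)
    have e : (1 - t) • x + t • z = x + t • (z - x) := by module
    rw [e] at hc
    simp only [smul_eq_mul, zero_add, zero_smul, add_zero] at hc ⊢
    rw [inv_mul_le_iff₀ ht.1]
    linarith
  linarith

lemma gr_of_sub {f : ConvFn n} {x y : Eucl n} (hd : DifferentiableAt ℝ (⇑f.1) x) (h : SubG f x y) : y = gr f x := by
  have hmin : IsLocalMin (fun z => f.1 z - inner ℝ y z) x := by
    refine Eventually.of_forall fun z => ?_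
    have := h z
    rw [inner_sub_right] at this
    simp only
    linarith
  have h0 := hmin.fderiv_eq_zero
  have hin : HasFDerivAt (fun z => inner ℝ y z) (InnerProductSpace.toDual ℝ (Eucl n) y) x :=
    (InnerProductSpace.toDual ℝ (Eucl n) y).hasFDerivAt
  have hsb : HasFDerivAt (fun z => f.1 z - inner ℝ y z)
      (fderiv ℝ (⇑f.1) x - InnerProductSpace.toDual ℝ (Eucl n) y) x := hd.hasFDerivAt.sub hin
  rw [hsb.fderiv, sub_eq_zero] at h0
  rw [gr, h0]; simp

def Dgr (f : ConvFn n) (x : Eucl n) : Eucl n →L[ℝ] Eucl n :=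
  ((InnerProductSpace.toDual ℝ (Eucl n)).symm.toContinuousLinearEquiv.toContinuousLinearMap :
    (Eucl n →L[ℝ] ℝ) →L[ℝ] Eucl n) ∘L (fderiv ℝ (fderiv ℝ (⇑f.1)) x)

lemma gr_hasFDeriv {f : ConvFn n} (hf : ContDiff ℝ 2 (⇑f.1)) (x : Eucl n) : HasFDerivAt (gr f) (Dgr f x) x := by
  have h1 : ContDiff ℝ 1 (fderiv ℝ (⇑f.1)) := hf.fderiv_right (by norm_num)
  have h2 : HasFDerivAt (fderiv ℝ (⇑f.1)) (fderiv ℝ (fderiv ℝ (⇑f.1)) x) x :=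
    (h1.differentiable (by norm_num) x).hasFDerivAt
  exact ((InnerProductSpace.toDual ℝ (Eucl n)).symm.toContinuousLinearEquiv.toContinuousLinearMap :
    (Eucl n →L[ℝ] ℝ) →L[ℝ] Eucl n).hasFDerivAt.comp x h2

lemma gr_continuous {f : ConvFn n} (hf : ContDiff ℝ 2 (⇑f.1)) : Continuous (gr f) :=
  continuous_iff_continuousAt.2 fun x => (gr_hasFDeriv hf x).continuousAt

lemma Dgr_continuous {f : ConvFn n} (hf : ContDiff ℝ 2 (⇑f.1)) : Continuous (Dgr f) := by
  have h1 : ContDiff ℝ 1 (fderiv ℝ (⇑f.1)) := hf.fderiv_right (by norm_num)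
  have h2 : Continuous (fderiv ℝ (fderiv ℝ (⇑f.1))) := h1.continuous_fderiv (by norm_num)
  exact continuous_const.clm_comp h2

lemma Dgr_det {f : ConvFn n} (hf : ContDiff ℝ 2 (⇑f.1)) (x : Eucl n) :
    (Dgr f x).det = (hessMat (⇑f.1) x).det := by
  have h1 : ContDiff ℝ 1 (fderiv ℝ (⇑f.1)) := hf.fderiv_right (by norm_num)
  have h2 : DifferentiableAt ℝ (fderiv ℝ (⇑f.1)) x := h1.differentiable (by norm_num) x
  have e : ∀ i j, hessMat (⇑f.1) x i j =
      fderiv ℝ (fderiv ℝ (⇑f.1)) x (EuclideanSpace.single i 1) (EuclideanSpace.single j 1) := by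
    intro i j
    have h3 : HasFDerivAt (fun y => fderiv ℝ (⇑f.1) y (EuclideanSpace.single j 1))
        ((fderiv ℝ (fderiv ℝ (⇑f.1)) x).flip (EuclideanSpace.single j 1)) x := by
      have := h2.hasFDerivAt.clm_apply (hasFDerivAt_const (EuclideanSpace.single j (1 : ℝ)) x)
      simpa using this
    rw [hessMat, Matrix.of_apply, h3.fderiv]
    rfl
  rw [ContinuousLinearMap.det, ← LinearMap.det_toMatrix (EuclideanSpace.basisFun (Fin n) ℝ).toBasis, ← Matrix.det_transpose]
  congr 1
  ext i j
  rw [Matrix.transpose_apply, LinearMap.toMatrix_apply, e]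
  simp only [OrthonormalBasis.coe_toBasis, OrthonormalBasis.coe_toBasis_repr_apply, EuclideanSpace.basisFun_repr,
    EuclideanSpace.basisFun_apply]
  change ((InnerProductSpace.toDual ℝ (Eucl n)).symm (fderiv ℝ (fderiv ℝ (⇑f.1)) x (EuclideanSpace.single i 1))) j = _
  rw [← InnerProductSpace.toDual_symm_apply, real_inner_comm, EuclideanSpace.inner_single_left]; simp

lemma gr_mono {f : ConvFn n} (hf : ContDiff ℝ 2 (⇑f.1)) (x z : Eucl n) :
    0 ≤ inner ℝ (gr f z - gr f x) (z - x) := by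
  have hd := hf.differentiable (by norm_num)
  have h1 := sub_gr (hd x) z
  have h2 := sub_gr (hd z) x
  rw [inner_sub_left]
  rw [← neg_sub z x, inner_neg_right] at h2
  linarith

lemma Dgr_psd {f : ConvFn n} (hf : ContDiff ℝ 2 (⇑f.1)) (x u : Eucl n) : 0 ≤ inner ℝ (Dgr f x u) u := by
  have h1 : HasDerivAt (fun t : ℝ => gr f (x + t • u)) (Dgr f x u) 0 := by
    have h2 : HasDerivAt (fun t : ℝ => x + t • u) u 0 := by
      have := ((hasDerivAt_id (0 : ℝ)).smul_const u).const_add x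
      simpa using this
    have h3 : HasFDerivAt (gr f) (Dgr f x) (x + (0 : ℝ) • u) := by simpa using gr_hasFDeriv hf x
    exact h3.comp_hasDerivAt (0 : ℝ) h2
  have h4 := h1.tendsto_slope_zero_right
  have h5 : Tendsto (fun t : ℝ => inner ℝ (t⁻¹ • (gr f (x + (0 + t) • u) - gr f (x + (0 : ℝ) • u))) u) (𝓝[>] 0)
      (𝓝 (inner ℝ (Dgr f x u) u)) := h4.inner tendsto_const_nhds
  refine ge_of_tendsto h5 ?_
  filter_upwards [self_mem_nhdsWithin] with t ht
  have ht' : (0 : ℝ) < t := ht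
  have := gr_mono hf x (x + t • u)
  rw [add_sub_cancel_left, real_inner_smul_right] at this
  rw [real_inner_smul_left, zero_add, zero_smul, add_zero]
  have h6 := nonneg_of_mul_nonneg_right this ht'
  positivity

lemma det_nonneg_of_psd (D : Eucl n →L[ℝ] Eucl n) (h : ∀ u, 0 ≤ inner ℝ (D u) u) : 0 ≤ D.det := by
  by_contra hneg
  push Not at hneg
  have hc : Continuous fun s : ℝ => ((1 - s) • D + s • ContinuousLinearMap.id ℝ (Eucl n)).det :=
    ContinuousLinearMap.continuous_det.comp (by fun_prop)
  have hiv := intermediate_value_Icc (zero_le_one' ℝ) hc.continuousOn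
  have h1 : ((1 - (1 : ℝ)) • D + (1 : ℝ) • ContinuousLinearMap.id ℝ (Eucl n)).det = 1 := by
    simp [ContinuousLinearMap.det]
  have h0 : ((1 - (0 : ℝ)) • D + (0 : ℝ) • ContinuousLinearMap.id ℝ (Eucl n)).det = D.det := by
    have e : (1 - (0 : ℝ)) • D + (0 : ℝ) • ContinuousLinearMap.id ℝ (Eucl n) = D := by
      refine ContinuousLinearMap.ext fun u => ?_
      show (1 - (0 : ℝ)) • D u + (0 : ℝ) • u = D u
      rw [sub_zero, one_smul, zero_smul, add_zero]
    rw [e]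
  rw [h1, h0] at hiv
  obtain ⟨s, hs, hs0⟩ := hiv ⟨hneg.le, zero_le_one⟩
  simp only at hs0
  have hspos : 0 < s := by
    rcases eq_or_lt_of_le hs.1 with h | h
    · rw [← h, h0] at hs0; linarith
    · exact h
  have hk := LinearMap.bot_lt_ker_of_det_eq_zero (f := (((1 - s) • D + s • ContinuousLinearMap.id ℝ (Eucl n) :
    Eucl n →L[ℝ] Eucl n) : Eucl n →ₗ[ℝ] Eucl n)) hs0
  obtain ⟨u, hu, hu0⟩ := Submodule.exists_mem_ne_zero_of_ne_bot hk.ne'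
  have hu' : (1 - s) • D u + s • u = 0 := by simpa using hu
  have h3 : inner ℝ ((1 - s) • D u + s • u) u = 0 := by rw [hu', inner_zero_left]
  rw [inner_add_left, real_inner_smul_left, real_inner_smul_left, real_inner_self_eq_norm_sq] at h3
  have h4 := mul_nonneg (sub_nonneg.2 hs.2) (h u)
  have h5 : 0 < s * ‖u‖ ^ 2 := by have := norm_pos_iff.2 hu0; positivity
  linarith

lemma isU_gr {f : ConvFn n} (hf : ContDiff ℝ 2 (⇑f.1)) {x : Eucl n} (hx : (Dgr f x).det ≠ 0) :
    IsU f (gr f x) x := by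
  have hd := hf.differentiable (by norm_num)
  refine ⟨sub_gr (hd x), fun x' hx' => ?_⟩
  have hseg : ∀ t ∈ Set.Icc (0 : ℝ) 1, gr f (x + t • (x' - x)) = gr f x := fun t ht =>
    (gr_of_sub (hd _) (sub_segment f x x' _ (sub_gr (hd x)) hx' t ht.1 ht.2)).symm
  have h1 : HasDerivAt (fun t : ℝ => gr f (x + t • (x' - x))) (Dgr f x (x' - x)) 0 := by
    have h2 : HasDerivAt (fun t : ℝ => x + t • (x' - x)) (x' - x) 0 := by
      have := ((hasDerivAt_id (0 : ℝ)).smul_const (x' - x)).const_add x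
      simpa using this
    have h3 : HasFDerivAt (gr f) (Dgr f x) (x + (0 : ℝ) • (x' - x)) := by simpa using gr_hasFDeriv hf x
    exact h3.comp_hasDerivAt (0 : ℝ) h2
  have h4 := h1.tendsto_slope_zero_right
  have h5 : Dgr f x (x' - x) = 0 := by
    refine tendsto_nhds_unique h4 (tendsto_const_nhds.congr' ?_)
    filter_upwards [Ioo_mem_nhdsGT (zero_lt_one' ℝ)] with t ht
    rw [zero_add, hseg t ⟨ht.1.le, ht.2.le⟩, zero_smul, add_zero, sub_self, smul_zero]
  by_contra hne
  apply hx
  rw [ContinuousLinearMap.det]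
  by_contra hdet
  have hu : IsUnit (LinearMap.det (Dgr f x : Eucl n →ₗ[ℝ] Eucl n)) := isUnit_iff_ne_zero.2 hdet
  have hker := LinearMap.ker_eq_bot.1 ((LinearMap.isUnit_iff_ker_eq_bot _).1 ((LinearMap.isUnit_iff_isUnit_det _).2 hu))
  have : x' - x = 0 := hker (by simpa using h5)
  exact hne (sub_eq_zero.1 this)

lemma PsiP_rep {d : ℕ} {ψ : Eucl n → MvPolynomial (Fin (n + 1)) ℂ} (hψ : Fam d ψ) :
    TopDegreeRepresentation (PsiP ψ hψ) ψ := by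
  intro f hf φ
  have hd := hf.differentiable (by norm_num)
  set κ := kap ψ φ with hκ
  rw [PsiP_apply]
  let S : Set (Eucl n) := {x | (Dgr f x).det ≠ 0}
  have hdc : Continuous fun x => (Dgr f x).det := ContinuousLinearMap.continuous_det.comp (Dgr_continuous hf)
  have hS : MeasurableSet S := (isOpen_ne_fun hdc continuous_const).measurableSet
  have hZ : volume (gr f '' Sᶜ) = 0 :=
    addHaar_image_eq_zero_of_det_fderivWithin_eq_zero volume (f' := Dgr f)
      (fun x _ => (gr_hasFDeriv hf x).hasFDerivWithinAt) (fun x hx => by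
        by_contra h; exact hx h)
  have hinj : Set.InjOn (gr f) S := by
    intro x hx x' hx' he
    have := (isU_gr hf hx).2 x' (by rw [he]; exact sub_gr (hd x'))
    exact this.symm
  have hae : ∀ᵐ y, y ∉ gr f '' S → ig f κ y = 0 := by
    have : ∀ᵐ y, y ∉ gr f '' Sᶜ := measure_eq_zero_iff_ae_notMem.1 hZ
    filter_upwards [this] with y hy hyS
    apply ig_none
    rintro ⟨x, hx⟩
    have e := gr_of_sub (hd x) hx.1
    by_cases hxS : x ∈ S
    · exact hyS ⟨x, hxS, e.symm⟩
    · exact hy ⟨x, hxS, e.symm⟩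
  rw [← setIntegral_eq_integral_of_ae_compl_eq_zero hae,
    integral_image_eq_integral_abs_det_fderiv_smul volume hS (fun x _ => (gr_hasFDeriv hf x).hasFDerivWithinAt) hinj]
  rw [← setIntegral_eq_integral_of_forall_compl_eq_zero (s := S) (μ := volume) (f := fun x => φ x *
      MvPolynomial.eval (Fin.cons ((f.1 x : ℝ) : ℂ) fun i => ((gradVec (⇑f.1) x i : ℝ) : ℂ)) (ψ x)
      * (((hessMat (⇑f.1) x).det : ℝ) : ℂ))]
  · refine setIntegral_congr_fun hS fun x hx => ?_
    rw [ig_eq (isU_gr hf hx), ← Dgr_det hf, abs_of_nonneg (det_nonneg_of_psd _ (Dgr_psd hf x)), hκ, kap, Complex.real_smul]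
    have : wvec (f.1 x) (gr f x) = Fin.cons ((f.1 x : ℝ) : ℂ) fun i => ((gradVec (⇑f.1) x i : ℝ) : ℂ) := by
      rw [wvec]
      simp only [gr_coord]
    rw [this]; ring
  · intro x hx
    have : (Dgr f x).det = 0 := by by_contra h; exact hx h
    rw [← Dgr_det hf, this]; simp
end Aux7

section Aux8
open MeasureTheory Filter Topology Metric
variable {n : ℕ}

lemma isU_cone (a : Eucl n) (s : ℝ) (v : Eucl n) (t : ℝ≥0) (y : Eucl n) (hy : ‖y - v‖ < t) :
    IsU (addAffine (smulConv t (cone a)) s v) y a := by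
  rw [isU_addAffine]
  refine ⟨fun z => ?_, fun x hx => ?_⟩
  · simp only [smulConv_apply, cone_apply, sub_self, norm_zero, mul_zero, zero_add]
    exact (real_inner_le_norm _ _).trans (mul_le_mul_of_nonneg_right hy.le (norm_nonneg _))
  · have h := hx a
    simp only [smulConv_apply, cone_apply, sub_self, norm_zero, mul_zero] at h
    have h2 : inner ℝ (y - v) (a - x) ≥ -(‖y - v‖ * ‖x - a‖) := by
      have := neg_le_of_abs_le (abs_real_inner_le_norm (y - v) (a - x))
      rwa [norm_sub_rev a x] at this
    by_contra hne
    have h3 : 0 < ‖x - a‖ := norm_pos_iff.2 (sub_ne_zero.2 hne)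
    nlinarith

lemma not_isU_cone (a : Eucl n) (s : ℝ) (v : Eucl n) (t : ℝ≥0) (y : Eucl n) (hy : t < ‖y - v‖) :
    ¬ ∃ x, IsU (addAffine (smulConv t (cone a)) s v) y x := by
  rintro ⟨x, hx⟩
  rw [isU_addAffine] at hx
  have h := hx.1 (x + (y - v))
  simp only [smulConv_apply, cone_apply, add_sub_cancel_left, real_inner_self_eq_norm_sq] at h
  have h2 : ‖x + (y - v) - a‖ ≤ ‖x - a‖ + ‖y - v‖ := by
    rw [show x + (y - v) - a = (x - a) + (y - v) by abel]; exact norm_add_le _ _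
  have h3 := mul_le_mul_of_nonneg_left h2 t.2
  have h4 : (0 : ℝ) ≤ t := t.2
  change (t : ℝ) * _ ≤ (t : ℝ) * _ at h3
  nlinarith

lemma PsiP_cone {d : ℕ} {ψ : Eucl n → MvPolynomial (Fin (n + 1)) ℂ} (hψ : Fam d ψ) (a : Eucl n) (s : ℝ)
    (v : Eucl n) (t : ℝ≥0) (ht : 0 < t) (φ : C_c(Eucl n, ℂ)) :
    (PsiP ψ hψ (addAffine (smulConv t (cone a)) s v)).1 φ =
      ∫ y in closedBall v t, φ a * MvPolynomial.eval (wvec (s + inner ℝ v a) y) (ψ a) := by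
  have ht' : (0 : ℝ) < t := by exact_mod_cast ht
  rw [PsiP_apply, ← integral_indicator measurableSet_closedBall]
  apply integral_congr_ae
  have h0 : ∀ᵐ y, y ∉ sphere v (t : ℝ) :=
    measure_eq_zero_iff_ae_notMem.1 (Measure.addHaar_sphere_of_ne_zero volume v ht'.ne')
  filter_upwards [h0] with y hy
  rw [mem_sphere, dist_eq_norm] at hy
  rcases lt_or_gt_of_ne hy with h | h
  · rw [ig_eq (isU_cone a s v t y h), Set.indicator_of_mem (by rw [mem_closedBall, dist_eq_norm]; exact h.le), kap]
    simp [addAffine_apply, smulConv_apply, cone_apply]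
  · rw [ig_none (not_isU_cone a s v t y h), Set.indicator_of_notMem (by rw [mem_closedBall, dist_eq_norm]; exact not_le.2 h)]

lemma vol_cb (v : Eucl n) {r : ℝ} (hr : 0 ≤ r) : (volume : Measure (Eucl n)).real (closedBall v r) = r ^ n * omegaN n := by
  rw [Measure.addHaar_real_closedBall volume v hr, omegaN]; simp

lemma avg_tendsto (k : Eucl n → ℂ) (hk : Continuous k) (v : Eucl n) :
    Tendsto (fun t : ℝ≥0 => (((t : ℝ) : ℂ) ^ n)⁻¹ * ∫ y in closedBall v t, k y) (𝓝[>] 0) (𝓝 ((omegaN n : ℂ) * k v)) := by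
  rw [Metric.tendsto_nhds]
  intro ε hε
  have hω := omegaN_pos (n := n)
  have hε' : 0 < ε / (2 * omegaN n) := by positivity
  obtain ⟨δ, hδ, hd⟩ := Metric.continuousAt_iff.1 hk.continuousAt _ hε'
  have : ∀ᶠ t : ℝ≥0 in 𝓝[>] 0, (t : ℝ) < δ :=
    (NNReal.continuous_coe.tendsto 0 |>.mono_left nhdsWithin_le_nhds).eventually_lt_const (by simpa using hδ)
  filter_upwards [this, self_mem_nhdsWithin] with t htδ ht
  have ht' : (0 : ℝ) < t := by exact_mod_cast ht
  have hi : IntegrableOn k (closedBall v t) := hk.continuousOn.integrableOn_compact (isCompact_closedBall _ _)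
  have hc : IntegrableOn (fun _ => k v) (closedBall v (t : ℝ)) := 
    continuousOn_const.integrableOn_compact (isCompact_closedBall _ _)
  have e : (∫ y in closedBall v t, k y) - ((t : ℝ) : ℂ) ^ n * ((omegaN n : ℂ) * k v) = ∫ y in closedBall v t, (k y - k v) := by
    rw [integral_sub hi hc, setIntegral_const, vol_cb v ht'.le, Complex.real_smul]
    push_cast; ring
  have hb : ‖∫ y in closedBall v (t : ℝ), (k y - k v)‖ ≤ ε / (2 * omegaN n) * volume.real (closedBall v (t : ℝ)) := by
    refine norm_setIntegral_le_of_norm_le_const measure_closedBall_lt_top fun y hy => ?_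
    rw [← dist_eq_norm]
    exact (hd (lt_of_le_of_lt hy htδ)).le
  rw [vol_cb v ht'.le] at hb
  have h0 : ((t : ℝ) : ℂ) ^ n ≠ 0 := pow_ne_zero _ (by exact_mod_cast ht'.ne')
  rw [dist_eq_norm]
  have e2 : (((t : ℝ) : ℂ) ^ n)⁻¹ * (∫ y in closedBall v t, k y) - (omegaN n : ℂ) * k v
      = (((t : ℝ) : ℂ) ^ n)⁻¹ * ∫ y in closedBall v t, (k y - k v) := by
    rw [← e]; field_simp
  rw [e2, norm_mul, norm_inv, norm_pow, Complex.norm_real, Real.norm_of_nonneg ht'.le]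
  have h5 : 0 < (t : ℝ) ^ n := by positivity
  calc _ ≤ ((t : ℝ) ^ n)⁻¹ * (ε / (2 * omegaN n) * ((t : ℝ) ^ n * omegaN n)) := by gcongr
    _ = ε / 2 := by field_simp
    _ < ε := by linarith

lemma PsiP_Qf {d : ℕ} {ψ : Eucl n → MvPolynomial (Fin (n + 1)) ℂ} (hψ : Fam d ψ) (a : Eucl n) (s : ℝ)
    (v : Eucl n) (φ : C_c(Eucl n, ℂ)) :
    Qf d (PsiP ψ hψ) φ 0 (cone a) s v = omegaN n * φ a * MvPolynomial.eval (wvec (s + inner ℝ v a) v) (ψ a) := by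
  have hm := PsiP_mem hψ
  have h1 := Qf_tendsto (d := d) hm.2.1 φ (l := 𝓝[>] (0 : ℝ≥0)) (t := fun t => (t : ℝ)) (t₀ := 0) (G := fun _ => cone a)
    (s := fun _ => s) (v := fun _ => v) ((NNReal.continuous_coe.tendsto 0).mono_left nhdsWithin_le_nhds) 
    tendsto_const_nhds tendsto_const_nhds tendsto_const_nhds
  have hk : Continuous fun y : Eucl n => φ a * MvPolynomial.eval (wvec (s + inner ℝ v a) y) (ψ a) := by
    refine continuous_const.mul ?_
    have := hψ.evc.comp (f := fun y : Eucl n => (a, s + inner ℝ v a, y)) (by fun_prop)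
    exact this
  have h2 := avg_tendsto _ hk v
  have h3 := tendsto_nhds_unique h1 (h2.congr' ?_)
  · rw [h3]; ring
  · filter_upwards [self_mem_nhdsWithin] with t ht
    have ht' : (0 : ℝ) < t := by exact_mod_cast ht
    have h0 : ((t : ℝ) : ℂ) ^ n ≠ 0 := pow_ne_zero _ (by exact_mod_cast ht'.ne')
    rw [← PsiP_cone hψ a s v t ht φ, Qf_spec hm.2.2 (PsiP_hom hψ) φ t ht]
    field_simp

/-- difference of functionals -/
def Psi0 {d : ℕ} (Ψ : ConvFn n → RadonMeasure n) (ψ : Eucl n → MvPolynomial (Fin (n + 1)) ℂ) (hψ : Fam d ψ) :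
    ConvFn n → RadonMeasure n := fun f => Ψ f - PsiP ψ hψ f

lemma Psi0_apply {d : ℕ} (Ψ : ConvFn n → RadonMeasure n) (ψ : Eucl n → MvPolynomial (Fin (n + 1)) ℂ) (hψ : Fam d ψ)
    (f : ConvFn n) (φ : C_c(Eucl n, ℂ)) : (Psi0 Ψ ψ hψ f).1 φ = (Ψ f).1 φ - (PsiP ψ hψ f).1 φ := rfl

lemma Psi0_hom {d : ℕ} {Ψ : ConvFn n → RadonMeasure n} {ψ : Eucl n → MvPolynomial (Fin (n + 1)) ℂ} (hψ : Fam d ψ)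
    (hh : IsHomogeneousDeg (n + d) Ψ) : IsHomogeneousDeg (n + d) (Psi0 Ψ ψ hψ) := by
  intro f t
  rw [Psi0, hh, PsiP_hom hψ, Psi0, smul_sub]

lemma Psi0_mem {d : ℕ} {Ψ : ConvFn n → RadonMeasure n} {ψ : Eucl n → MvPolynomial (Fin (n + 1)) ℂ} (hψ : Fam d ψ)
    (hΨ : MemPdLV d Ψ) : MemPdLV d (Psi0 Ψ ψ hψ) := by
  have hm := PsiP_mem hψ
  refine ⟨?_, ?_, ?_⟩
  · intro f h U hU he φ hφ
    rw [Psi0_apply, Psi0_apply, hΨ.1 f h U hU he φ hφ, hm.1 f h U hU he φ hφ]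
  · intro φ
    exact (hΨ.2.1 φ).sub (hm.2.1 φ)
  · intro f φ
    obtain ⟨P, hP, hPe⟩ := hΨ.2.2 f φ
    obtain ⟨P', hP', hPe'⟩ := hm.2.2 f φ
    refine ⟨P - P', (MvPolynomial.totalDegree_sub _ _).trans (max_le hP hP'), fun s v => ?_⟩
    rw [Psi0_apply, hPe, hPe', map_sub]

lemma Psi0_Qf {d : ℕ} {Ψ : ConvFn n → RadonMeasure n} {ψ : Eucl n → MvPolynomial (Fin (n + 1)) ℂ} (hψ : Fam d ψ)
    (h : ∀ (a : Eucl n) (s : ℝ) (v : Eucl n) (φ : C_c(Eucl n, ℂ)),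
              Qf d Ψ φ 0 (cone a) s v = ↑(omegaN n) * φ a * (MvPolynomial.eval (wvec (s + inner ℝ v a) v)) (ψ a))
    (a : Eucl n) (s : ℝ) (v : Eucl n) (φ : C_c(Eucl n, ℂ)) :
    Qf d (Psi0 Ψ ψ hψ) φ 0 (cone a) s v = 0 := by
  have e : Qf d (Psi0 Ψ ψ hψ) φ 0 (cone a) s v = Qf d Ψ φ 0 (cone a) s v - Qf d (PsiP ψ hψ) φ 0 (cone a) s v := by
    simp only [Qf, Psi0_apply, mul_sub, Finset.sum_sub_distrib]
  rw [e, h, PsiP_Qf, sub_self]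
end Aux8

section Aux9
open MeasureTheory Filter Topology Metric
variable {n : ℕ}

lemma lemmaD {d : ℕ} {Ψ : ConvFn n → RadonMeasure n} (hΨ : MemPdLV d Ψ) (hh : IsHomogeneousDeg (n + d) Ψ)
    (h0 : ∀ (a : Eucl n) (s : ℝ) (v : Eucl n) (φ : C_c(Eucl n, ℂ)), Qf d Ψ φ 0 (cone a) s v = 0)
    (φ : C_c(Eucl n, ℂ)) (L ε : ℝ) (hε : 0 < ε) :
    ∃ δ > 0, ∀ (t : ℝ) (a : Eucl n) (s : ℝ) (v : Eucl n) (h : ConvFn n), 0 < t → t < δ → ‖a‖ ≤ L → |s| ≤ L → ‖v‖ ≤ L →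
      (∀ x, |h.1 x - (s + inner ℝ v x + t * ‖x - a‖)| ≤ δ * t) → ‖(Ψ h).1 φ‖ ≤ ε * t ^ n := by
  by_contra hcon
  push Not at hcon
  have hpos : ∀ k : ℕ, (0 : ℝ) < 1 / ((k : ℝ) + 1) := fun k => by positivity
  choose t a s v h ht htδ ha hs hv hx hbig using fun k : ℕ => hcon (1 / ((k : ℝ) + 1)) (hpos k)
  obtain ⟨⟨a₀, s₀, v₀⟩, -, θ, hθ, hlim⟩ := (isCompact_closedBall (0 : Eucl n × ℝ × Eucl n) L).tendsto_subseq
    (x := fun k => (a k, s k, v k)) (fun k => by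
      rw [mem_closedBall, dist_zero_right, Prod.norm_def, Prod.norm_def]
      exact max_le (ha k) (max_le (hs k) (hv k)))
  have hla : Tendsto (fun k => a (θ k)) atTop (𝓝 a₀) := (continuous_fst.tendsto _).comp hlim
  have hls : Tendsto (fun k => s (θ k)) atTop (𝓝 s₀) := ((continuous_fst.comp continuous_snd).tendsto _).comp hlim
  have hlv : Tendsto (fun k => v (θ k)) atTop (𝓝 v₀) := ((continuous_snd.comp continuous_snd).tendsto _).comp hlim
  have hone : Tendsto (fun k => 1 / ((θ k : ℝ) + 1)) atTop (𝓝 0) :=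
    tendsto_one_div_add_atTop_nhds_zero_nat.comp hθ.tendsto_atTop
  have hlt : Tendsto (fun k => t (θ k)) atTop (𝓝 0) :=
    squeeze_zero (fun k => (ht _).le) (fun k => (htδ _).le) hone
  let T : ℕ → ℝ≥0 := fun k => ⟨t k, (ht k).le⟩
  have hT : ∀ k, 0 < T k := fun k => by rw [← NNReal.coe_pos]; exact ht k
  let G : ℕ → ConvFn n := fun k => smulConv (T k)⁻¹ (addAffine (h k) (-s k) (-v k))
  have hG : ∀ k, h k = addAffine (smulConv (T k) (G k)) (s k) (v k) := by
    intro k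
    apply convFn_ext
    intro x
    have : (T k : ℝ) ≠ 0 := (ht k).ne'
    simp only [G, addAffine_apply, smulConv_apply, NNReal.coe_inv, inner_neg_left]
    field_simp
    ring
  have hGc : ∀ k x, |(G k).1 x - ‖x - a k‖| ≤ 1 / ((k : ℝ) + 1) := by
    intro k x
    have h1 := hx k x
    have e : (G k).1 x - ‖x - a k‖ = (t k)⁻¹ * ((h k).1 x - (s k + inner ℝ (v k) x + t k * ‖x - a k‖)) := by
      have : t k ≠ 0 := (ht k).ne'
      simp only [G, addAffine_apply, smulConv_apply, NNReal.coe_inv, inner_neg_left]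
      change (t k)⁻¹ * _ - _ = _
      field_simp
      ring
    rw [e, abs_mul, abs_of_pos (inv_pos.2 (ht k))]
    calc _ ≤ (t k)⁻¹ * (1 / ((k : ℝ) + 1) * t k) := mul_le_mul_of_nonneg_left h1 (inv_pos.2 (ht k)).le
      _ = _ := by have : t k ≠ 0 := (ht k).ne'
                  field_simp
  have hlG : Tendsto (fun k => G (θ k)) atTop (𝓝 (cone a₀)) := by
    apply tendsto_convFn
    intro R η hη
    have h2 : Tendsto (fun k => 1 / ((θ k : ℝ) + 1) + ‖a (θ k) - a₀‖) atTop (𝓝 0) := by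
      simpa using hone.add (tendsto_iff_norm_sub_tendsto_zero.1 hla)
    filter_upwards [h2.eventually_lt_const hη] with k hk x _
    have h3 := hGc (θ k) x
    have h4 : |‖x - a (θ k)‖ - ‖x - a₀‖| ≤ ‖a (θ k) - a₀‖ := by
      refine (abs_norm_sub_norm_le _ _).trans (le_of_eq ?_)
      rw [← norm_neg]; congr 1; abel
    rw [cone_apply]
    calc _ ≤ _ := abs_sub_le _ ‖x - a (θ k)‖ _
      _ < η := by linarith
  have hQ := Qf_tendsto (d := d) hΨ.2.1 φ hlt hlG hls hlv
  rw [h0] at hQ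
  have hQ' := hQ.norm
  rw [norm_zero] at hQ'
  obtain ⟨k, hk⟩ := (hQ'.eventually_lt_const hε).exists
  have h5 := hbig (θ k)
  rw [hG, Qf_spec hΨ.2.2 hh φ _ (hT _)] at h5
  rw [norm_mul, norm_pow, Complex.norm_real, Real.norm_of_nonneg (T (θ k)).coe_nonneg] at h5
  change ε * t (θ k) ^ n < t (θ k) ^ n * ‖Qf d Ψ φ (t (θ k)) _ _ _‖ at h5
  have h6 : 0 < t (θ k) ^ n := pow_pos (ht _) _
  nlinarith
end Aux9

section Aux10
open MeasureTheory Filter Topology Metric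
variable {n : ℕ}

structure Duo (f : ConvFn n) (y g : Eucl n → Eucl n) (c : ℝ) : Prop where
  yc : Continuous y
  gc : Continuous g
  gy : ∀ x, g (y x) = x
  yg : ∀ q, y (g q) = q
  c0 : 0 ≤ c
  lip : ∀ q q', ‖g q - g q'‖ ≤ c * ‖q - q'‖
  sub : ∀ x, SubG f x (y x)
  uniq : ∀ x q, SubG f x q → q = y x

lemma Duo.subg {f : ConvFn n} {y g : Eucl n → Eucl n} {c : ℝ} (H : Duo f y g c) (q z : Eucl n) :
    f.1 (g q) + inner ℝ q (z - g q) ≤ f.1 z := by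
  have := H.sub (g q) z
  rwa [H.yg] at this

/-- value of the affine minorant of slope q -/
def vl (f : ConvFn n) (g : Eucl n → Eucl n) (q z : Eucl n) : ℝ := (f.1 (g q) - inner ℝ q (g q)) + inner ℝ q z

lemma vl_eq (f : ConvFn n) (g : Eucl n → Eucl n) (q z : Eucl n) : vl f g q z = f.1 (g q) + inner ℝ q (z - g q) := by
  rw [vl, inner_sub_right]; ring

lemma vl_le {f : ConvFn n} {y g : Eucl n → Eucl n} {c : ℝ} (H : Duo f y g c) (q z : Eucl n) : vl f g q z ≤ f.1 z := by
  rw [vl_eq]; exact H.subg q z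

lemma vl_uniq {f : ConvFn n} {y g : Eucl n → Eucl n} {c : ℝ} (H : Duo f y g c) {p z : Eucl n} {r : ℝ} {q₁ q₂ : Eucl n}
    (h₁ : q₁ ∈ closedBall p r) (h₂ : q₂ ∈ closedBall p r) (m₁ : ∀ q ∈ closedBall p r, vl f g q z ≤ vl f g q₁ z)
    (m₂ : ∀ q ∈ closedBall p r, vl f g q z ≤ vl f g q₂ z) : q₁ = q₂ := by
  set q : Eucl n := (2⁻¹ : ℝ) • q₁ + (2⁻¹ : ℝ) • q₂ with hq
  have hqm : q ∈ closedBall p r := (convex_closedBall p r) h₁ h₂ (by norm_num) (by norm_num) (by norm_num)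
  have e12 : vl f g q₁ z = vl f g q₂ z := le_antisymm (m₂ _ h₁) (m₁ _ h₂)
  have hqle := m₁ q hqm
  have a1 := vl_le H q₁ (g q)
  have a2 := vl_le H q₂ (g q)
  have eq1 : vl f g q z = f.1 (g q) - inner ℝ q (g q) + (2⁻¹ * inner ℝ q₁ z + 2⁻¹ * inner ℝ q₂ z) := by
    rw [vl]; congr 1; rw [hq, inner_add_left, real_inner_smul_left, real_inner_smul_left]
  have eq2 : inner ℝ q (g q) = 2⁻¹ * inner ℝ q₁ (g q) + 2⁻¹ * inner ℝ q₂ (g q) := by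
    conv_lhs => rw [hq]
    rw [inner_add_left, real_inner_smul_left, real_inner_smul_left]
  have b1 : vl f g q₁ (g q) = f.1 (g q) := by
    rw [eq1, eq2] at hqle
    simp only [vl] at *
    linarith
  have b2 : vl f g q₂ (g q) = f.1 (g q) := by
    rw [eq1, eq2] at hqle
    simp only [vl] at *
    linarith
  have key : ∀ q', vl f g q' (g q) = f.1 (g q) → q' = q := by
    intro q' hq'
    rw [← H.yg q]
    apply H.uniq
    intro w
    have := vl_le H q' w
    rw [← hq']
    simp only [vl, inner_sub_right] at *
    linarith
  rw [key _ b1, key _ b2]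

lemma vl_int {f : ConvFn n} {y g : Eucl n → Eucl n} {c : ℝ} (H : Duo f y g c) {p z : Eucl n} {r : ℝ} {q : Eucl n}
    (h : ‖q - p‖ < r) (m : ∀ q' ∈ closedBall p r, vl f g q' z ≤ vl f g q z) : q = y z := by
  have hz : z = g q := by
    by_contra hne
    have hpos : 0 < ‖z - g q‖ := norm_pos_iff.2 (sub_ne_zero.2 hne)
    obtain ⟨τ, hτ0, hτ1, hτ2⟩ : ∃ τ : ℝ, 0 < τ ∧ c * τ < 1 ∧ τ * ‖z - g q‖ ≤ r - ‖q - p‖ := by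
      have hc := H.c0
      refine ⟨min (1 / (c + 1)) ((r - ‖q - p‖) / ‖z - g q‖), ?_, ?_, ?_⟩
      · have := sub_pos.2 h
        positivity
      · calc c * _ ≤ c * (1 / (c + 1)) := by gcongr; exact min_le_left _ _
          _ < 1 := by rw [mul_one_div, div_lt_one (by positivity)]; linarith
      · calc _ ≤ (r - ‖q - p‖) / ‖z - g q‖ * ‖z - g q‖ := by gcongr; exact min_le_right _ _
          _ = _ := by field_simp
    set q' := q + τ • (z - g q) with hq'
    have hd : q' - q = τ • (z - g q) := by rw [hq', add_sub_cancel_left]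
    have hmem : q' ∈ closedBall p r := by
      rw [mem_closedBall, dist_eq_norm, show q' - p = (q - p) + (q' - q) by abel, hd]
      refine (norm_add_le _ _).trans ?_
      rw [norm_smul, Real.norm_of_nonneg hτ0.le]; linarith
    have h1 := m q' hmem
    have h2 := vl_le H q (g q')
    have h3 : inner ℝ (q' - q) (z - g q') ≤ 0 := by
      simp only [vl, inner_sub_right, inner_sub_left] at *
      linarith
    rw [hd, real_inner_smul_left] at h3
    have h4 : inner ℝ (z - g q) (z - g q') ≤ 0 := by
      by_contra hc; push Not at hc; nlinarith
    have h5 : inner ℝ (z - g q) (z - g q') = ‖z - g q‖ ^ 2 - inner ℝ (z - g q) (g q' - g q) := by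
      rw [← real_inner_self_eq_norm_sq, ← inner_sub_right]; congr 1; abel
    have h6 := real_inner_le_norm (z - g q) (g q' - g q)
    have h7 := H.lip q' q
    rw [hd, norm_smul, Real.norm_of_nonneg hτ0.le] at h7
    have h8 : ‖z - g q‖ * ‖g q' - g q‖ ≤ ‖z - g q‖ * (c * (τ * ‖z - g q‖)) := by gcongr
    have h9 : 0 < ‖z - g q‖ ^ 2 := by positivity
    nlinarith
  rw [hz, H.yg]

lemma local_model {f : ConvFn n} {y g : Eucl n → Eucl n} {c : ℝ} (H : Duo f y g c) (p : Eucl n) (r : ℝ) (hr : 0 < r) :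
    ∃ (h : ConvFn n) (Y : Eucl n → Eucl n), Continuous Y ∧ (∀ z, ‖Y z - p‖ ≤ r) ∧ (∀ z, SubG h z (Y z)) ∧
      (∀ z, ‖Y z - p‖ < r → Y z = y z) ∧ (∀ z, ‖y z - p‖ ≤ r → h.1 z = f.1 z) ∧
      (∀ z, |h.1 z - (f.1 (g p) + inner ℝ p (z - g p) + r * ‖z - g p‖)| ≤ c * r ^ 2) := by
  have : Nonempty (closedBall p r) := ⟨⟨p, mem_closedBall_self hr.le⟩⟩
  obtain ⟨h, hlow, hup, -⟩ := supAffine (ι := closedBall p r) (fun q => f.1 (g q) - inner ℝ (q : Eucl n) (g q)) (fun q => q) p r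
    (fun q => by rw [← dist_eq_norm]; exact q.2) (g p) (f.1 (g p)) (fun q => vl_le H q (g p))
  have hlow' : ∀ q ∈ closedBall p r, ∀ z, vl f g q z ≤ h.1 z := fun q hq z => hlow ⟨q, hq⟩ z
  have hup' : ∀ z b, (∀ q ∈ closedBall p r, vl f g q z ≤ b) → h.1 z ≤ b := fun z b hb => hup z b fun q => hb q q.2
  have hvc : ∀ z, Continuous fun q => vl f g q z := fun z => by
    have := H.gc
    have h2 := f.1.continuous
    unfold vl; fun_prop
  have hex : ∀ z, ∃ q ∈ closedBall p r, ∀ q' ∈ closedBall p r, vl f g q' z ≤ vl f g q z := fun z => by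
    obtain ⟨q, hq, hm⟩ := (isCompact_closedBall p r).exists_isMaxOn ⟨p, mem_closedBall_self hr.le⟩ (hvc z).continuousOn
    exact ⟨q, hq, fun q' hq' => hm hq'⟩
  choose Y hY hYm using hex
  have hhY : ∀ z, h.1 z = vl f g (Y z) z := fun z => le_antisymm (hup' z _ (hYm z)) (hlow' _ (hY z) z)
  refine ⟨h, Y, ?_, fun z => by rw [← dist_eq_norm]; exact hY z, ?_, fun z hz => vl_int H hz (hYm z), ?_, ?_⟩
  · rw [continuous_iff_continuousAt]
    intro z₀
    refine argmax_tendsto (isCompact_closedBall p r) (hvc z₀).continuousOn (G := fun z q => vl f g q z) ?_ (hY z₀)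
      (fun q hq hqm => vl_uniq H hq (hY z₀) hqm (hYm z₀)) (Eventually.of_forall fun z => ⟨hY z, hYm z⟩)
    intro ε hε
    have hB : 0 < ‖p‖ + r := by positivity
    filter_upwards [ball_mem_nhds z₀ (div_pos hε hB)] with z hz q hq
    rw [mem_ball, dist_eq_norm, lt_div_iff₀ hB] at hz
    have e : vl f g q z - vl f g q z₀ = inner ℝ q (z - z₀) := by simp only [vl, inner_sub_right]; ring
    rw [e]
    have hqn : ‖q‖ ≤ ‖p‖ + r := by
      rw [mem_closedBall, dist_eq_norm] at hq
      have := norm_le_norm_add_norm_sub p q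
      rw [norm_sub_rev] at this
      linarith
    calc _ ≤ ‖q‖ * ‖z - z₀‖ := abs_real_inner_le_norm _ _
      _ ≤ (‖p‖ + r) * ‖z - z₀‖ := by gcongr
      _ < ε := by linarith
  · intro z w
    rw [hhY z]
    have := hlow' _ (hY z) w
    simp only [vl, inner_sub_right] at *
    linarith
  · intro z hz
    apply le_antisymm
    · exact hup' z _ fun q _ => vl_le H q z
    · have := hlow' (y z) (by rw [mem_closedBall, dist_eq_norm]; exact hz) z
      rw [vl_eq, H.gy] at this
      simpa using this
  · intro z
    set a := g p with ha
    rw [abs_le]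
    constructor
    · obtain ⟨q, hq, hq2⟩ : ∃ q, ‖q - p‖ ≤ r ∧ inner ℝ (q - p) (z - a) = r * ‖z - a‖ := by
        by_cases hz : ‖z - a‖ = 0
        · refine ⟨p, by simp [hr.le], by rw [hz]; simp⟩
        · refine ⟨p + (r * ‖z - a‖⁻¹) • (z - a), ?_, ?_⟩
          · rw [add_sub_cancel_left, norm_smul, norm_mul, norm_inv, norm_norm, mul_assoc, inv_mul_cancel₀ hz, mul_one,
              Real.norm_of_nonneg hr.le]
          · rw [add_sub_cancel_left, real_inner_smul_left, real_inner_self_eq_norm_sq]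
            field_simp
      have h1 := hlow' q (by rw [mem_closedBall, dist_eq_norm]; exact hq) z
      have h2 := H.subg p (g q)
      have h3 : inner ℝ (q - p) (g q - a) ≤ c * r ^ 2 := by
        have hc := H.c0
        calc _ ≤ ‖q - p‖ * ‖g q - a‖ := real_inner_le_norm _ _
          _ ≤ r * (c * r) := by
            have := H.lip q p
            have h5 : c * ‖q - p‖ ≤ c * r := by gcongr
            gcongr
            exact this.trans h5
          _ = _ := by ring
      simp only [vl, inner_sub_right, inner_sub_left] at *
      linarith
    · have : h.1 z ≤ f.1 a + inner ℝ p (z - a) + r * ‖z - a‖ := by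
        refine hup' z _ fun q hq => ?_
        have h1 := vl_le H q a
        rw [mem_closedBall, dist_eq_norm] at hq
        have h2 : inner ℝ (q - p) (z - a) ≤ r * ‖z - a‖ :=
          (real_inner_le_norm _ _).trans (by gcongr)
        simp only [vl, inner_sub_right, inner_sub_left] at *
        linarith
      have hc := H.c0
      have : 0 ≤ c * r ^ 2 := by positivity
      linarith
end Aux10

section Aux11
open MeasureTheory Filter Topology Metric
variable {n : ℕ}

lemma finite_cover (S : Set (Eucl n)) (hS : IsCompact S) (δ ε : ℝ) (hδ : 0 < δ) (hε : 0 < ε) :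
    ∃ (F : Finset (Eucl n)) (r : Eucl n → ℝ), ↑F ⊆ S ∧ (∀ x ∈ F, 0 < r x ∧ r x < δ) ∧
      (F : Set (Eucl n)).PairwiseDisjoint (fun x => closedBall x (r x)) ∧
      volume.real (S \ ⋃ x ∈ F, closedBall x (r x)) ≤ ε := by
  obtain ⟨t, r, htc, hts, htr, hμ, hdis⟩ := Besicovitch.exists_disjoint_closedBall_covering_ae (volume : Measure (Eucl n))
    (fun _ => Set.univ) S (fun x _ η hη => by
      rw [Set.univ_inter]; exact Set.nonempty_Ioo.2 hη) (fun _ => δ) (fun _ _ => hδ)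
  have : Countable t := htc.to_subtype
  have hlim := tendsto_measure_iInter_atTop (μ := (volume : Measure (Eucl n)))
    (s := fun F : Finset t => S \ ⋃ x ∈ F, closedBall (x : Eucl n) (r x))
    (fun F => (hS.measurableSet.diff (Finset.measurableSet_biUnion _ fun x _ => measurableSet_closedBall)).nullMeasurableSet)
    (fun F F' hFF => Set.sdiff_subset_sdiff_right (Set.biUnion_subset_biUnion_left hFF))
    ⟨∅, ((measure_mono Set.sdiff_subset).trans_lt hS.measure_lt_top).ne⟩
  have hz : volume (⋂ F : Finset t, S \ ⋃ x ∈ F, closedBall (x : Eucl n) (r x)) = 0 := by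
    refine measure_mono_null ?_ hμ
    intro z hz
    rw [Set.mem_iInter] at hz
    refine ⟨(hz ∅).1, fun hc => ?_⟩
    rw [Set.mem_iUnion₂] at hc
    obtain ⟨x, hx, hzx⟩ := hc
    apply (hz {⟨x, hx⟩}).2
    simpa using hzx
  rw [hz] at hlim
  obtain ⟨F, hF⟩ := (hlim.eventually_lt_const (ENNReal.ofReal_pos.2 hε)).exists
  refine ⟨F.map (Function.Embedding.subtype _), r, ?_, ?_, ?_, ?_⟩
  · intro x hx
    simp only [Finset.coe_map, Set.mem_image] at hx
    obtain ⟨x', -, rfl⟩ := hx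
    exact hts x'.2
  · intro x hx
    rw [Finset.mem_map] at hx
    obtain ⟨x', -, rfl⟩ := hx
    exact (htr _ x'.2).2
  · refine hdis.subset ?_
    intro x hx
    simp only [Finset.coe_map, Set.mem_image] at hx
    obtain ⟨x', -, rfl⟩ := hx
    exact x'.2
  · have e : (⋃ x ∈ F.map (Function.Embedding.subtype _), closedBall x (r x)) = ⋃ x ∈ F, closedBall (x : Eucl n) (r x) := by
      ext z; simp
    rw [e]
    exact ENNReal.toReal_le_of_le_ofReal hε.le hF.le

lemma vol_shell (p : Eucl n) {r κ : ℝ} (hr : 0 < r) (hκ : 0 < κ) (hκ1 : κ < 1) :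
    (volume : Measure (Eucl n)).real (closedBall p r \ ball p (κ * r)) = omegaN n * r ^ n * (1 - κ ^ n) := by
  have hsub : ball p (κ * r) ⊆ closedBall p r := ball_subset_closedBall.trans (closedBall_subset_closedBall (by nlinarith))
  have hpos : 0 < κ * r := by positivity
  rw [measureReal_sdiff hsub measurableSet_ball measure_closedBall_lt_top.ne, vol_cb p hr.le]
  have : (volume : Measure (Eucl n)).real (ball p (κ * r)) = (κ * r) ^ n * omegaN n := by
    rw [measureReal_def, Measure.addHaar_ball_of_pos volume p hpos, ENNReal.toReal_mul, omegaN, measureReal_def,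
      ENNReal.toReal_ofReal (by positivity)]
    simp
  rw [this, mul_pow]; ring

lemma mulC_split (φ : C_c(Eucl n, ℂ)) (u : C(Eucl n, ℂ)) : φ = mulC φ u + mulC φ (1 - u) := by
  apply DFunLike.ext
  intro x
  rw [CompactlySupportedContinuousMap.add_apply, mulC_apply, mulC_apply]
  simp only [ContinuousMap.sub_apply, ContinuousMap.one_apply]
  ring

lemma ball_est {d : ℕ} {Ψ : ConvFn n → RadonMeasure n} (hΨ : MemPdLV d Ψ) (hh : IsHomogeneousDeg (n + d) Ψ)
    (h0 : ∀ (a : Eucl n) (s : ℝ) (v : Eucl n) (φ : C_c(Eucl n, ℂ)), Qf d Ψ φ 0 (cone a) s v = 0)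
    {f : ConvFn n} {y g : Eucl n → Eucl n} {c : ℝ} (H : Duo f y g c) (φ : C_c(Eucl n, ℂ)) :
    ∃ C₁ : ℝ, 0 ≤ C₁ ∧ ∀ κ : ℝ, 0 < κ → κ < 1 → ∀ ε > 0, ∃ δ, 0 < δ ∧ δ ≤ 1 ∧ ∀ p ∈ y '' tsupport ⇑φ, ∀ r, 0 < r → r < δ →
      ∀ χ : C_c(Eucl n, ℂ), (∀ q ∈ closedBall p (κ * r), χ q = 1) → (∀ q, ‖χ q‖ ≤ 1) → tsupport ⇑χ ⊆ ball p r →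
        ‖(Ψ f).1 (mulC φ ⟨fun z => χ (y z), χ.1.continuous.comp H.yc⟩)‖ ≤ (ε + C₁ * (1 - κ ^ n)) * r ^ n := by
  obtain ⟨R, hR, hsR⟩ := cc_tsupport_ball φ
  obtain ⟨M, hM, hb⟩ := cc_bound φ
  obtain ⟨Ly, hLy0, hLy⟩ : ∃ Ly : ℝ, 0 ≤ Ly ∧ ∀ x ∈ tsupport ⇑φ, ‖y x‖ ≤ Ly := by
    obtain ⟨B, hB⟩ := (cc_tsupport_compact φ).exists_bound_of_continuousOn H.yc.continuousOn
    exact ⟨max B 0, le_max_right _ _, fun x hx => (hB x hx).trans (le_max_left _ _)⟩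
  obtain ⟨Lf, hLf0, hLf⟩ := conv_bound f R
  have hc := H.c0
  set L := Lf + (Ly + 1) * (2 * R + 2) + (2 * R + 1) + c + R with hL
  have hL0 : 0 ≤ L := by positivity
  obtain ⟨C, hC0, hC⟩ := lemmaC hΨ hh R L hR.le hL0
  have hω := omegaN_pos (n := n)
  refine ⟨C * (2 * M) * omegaN n, by positivity, fun κ hκ hκ1 ε hε => ?_⟩
  obtain ⟨δ', hδ', hD⟩ := lemmaD hΨ hh h0 φ L ε hε
  refine ⟨min 1 (δ' / (c + 1)), by positivity, min_le_left _ _, ?_⟩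
  rintro _ ⟨x₀, hx₀, rfl⟩ r hr hrδ χ hχ1 hχb hχs
  obtain ⟨h, Y, hYc, hYr, hYs, hYy, hhf, hhe⟩ := local_model H (y x₀) r hr
  rw [H.gy] at hhe
  set p := y x₀ with hp
  have hr1 : r < 1 := hrδ.trans_le (min_le_left _ _)
  have hr2 : r * (c + 1) < δ' := by
    have := hrδ.trans_le (min_le_right _ _)
    rwa [lt_div_iff₀ (by positivity)] at this
  have hx₀R : ‖x₀‖ ≤ R := by simpa using hsR hx₀
  have hpL : ‖p‖ ≤ Ly := hLy _ hx₀
  have hfa := hLf x₀ (hsR hx₀)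
  let u : C(Eucl n, ℂ) := ⟨fun z => χ (y z), χ.1.continuous.comp H.yc⟩
  change ‖(Ψ f).1 (mulC φ u)‖ ≤ _
  -- locality
  have hloc : (Ψ f).1 (mulC φ u) = (Ψ h).1 (mulC φ u) := by
    refine hΨ.1 f h (y ⁻¹' ball p r) (isOpen_ball.preimage H.yc) (fun z hz => ?_) _ ?_
    · have hz' : ‖y z - p‖ < r := by rw [← dist_eq_norm]; exact hz
      exact (hhf z hz'.le).symm
    · refine (tsupport_mulC_right φ u).trans ?_
      refine Set.Subset.trans ?_ (Set.preimage_mono hχs)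
      exact closure_minimal (fun z hz => subset_closure hz) ((isClosed_tsupport _).preimage H.yc)
  have hsplit : (Ψ h).1 (mulC φ u) = (Ψ h).1 φ - (Ψ h).1 (mulC φ (1 - u)) := by
    conv_rhs => rw [mulC_split φ u]
    rw [map_add]
    have e : (mulC (mulC φ u + mulC φ (1 - u)) (1 - u)) = mulC φ (1 - u) := by rw [← mulC_split φ u]
    rw [e]; ring
  rw [hloc, hsplit]
  have hA : ‖(Ψ h).1 φ‖ ≤ ε * r ^ n := by
    refine hD r x₀ (f.1 x₀ - inner ℝ p x₀) p h hr (by nlinarith) ?_ ?_ ?_ ?_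
    · rw [hL]; nlinarith
    · have h1 : |f.1 x₀ - inner ℝ p x₀| ≤ |f.1 x₀| + |inner ℝ p x₀| := abs_sub _ _
      have h2 : |inner ℝ p x₀| ≤ Ly * R := (abs_real_inner_le_norm _ _).trans (by gcongr)
      rw [hL]; nlinarith
    · rw [hL]; nlinarith
    · intro x
      have := hhe x
      rw [inner_sub_right] at this
      have e : f.1 x₀ - inner ℝ p x₀ + inner ℝ p x + r * ‖x - x₀‖ = f.1 x₀ + (inner ℝ p x - inner ℝ p x₀) + r * ‖x - x₀‖ := by ring
      rw [e]
      refine this.trans ?_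
      nlinarith
  have hB : ‖(Ψ h).1 (mulC φ (1 - u))‖ ≤ C * (2 * M) * (omegaN n * r ^ n * (1 - κ ^ n)) := by
    have h1 := hC h Set.univ Y isOpen_univ hYc.continuousOn (fun x _ z => hYs x z) (fun x _ => ?_) (fun x hx => ?_)
      (mulC φ (1 - u)) (2 * M) (by positivity) ((tsupport_mulC_left _ _).trans hsR) (Set.subset_univ _) (fun x => ?_)
    · refine h1.trans ?_
      rw [← vol_shell p hr hκ hκ1]
      refine mul_le_mul_of_nonneg_left ?_ (by positivity)
      refine measureReal_mono ?_ ((measure_mono Set.sdiff_subset).trans_lt measure_closedBall_lt_top).ne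
      rintro _ ⟨z, hz, rfl⟩
      refine ⟨by rw [mem_closedBall, dist_eq_norm]; exact hYr z, fun hzb => ?_⟩
      have hsub : tsupport ⇑(mulC φ (1 - u)) ⊆ (Y ⁻¹' ball p (κ * r))ᶜ := by
        refine closure_minimal (fun w hw hwb => hw ?_) (isOpen_ball.preimage hYc).isClosed_compl
        have hw1 : ‖Y w - p‖ < κ * r := by rw [← dist_eq_norm]; exact hwb
        have hw2 := hYy w (hw1.trans (by nlinarith))
        rw [mulC_apply]
        have : u w = 1 := hχ1 (y w) (by rw [← hw2]; exact ball_subset_closedBall hwb)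
        simp only [ContinuousMap.sub_apply, ContinuousMap.one_apply, this, sub_self, mul_zero]
      exact hsub hz hzb
    · have h1 := hYr x
      have h2 := norm_le_norm_add_norm_sub p (Y x)
      rw [norm_sub_rev] at h2
      rw [hL]; nlinarith
    · have hxR : ‖x‖ ≤ R + 1 := by simpa using hx
      have h1 := hhe x
      have h2 : ‖x - x₀‖ ≤ 2 * R + 1 := (norm_sub_le _ _).trans (by linarith)
      have h3 : |inner ℝ p (x - x₀)| ≤ Ly * (2 * R + 1) := (abs_real_inner_le_norm _ _).trans (by gcongr)
      have h4 : r * ‖x - x₀‖ ≤ 1 * (2 * R + 1) := by gcongr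
      have h4' : 0 ≤ r * ‖x - x₀‖ := by positivity
      have h5 : c * r ^ 2 ≤ c * 1 := by gcongr; nlinarith
      rw [abs_le] at h1 h3 hfa ⊢
      constructor <;> rw [hL] <;> nlinarith
    · rw [mulC_apply, norm_mul]
      have h1 : ‖(1 - u) x‖ ≤ 2 := by
        simp only [ContinuousMap.sub_apply, ContinuousMap.one_apply]
        refine (norm_sub_le _ _).trans ?_
        have : ‖u x‖ ≤ 1 := hχb (y x)
        rw [norm_one]; linarith
      calc _ ≤ M * 2 := by gcongr; exact hb x
        _ = _ := by ring
  refine (norm_sub_le _ _).trans ((add_le_add hA hB).trans (le_of_eq ?_))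
  ring
end Aux11

section Aux12
open MeasureTheory Filter Topology Metric
variable {n : ℕ}

lemma exists_kappa (n : ℕ) {ε : ℝ} (hε : 0 < ε) : ∃ κ : ℝ, 0 < κ ∧ κ < 1 ∧ 1 - κ ^ n ≤ ε := by
  have hc : Tendsto (fun κ : ℝ => 1 - κ ^ n) (𝓝[<] 1) (𝓝 (1 - 1 ^ n)) :=
    ((by fun_prop : Continuous fun κ : ℝ => 1 - κ ^ n).tendsto 1).mono_left nhdsWithin_le_nhds
  rw [one_pow, sub_self] at hc
  obtain ⟨κ, h1, h2⟩ := ((hc.eventually_lt_const hε).and (Ioo_mem_nhdsLT (zero_lt_one' ℝ))).exists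
  exact ⟨κ, h2.1, h2.2, h1.le⟩

lemma sum_mulC_split (φ : C_c(Eucl n, ℂ)) (F : Finset (Eucl n)) (u : Eucl n → C(Eucl n, ℂ)) :
    φ = ∑ p ∈ F, mulC φ (u p) + mulC φ (1 - ∑ p ∈ F, u p) := by
  have h : ∑ p ∈ F, mulC φ (u p) = mulC φ (∑ p ∈ F, u p) := by
    induction F using Finset.induction_on with
    | empty =>
      apply DFunLike.ext
      intro x
      simp [mulC_apply]
    | insert a s ha ih =>
      rw [Finset.sum_insert ha, Finset.sum_insert ha, ih]
      apply DFunLike.ext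
      intro x
      simp [mulC_apply, mul_add]
  rw [h]
  exact mulC_split _ _

set_option maxHeartbeats 1000000 in
lemma lemmaZ {d : ℕ} {Ψ : ConvFn n → RadonMeasure n} (hΨ : MemPdLV d Ψ) (hh : IsHomogeneousDeg (n + d) Ψ)
    (h0 : ∀ (a : Eucl n) (s : ℝ) (v : Eucl n) (φ : C_c(Eucl n, ℂ)), Qf d Ψ φ 0 (cone a) s v = 0)
    {f : ConvFn n} {y g : Eucl n → Eucl n} {c : ℝ} (H : Duo f y g c) (φ : C_c(Eucl n, ℂ)) : (Ψ f).1 φ = 0 := by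
  obtain ⟨R, hR, hsR⟩ := cc_tsupport_ball φ
  obtain ⟨M, hM, hb⟩ := cc_bound φ
  obtain ⟨Ly, hLy0, hLy⟩ : ∃ Ly : ℝ, 0 ≤ Ly ∧ ∀ x ∈ tsupport ⇑φ, ‖y x‖ ≤ Ly := by
    obtain ⟨B, hB⟩ := (cc_tsupport_compact φ).exists_bound_of_continuousOn H.yc.continuousOn
    exact ⟨max B 0, le_max_right _ _, fun x hx => (hB x hx).trans (le_max_left _ _)⟩
  obtain ⟨Lf, hLf0, hLf⟩ := conv_bound f (R + 1)
  obtain ⟨C₁, hC₁, hball⟩ := ball_est hΨ hh h0 H φ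
  obtain ⟨C, hC0, hC⟩ := lemmaC hΨ hh R (Lf + (Ly + 1)) hR.le (by positivity)
  have hω := omegaN_pos (n := n)
  set V := (volume : Measure (Eucl n)).real (closedBall 0 (Ly + 1)) with hV
  have hV0 : 0 ≤ V := measureReal_nonneg
  set K := (1 + C₁) * (V / omegaN n) + C * (2 * M) * (1 + V) with hK
  have hK0 : 0 ≤ K := by positivity
  suffices hmain : ∀ ε > 0, ‖(Ψ f).1 φ‖ ≤ ε * K by
    by_contra hne
    have hpos : 0 < ‖(Ψ f).1 φ‖ := norm_pos_iff.2 hne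
    have := hmain (‖(Ψ f).1 φ‖ / (2 * (K + 1))) (by positivity)
    have h2 : ‖(Ψ f).1 φ‖ / (2 * (K + 1)) * K < ‖(Ψ f).1 φ‖ := by
      rw [div_mul_eq_mul_div, div_lt_iff₀ (by positivity)]
      nlinarith
    linarith
  intro ε hε
  obtain ⟨κ, hκ0, hκ1, hκε⟩ := exists_kappa n hε
  obtain ⟨δ, hδ0, hδ1, hδ⟩ := hball κ hκ0 hκ1 ε hε
  set S := y '' tsupport ⇑φ with hS
  have hSc : IsCompact S := (cc_tsupport_compact φ).image H.yc
  obtain ⟨F, r, hFS, hFr, hdis, hcov⟩ := finite_cover S hSc δ ε hδ0 hε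
  have hcut : ∀ p, ∃ χ : C_c(Eucl n, ℂ), p ∈ F → (∀ q ∈ closedBall p (κ * r p), χ q = 1) ∧ (∀ q, ‖χ q‖ ≤ 1) ∧ tsupport ⇑χ ⊆ ball p (r p) := by
    intro p
    by_cases hp : p ∈ F
    · have hrp := (hFr p hp).1
      obtain ⟨χ, h1, h2, h3⟩ := exists_cutoff (closedBall p (κ * r p)) (ball p (r p)) (isCompact_closedBall _ _) isOpen_ball
        (closedBall_subset_ball (by nlinarith))
      exact ⟨χ, fun _ => ⟨h1, h2, h3⟩⟩
    · exact ⟨0, fun h => absurd h hp⟩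
  choose χ hχ using hcut
  let u : Eucl n → C(Eucl n, ℂ) := fun p => ⟨fun z => χ p (y z), (χ p).1.continuous.comp H.yc⟩
  have hu0 : ∀ p w, y w ∉ tsupport ⇑(χ p) → u p w = 0 := fun p w h => by
    change χ p (y w) = 0
    exact image_eq_zero_of_notMem_tsupport h
  have hsumr : (∑ p ∈ F, r p ^ n) * omegaN n ≤ V := by
    have h1 : (volume : Measure (Eucl n)).real (⋃ p ∈ F, closedBall p (r p)) = ∑ p ∈ F, r p ^ n * omegaN n := by
      rw [measureReal_biUnion_finset hdis (fun p _ => measurableSet_closedBall)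
        (fun p _ => measure_closedBall_lt_top.ne)]
      exact Finset.sum_congr rfl fun p hp => vol_cb p (hFr p hp).1.le
    rw [Finset.sum_mul, ← h1]
    refine measureReal_mono ?_ measure_closedBall_lt_top.ne
    intro z hz
    rw [Set.mem_iUnion₂] at hz
    obtain ⟨p, hp, hz⟩ := hz
    obtain ⟨x, hx, hxp⟩ := hFS hp
    have hpn : ‖p‖ ≤ Ly := by rw [← hxp]; exact hLy x hx
    rw [mem_closedBall, dist_eq_norm] at hz
    rw [mem_closedBall, dist_zero_right]
    have := norm_le_norm_add_norm_sub p z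
    rw [norm_sub_rev] at this
    have := (hFr p hp).2
    linarith
  have hsum1 : ‖∑ p ∈ F, (Ψ f).1 (mulC φ (u p))‖ ≤ ε * ((1 + C₁) * (V / omegaN n)) := by
    calc _ ≤ ∑ p ∈ F, (ε + C₁ * ε) * r p ^ n := by
          refine norm_sum_le_of_le _ fun p hp => ?_
          obtain ⟨h1, h2, h3⟩ := hχ p hp
          have hrp := hFr p hp
          refine (hδ p (hFS hp) (r p) hrp.1 hrp.2 (χ p) h1 h2 h3).trans ?_
          have := hrp.1
          gcongr
      _ = (ε + C₁ * ε) * ∑ p ∈ F, r p ^ n := by rw [Finset.mul_sum]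
      _ ≤ (ε + C₁ * ε) * (V / omegaN n) := by
          gcongr
          rwa [le_div_iff₀ hω]
      _ = _ := by ring
  have hW : tsupport ⇑φ ⊆ y ⁻¹' ball (0 : Eucl n) (Ly + 1) := fun x hx => by
    rw [Set.mem_preimage, mem_ball, dist_zero_right]
    have := hLy x hx
    linarith
  have hrem : ‖(Ψ f).1 (mulC φ (1 - ∑ p ∈ F, u p))‖ ≤ ε * (C * (2 * M) * (1 + V)) := by
    have h1 := hC f (y ⁻¹' ball 0 (Ly + 1)) y (isOpen_ball.preimage H.yc) H.yc.continuousOn (fun x _ z => H.sub x z)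
      (fun x hx => ?_) (fun x hx => ?_) (mulC φ (1 - ∑ p ∈ F, u p)) (2 * M) (by positivity)
      ((tsupport_mulC_left _ _).trans hsR) ((tsupport_mulC_left _ _).trans hW) (fun x => ?_)
    · refine h1.trans ?_
      have hvol : volume.real (y '' tsupport ⇑(mulC φ (1 - ∑ p ∈ F, u p))) ≤ ε + ε * V := by
        have hsub : y '' tsupport ⇑(mulC φ (1 - ∑ p ∈ F, u p)) ⊆
            (S \ ⋃ p ∈ F, closedBall p (r p)) ∪ ⋃ p ∈ F, (closedBall p (r p) \ ball p (κ * r p)) := by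
          rintro _ ⟨z, hz, rfl⟩
          by_cases hzc : y z ∈ ⋃ p ∈ F, closedBall p (r p)
          · right
            rw [Set.mem_iUnion₂] at hzc ⊢
            obtain ⟨p, hp, hzp⟩ := hzc
            refine ⟨p, hp, hzp, fun hzb => ?_⟩
            have hsub2 : tsupport ⇑(mulC φ (1 - ∑ p ∈ F, u p)) ⊆ (y ⁻¹' ball p (κ * r p))ᶜ := by
              refine closure_minimal (fun w hw hwb => hw ?_) (isOpen_ball.preimage H.yc).isClosed_compl
              have hwb' : y w ∈ ball p (κ * r p) := hwb
              rw [mulC_apply]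
              have hs1 : (∑ p ∈ F, u p) w = 1 := by
                rw [ContinuousMap.sum_apply, Finset.sum_eq_single_of_mem p hp]
                · exact (hχ p hp).1 _ (ball_subset_closedBall hwb')
                · intro p' hp' hne
                  have hmem : y w ∈ closedBall p (r p) := by
                    refine (ball_subset_closedBall.trans (closedBall_subset_closedBall ?_)) hwb'
                    have := (hFr p hp).1
                    nlinarith
                  have hnot : y w ∉ tsupport ⇑(χ p') := fun hmem' =>
                    Set.disjoint_left.1 (hdis hp' hp hne) (ball_subset_closedBall ((hχ p' hp').2.2 hmem')) hmem
                  exact hu0 _ _ hnot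
              simp only [ContinuousMap.sub_apply, ContinuousMap.one_apply, hs1, sub_self, mul_zero]
            exact hsub2 hz hzb
          · left
            exact ⟨⟨z, tsupport_mulC_left _ _ hz, rfl⟩, hzc⟩
        have hfin : ∀ p ∈ F, (volume : Measure (Eucl n)) (closedBall p (r p) \ ball p (κ * r p)) ≠ ⊤ := fun p _ =>
          ((measure_mono Set.sdiff_subset).trans_lt measure_closedBall_lt_top).ne
        have hfin2 : (volume : Measure (Eucl n)) (⋃ p ∈ F, (closedBall p (r p) \ ball p (κ * r p))) ≠ ⊤ :=
          (measure_biUnion_lt_top F.finite_toSet fun p hp => (hfin p hp).lt_top).ne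
        have hfin1 : (volume : Measure (Eucl n)) (S \ ⋃ p ∈ F, closedBall p (r p)) ≠ ⊤ :=
          ((measure_mono Set.sdiff_subset).trans_lt hSc.measure_lt_top).ne
        calc _ ≤ _ := measureReal_mono hsub (measure_union_ne_top hfin1 hfin2)
          _ ≤ _ := measureReal_union_le _ _
          _ ≤ ε + ∑ p ∈ F, omegaN n * r p ^ n * ε := by
            refine add_le_add hcov ((measureReal_biUnion_finset_le _ _).trans (Finset.sum_le_sum fun p hp => ?_))
            have hrp := (hFr p hp).1
            rw [vol_shell p hrp hκ0 hκ1]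
            gcongr
          _ = ε + ε * ((∑ p ∈ F, r p ^ n) * omegaN n) := by
            rw [Finset.sum_mul, Finset.mul_sum]
            congr 1
            exact Finset.sum_congr rfl fun p _ => by ring
          _ ≤ _ := by gcongr
      calc _ ≤ C * (2 * M) * (ε + ε * V) := by gcongr
        _ = _ := by ring
    · have : y x ∈ ball 0 (Ly + 1) := hx
      rw [mem_ball, dist_zero_right] at this
      linarith
    · have := hLf x hx
      linarith
    · rw [mulC_apply, norm_mul]
      have hs : ‖(∑ p ∈ F, u p) x‖ ≤ 1 := by
        rw [ContinuousMap.sum_apply]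
        by_cases hex : ∃ p ∈ F, y x ∈ closedBall p (r p)
        · obtain ⟨p, hp, hmem⟩ := hex
          rw [Finset.sum_eq_single_of_mem p hp]
          · exact (hχ p hp).2.1 _
          · intro p' hp' hne
            have hnot : y x ∉ tsupport ⇑(χ p') := fun hmem' =>
              Set.disjoint_left.1 (hdis hp' hp hne) (ball_subset_closedBall ((hχ p' hp').2.2 hmem')) hmem
            exact hu0 _ _ hnot
        · rw [Finset.sum_eq_zero]
          · simp
          · intro p hp
            have hnot : y x ∉ tsupport ⇑(χ p) := fun hmem' => hex ⟨p, hp, ball_subset_closedBall ((hχ p hp).2.2 hmem')⟩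
            exact hu0 _ _ hnot
      have h1 : ‖(1 - ∑ p ∈ F, u p) x‖ ≤ 2 := by
        simp only [ContinuousMap.sub_apply, ContinuousMap.one_apply]
        refine (norm_sub_le _ _).trans ?_
        rw [norm_one]; linarith
      calc _ ≤ M * 2 := by gcongr; exact hb x
        _ = _ := by ring
  have e : (Ψ f).1 φ = ∑ p ∈ F, (Ψ f).1 (mulC φ (u p)) + (Ψ f).1 (mulC φ (1 - ∑ p ∈ F, u p)) := by
    conv_lhs => rw [sum_mulC_split φ F u]
    rw [map_add, map_sum]
  rw [e, hK, mul_add]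
  exact (norm_add_le _ _).trans (add_le_add hsum1 hrem)
end Aux12

section Aux13
open MeasureTheory Filter Topology Metric
variable {n : ℕ}

def addSq (f : ConvFn n) (ε : ℝ≥0) : ConvFn n :=
  ⟨⟨fun x => f.1 x + (ε : ℝ) * ‖x‖ ^ 2, by fun_prop⟩, by
    have h1 : ConvexOn ℝ Set.univ (fun x : Eucl n => ‖x‖ ^ 2) :=
      (convexOn_norm (convex_univ (𝕜 := ℝ) (E := Eucl n))).pow (fun x _ => norm_nonneg x) 2
    exact f.2.add (h1.smul ε.2)⟩

lemma addSq_apply (f : ConvFn n) (ε : ℝ≥0) (x : Eucl n) : (addSq f ε).1 x = f.1 x + (ε : ℝ) * ‖x‖ ^ 2 := rfl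

lemma addSq_contDiff {f : ConvFn n} (hf : ContDiff ℝ 2 (⇑f.1)) (ε : ℝ≥0) : ContDiff ℝ 2 (⇑(addSq f ε).1) := by
  change ContDiff ℝ 2 fun x => f.1 x + (ε : ℝ) * ‖x‖ ^ 2
  exact hf.add (contDiff_const.mul (contDiff_norm_sq ℝ))

lemma addSq_sub {f : ConvFn n} (ε : ℝ≥0) {x p : Eucl n} (h : SubG f x p) :
    SubG (addSq f ε) x (p + (2 * (ε : ℝ)) • x) := by
  intro z
  have h1 := h z
  have h2 : ‖z‖ ^ 2 = ‖x‖ ^ 2 + 2 * inner ℝ x (z - x) + ‖z - x‖ ^ 2 := by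
    rw [← norm_add_sq_real, add_sub_cancel]
  rw [addSq_apply, addSq_apply, inner_add_left, real_inner_smul_left, h2]
  have h3 : 0 ≤ (ε : ℝ) * ‖z - x‖ ^ 2 := by positivity
  nlinarith

lemma addSq_gr {f : ConvFn n} (hf : ContDiff ℝ 2 (⇑f.1)) (ε : ℝ≥0) (x : Eucl n) :
    gr (addSq f ε) x = gr f x + (2 * (ε : ℝ)) • x :=
  (gr_of_sub ((addSq_contDiff hf ε).differentiable (by norm_num) x)
    (addSq_sub ε (sub_gr (hf.differentiable (by norm_num) x)))).symm

lemma addSq_strong {f : ConvFn n} (hf : ContDiff ℝ 2 (⇑f.1)) {ε : ℝ≥0} (hε : 0 < ε) (x z : Eucl n) :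
    ‖z - x‖ ≤ (2 * (ε : ℝ))⁻¹ * ‖gr (addSq f ε) z - gr (addSq f ε) x‖ := by
  have hε' : (0 : ℝ) < ε := by exact_mod_cast hε
  have h1 := gr_mono hf x z
  have h2 : inner ℝ (gr (addSq f ε) z - gr (addSq f ε) x) (z - x) =
      inner ℝ (gr f z - gr f x) (z - x) + 2 * (ε : ℝ) * ‖z - x‖ ^ 2 := by
    rw [addSq_gr hf, addSq_gr hf, ← real_inner_self_eq_norm_sq, ← real_inner_smul_left, ← inner_add_left]
    congr 1; module
  have h3 := real_inner_le_norm (gr (addSq f ε) z - gr (addSq f ε) x) (z - x)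
  rw [inv_mul_eq_div, le_div_iff₀ (by positivity)]
  rcases (norm_nonneg (z - x)).eq_or_lt with h | h
  · rw [← h, zero_mul]; positivity
  · refine le_of_mul_le_mul_right ?_ h
    nlinarith

lemma addSq_surj {f : ConvFn n} (hf : ContDiff ℝ 2 (⇑f.1)) {ε : ℝ≥0} (hε : 0 < ε) (q : Eucl n) :
    ∃ z, gr (addSq f ε) z = q := by
  have hε' : (0 : ℝ) < ε := by exact_mod_cast hε
  have hc : Continuous fun z : Eucl n => (addSq f ε).1 z - inner ℝ q z := by fun_prop
  have hl : Tendsto (fun z : Eucl n => (addSq f ε).1 z - inner ℝ q z) (cocompact _) atTop := by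
    set B : ℝ := ‖gr f 0‖ + ‖q‖ with hB
    have h1 : Tendsto (fun t : ℝ => t * ((ε : ℝ) * t + (-B)) + f.1 0) atTop atTop := by
      refine tendsto_atTop_add_const_right _ _ (tendsto_id.atTop_mul_atTop₀ ?_)
      exact tendsto_atTop_add_const_right _ _ (tendsto_id.const_mul_atTop hε')
    refine tendsto_atTop_mono (fun z => ?_) (h1.comp (tendsto_norm_cocompact_atTop (E := Eucl n)))
    have h2 := sub_gr (hf.differentiable (by norm_num) (0 : Eucl n)) z
    rw [sub_zero] at h2
    have h3 := neg_le_of_abs_le (abs_real_inner_le_norm (gr f 0) z)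
    have h4 := real_inner_le_norm q z
    simp only [Function.comp, addSq_apply]
    rw [hB]
    nlinarith
  obtain ⟨z, hz⟩ := hc.exists_forall_le hl
  refine ⟨z, (gr_of_sub ((addSq_contDiff hf ε).differentiable (by norm_num) z) fun w => ?_).symm⟩
  have := hz w
  rw [inner_sub_right]
  linarith

lemma addSq_duo {f : ConvFn n} (hf : ContDiff ℝ 2 (⇑f.1)) {ε : ℝ≥0} (hε : 0 < ε) :
    ∃ g, Duo (addSq f ε) (gr (addSq f ε)) g (2 * (ε : ℝ))⁻¹ := by
  choose g hg using addSq_surj hf hε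
  have hc := addSq_contDiff hf ε
  have hlip : ∀ q q', ‖g q - g q'‖ ≤ (2 * (ε : ℝ))⁻¹ * ‖q - q'‖ := by
    intro q q'
    have := addSq_strong hf hε (g q') (g q)
    rwa [hg, hg] at this
  refine ⟨g, ⟨gr_continuous hc, ?_, ?_, hg, by positivity, hlip, fun x => sub_gr (hc.differentiable (by norm_num) x), 
    fun x q h => gr_of_sub (hc.differentiable (by norm_num) x) h⟩⟩
  · have : LipschitzWith (2 * ε)⁻¹ g := LipschitzWith.of_dist_le_mul fun q q' => by
      rw [dist_eq_norm, dist_eq_norm]; simpa using hlip q q'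
    exact this.continuous
  · intro x
    have := addSq_strong hf hε x (g (gr (addSq f ε) x))
    rw [hg, sub_self, norm_zero, mul_zero] at this
    exact sub_eq_zero.1 (norm_le_zero_iff.1 this)

lemma zero_of_cone {d : ℕ} {Ψ : ConvFn n → RadonMeasure n} (hΨ : MemPdLV d Ψ) (hh : IsHomogeneousDeg (n + d) Ψ)
    (h0 : ∀ (a : Eucl n) (s : ℝ) (v : Eucl n) (φ : C_c(Eucl n, ℂ)), Qf d Ψ φ 0 (cone a) s v = 0)
    {f : ConvFn n} (hf : ContDiff ℝ 2 (⇑f.1)) (φ : C_c(Eucl n, ℂ)) : (Ψ f).1 φ = 0 := by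
  have ht : Tendsto (fun ε : ℝ≥0 => addSq f ε) (𝓝[>] 0) (𝓝 f) := by
    apply tendsto_convFn
    intro R δ hδ
    have h1 : Tendsto (fun ε : ℝ≥0 => (ε : ℝ) * R ^ 2) (𝓝[>] 0) (𝓝 0) := by
      have : Tendsto (fun ε : ℝ≥0 => (ε : ℝ)) (𝓝[>] 0) (𝓝 0) :=
        (NNReal.continuous_coe.tendsto 0).mono_left nhdsWithin_le_nhds
      simpa using this.mul_const (R ^ 2)
    filter_upwards [h1.eventually (gt_mem_nhds hδ)] with ε he x hx
    rw [addSq_apply, add_sub_cancel_left, abs_of_nonneg (by positivity)]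
    refine lt_of_le_of_lt ?_ he
    gcongr
  have h2 : Tendsto (fun ε : ℝ≥0 => (Ψ (addSq f ε)).1 φ) (𝓝[>] 0) (𝓝 ((Ψ f).1 φ)) :=
    ((hΨ.2.1 φ).tendsto f).comp ht
  refine tendsto_nhds_unique h2 (tendsto_const_nhds.congr' ?_)
  filter_upwards [self_mem_nhdsWithin] with ε hε
  obtain ⟨g, H⟩ := addSq_duo hf (ε := ε) hε
  exact (lemmaZ hΨ hh h0 H φ).symm

lemma exists_rep {d : ℕ} {Ψ : ConvFn n → RadonMeasure n} (hΨ : MemPdLV d Ψ) (hh : IsHomogeneousDeg (n + d) Ψ) :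
    ∃ ψ : Eucl n → MvPolynomial (Fin (n + 1)) ℂ, Fam d ψ ∧ TopDegreeRepresentation Ψ ψ := by
  obtain ⟨ψ, h1, h2, h3⟩ := exists_psi hΨ hh
  have hψ : Fam d ψ := ⟨h1, h2⟩
  refine ⟨ψ, hψ, fun f hf φ => ?_⟩
  have h := zero_of_cone (Psi0_mem hψ hΨ) (Psi0_hom hψ hh) (Psi0_Qf hψ h3) hf φ
  rw [Psi0_apply, sub_eq_zero] at h
  rw [h, PsiP_rep hψ f hf φ]

def tst (s : ℝ) (v : Eucl n) : ConvFn n := addAffine (addSq (smulConv 0 (cone 0)) 2⁻¹) s v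

lemma tst_apply (s : ℝ) (v x : Eucl n) : (tst s v).1 x = 2⁻¹ * ‖x‖ ^ 2 + (s + inner ℝ v x) := by
  rw [tst, addAffine_apply, addSq_apply, smulConv_apply]; simp

lemma tst_contDiff (s : ℝ) (v : Eucl n) : ContDiff ℝ 2 (⇑(tst s v).1) := by
  have : (⇑(tst s v).1) = fun x => 2⁻¹ * ‖x‖ ^ 2 + (s + inner ℝ v x) := funext (tst_apply s v)
  rw [this]
  exact (contDiff_const.mul (contDiff_norm_sq ℝ)).add (contDiff_const.add (contDiff_const.inner ℝ contDiff_id))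

lemma tst_gr (s : ℝ) (v x : Eucl n) : gr (tst s v) x = x + v := by
  refine (gr_of_sub ((tst_contDiff s v).differentiable (by norm_num) x) fun z => ?_).symm
  have h2 : ‖z‖ ^ 2 = ‖x‖ ^ 2 + 2 * inner ℝ x (z - x) + ‖z - x‖ ^ 2 := by
    rw [← norm_add_sq_real, add_sub_cancel]
  rw [tst_apply, tst_apply, h2, inner_add_left, inner_sub_right v]
  nlinarith [sq_nonneg ‖z - x‖]

lemma tst_det (s : ℝ) (v x : Eucl n) : (hessMat (⇑(tst s v).1) x).det = 1 := by
  rw [← Dgr_det (tst_contDiff s v)]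
  have h1 := gr_hasFDeriv (tst_contDiff s v) x
  have h2 : HasFDerivAt (gr (tst s v)) (ContinuousLinearMap.id ℝ (Eucl n)) x := by
    have : gr (tst s v) = fun x => x + v := funext (tst_gr s v)
    rw [this]
    exact (hasFDerivAt_id x).add_const v
  rw [h1.unique h2, ContinuousLinearMap.det]
  simp

lemma rep_tst {Ψ : ConvFn n → RadonMeasure n} {ψ : Eucl n → MvPolynomial (Fin (n + 1)) ℂ}
    (h : TopDegreeRepresentation Ψ ψ) (s : ℝ) (v : Eucl n) (φ : C_c(Eucl n, ℂ)) :
    (Ψ (tst s v)).1 φ = ∫ x, φ x * MvPolynomial.eval (wvec ((tst s v).1 x) (x + v)) (ψ x) := by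
  rw [h _ (tst_contDiff s v) φ]
  refine integral_congr_ae (Eventually.of_forall fun x => ?_)
  simp only [tst_det, ← gr_coord, tst_gr, Complex.ofReal_one, mul_one]
  rfl

lemma eval_tst_cont {d : ℕ} {ψ : Eucl n → MvPolynomial (Fin (n + 1)) ℂ} (h : Fam d ψ) (s : ℝ) (v : Eucl n) :
    Continuous fun x => MvPolynomial.eval (wvec ((tst s v).1 x) (x + v)) (ψ x) :=
  h.evc.comp (f := fun x : Eucl n => (x, (tst s v).1 x, x + v)) (by fun_prop)

lemma rep_unique {d : ℕ} {Ψ : ConvFn n → RadonMeasure n} {ψ₁ ψ₂ : Eucl n → MvPolynomial (Fin (n + 1)) ℂ}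
    (h1 : Fam d ψ₁) (h2 : Fam d ψ₂) (r1 : TopDegreeRepresentation Ψ ψ₁) (r2 : TopDegreeRepresentation Ψ ψ₂) :
    ψ₁ = ψ₂ := by
  have key : ∀ (s : ℝ) (v x : Eucl n), MvPolynomial.eval (wvec ((tst s v).1 x) (x + v)) (ψ₁ x) =
      MvPolynomial.eval (wvec ((tst s v).1 x) (x + v)) (ψ₂ x) := by
    intro s v
    have c1 := eval_tst_cont h1 s v
    have c2 := eval_tst_cont h2 s v
    have hae := ae_eq_zero_of_integral_contDiff_smul_eq_zero (μ := (volume : Measure (Eucl n)))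
      (f := fun x => MvPolynomial.eval (wvec ((tst s v).1 x) (x + v)) (ψ₁ x) - 
        MvPolynomial.eval (wvec ((tst s v).1 x) (x + v)) (ψ₂ x)) (c1.sub c2).locallyIntegrable ?_
    · have := (Continuous.ae_eq_iff_eq volume (c1.sub c2) (continuous_const (y := (0 : ℂ)))).1 hae
      intro x
      exact sub_eq_zero.1 (congrFun this x)
    · intro g hg hgs
      have hgc : Continuous fun x => ((g x : ℝ) : ℂ) := Complex.continuous_ofReal.comp hg.continuous
      have hgs' : HasCompactSupport fun x => ((g x : ℝ) : ℂ) := hgs.comp_left (g := fun r : ℝ => (r : ℂ)) (by simp)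
      let φ : C_c(Eucl n, ℂ) := ⟨⟨fun x => ((g x : ℝ) : ℂ), hgc⟩, hgs'⟩
      have e1 := rep_tst r1 s v φ
      have e2 := rep_tst r2 s v φ
      have i1 : Integrable fun x => φ x * MvPolynomial.eval (wvec ((tst s v).1 x) (x + v)) (ψ₁ x) :=
        (hgc.mul c1).integrable_of_hasCompactSupport hgs'.mul_right
      have i2 : Integrable fun x => φ x * MvPolynomial.eval (wvec ((tst s v).1 x) (x + v)) (ψ₂ x) :=
        (hgc.mul c2).integrable_of_hasCompactSupport hgs'.mul_right
      have : (∫ x, (φ x * MvPolynomial.eval (wvec ((tst s v).1 x) (x + v)) (ψ₁ x) -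
          φ x * MvPolynomial.eval (wvec ((tst s v).1 x) (x + v)) (ψ₂ x))) = 0 := by
        rw [integral_sub i1 i2, ← e1, ← e2, sub_self]
      rw [← this]
      refine integral_congr_ae (Eventually.of_forall fun x => ?_)
      change g x • _ = ((g x : ℝ) : ℂ) * _ - ((g x : ℝ) : ℂ) * _
      rw [Complex.real_smul, mul_sub]
  have key2 : ∀ (a : Eucl n) (s : ℝ) (v : Eucl n), MvPolynomial.eval (wvec s v) (ψ₁ a) =
      MvPolynomial.eval (wvec s v) (ψ₂ a) := by
    intro a s v
    have := key (s - 2⁻¹ * ‖a‖ ^ 2 - inner ℝ (v - a) a) (v - a) a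
    rw [tst_apply, add_sub_cancel] at this
    rwa [show 2⁻¹ * ‖a‖ ^ 2 + (s - 2⁻¹ * ‖a‖ ^ 2 - inner ℝ (v - a) a + inner ℝ (v - a) a) = s by ring] at this
  funext a
  refine MvPolynomial.funext_set (fun _ => Set.range fun r : ℝ => (r : ℂ))
    (fun _ => Set.infinite_range_of_injective Complex.ofReal_injective) fun w hw => ?_
  choose r hr using fun i => hw i (Set.mem_univ i)
  have : w = wvec (r 0) (WithLp.toLp 2 fun i => r i.succ) := by
    funext i
    refine Fin.cases ?_ (fun j => ?_) i
    · simp [wvec, ← hr]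
    · simp [wvec, ← hr]
  rw [this]
  exact key2 a _ _
end Aux13

/-- For `Ψ ∈ P_dLV_{n+d}(ℝⁿ)` there exists a unique continuous family
`ψ` of `d`-homogeneous complex polynomials on `ℝ × ℝⁿ` (continuity being coefficientwise)
such that `Ψ(f; B) = ∫_B ψ(x)[f(x), ∇f(x)] det(D²f(x)) dx` on `C²` convex functions;
conversely every such `ψ` arises from some element of `P_dLV_{n+d}(ℝⁿ)`. -/
theorem top_degree_classification {n d : ℕ} (Ψ : ConvFn n → RadonMeasure n)
    (hΨ : MemPdLV d Ψ) (hhom : IsHomogeneousDeg (n + d) Ψ) :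
    (∃! ψ : Eucl n → MvPolynomial (Fin (n + 1)) ℂ,
      (∀ x, (ψ x).IsHomogeneous d) ∧
      (∀ m : Fin (n + 1) →₀ ℕ, Continuous fun x => (ψ x).coeff m) ∧
      TopDegreeRepresentation Ψ ψ) ∧
    (∀ ψ : Eucl n → MvPolynomial (Fin (n + 1)) ℂ,
      (∀ x, (ψ x).IsHomogeneous d) →
      (∀ m : Fin (n + 1) →₀ ℕ, Continuous fun x => (ψ x).coeff m) →
      ∃ Ψ' : ConvFn n → RadonMeasure n,
        MemPdLV d Ψ' ∧ IsHomogeneousDeg (n + d) Ψ' ∧ TopDegreeRepresentation Ψ' ψ) := by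
  constructor
  · obtain ⟨ψ, hψ, hr⟩ := exists_rep hΨ hhom
    refine ⟨ψ, ⟨hψ.hom, hψ.cont, hr⟩, ?_⟩
    rintro ψ' ⟨h1, h2, h3⟩
    exact rep_unique ⟨h1, h2⟩ hψ h3 hr
  · intro ψ h1 h2
    have hψ : Fam d ψ := ⟨h1, h2⟩
    exact ⟨PsiP ψ hψ, PsiP_mem hψ, PsiP_hom hψ, PsiP_rep hψ⟩

end
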